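/- arXiv:1210.6721 — 2 statements merged into one kernel-verified Lean document; each statement's English description precedes it below -/
import Mathlib

section
/- Counting formula for very well shaped sets: let p be a prime, let m, n be positive integers, and let G_1, …, G_n ∈ F_p[X_1, …, X_m] be degree 2 independent over F_p with total degrees at most d. Then there is a constant c depending only on m, n, d and C such that for every very well shaped set Ω ⊆ 𝕋_m with constant C satisfying μ(Ω) ≥ p^{−m/2}(log p)^{m(n+2)}, and every box Π = [α_1, β_1) × ⋯ × [α_n, β_n) ⊆ 𝕋_n, the number N(Ω; Π) of integer vectors x ∈ {0, …, p−1}^m with x/p ∈ Ω and ({G_1(x)/p}, …, {G_n(x)/p}) ∈ Π satisfies N(Ω; Π) ≥ λ(Π) μ(Ω) p^m − c · μ(Ω)^{(m−1)/m} p^{m−1/2} (log p)^{n+2}. -/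
open MeasureTheory

noncomputable section

abbrev Torus (m : ℕ) : Type := Fin m → AddCircle (1 : ℝ)

noncomputable def tmeas {m : ℕ} (Ω : Set (Torus m)) : ℝ := (volume Ω).toReal

noncomputable def torusDist {m : ℕ} (u w : Torus m) : ℝ :=
  Real.sqrt (∑ i, dist (u i) (w i) ^ 2)

noncomputable def torusDistSet {m : ℕ} (u : Torus m) (Ω : Set (Torus m)) : ℝ :=
  ⨅ w : Ω, torusDist u (w : Torus m)

def outerShell {m : ℕ} (Ω : Set (Torus m)) (ε : ℝ) : Set (Torus m) :=
  {u | u ∉ Ω ∧ torusDistSet u Ω < ε}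

def innerShell {m : ℕ} (Ω : Set (Torus m)) (ε : ℝ) : Set (Torus m) :=
  {u | u ∈ Ω ∧ torusDistSet u Ωᶜ < ε}

def IsWellShaped {m : ℕ} (Ω : Set (Torus m)) (C : ℝ) : Prop :=
  ∀ ε : ℝ, 0 < ε →
    tmeas (outerShell Ω ε) ≤ C * ε ∧ tmeas (innerShell Ω ε) ≤ C * ε

def IsVeryWellShaped {m : ℕ} (Ω : Set (Torus m)) (C : ℝ) : Prop :=
  ∀ ε : ℝ, 0 < ε →
    tmeas (outerShell Ω ε) ≤ C * (tmeas Ω ^ (1 - 1 / (m : ℝ)) * ε + ε ^ m) ∧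
    tmeas (innerShell Ω ε) ≤ C * (tmeas Ω ^ (1 - 1 / (m : ℝ)) * ε + ε ^ m)

noncomputable def discrepancy {ι : Type*} {n : ℕ} (s : Set ι) (ξ : ι → Fin n → ℝ) : ℝ :=
  if s.ncard = 0 then 1
  else
    ⨆ B : {B : (Fin n → ℝ) × (Fin n → ℝ) // ∀ j, 0 ≤ B.1 j ∧ B.1 j ≤ B.2 j ∧ B.2 j ≤ 1},
      |((s ∩ {k | ∀ j, B.val.1 j ≤ ξ k j ∧ ξ k j < B.val.2 j}).ncard : ℝ) / (s.ncard : ℝ)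
        - ∏ j, (B.val.2 j - B.val.1 j)|

noncomputable def torusPt (p : ℕ) {m : ℕ} (x : Fin m → Fin p) : Torus m :=
  fun i => ((((x i : ℕ) : ℝ) / (p : ℝ) : ℝ) : AddCircle (1 : ℝ))

noncomputable def fracPt {p m n : ℕ} (G : Fin n → MvPolynomial (Fin m) (ZMod p))
    (x : Fin m → ℤ) : Fin n → ℝ :=
  fun j => ((MvPolynomial.eval (fun i => ((x i : ℤ) : ZMod p)) (G j)).val : ℝ) / (p : ℝ)

def Degree2Independent {p m n : ℕ} (G : Fin n → MvPolynomial (Fin m) (ZMod p)) : Prop :=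
  ∀ a : Fin n → ZMod p, a ≠ 0 → 2 ≤ (∑ j, a j • G j).totalDegree

def torusIcc (a b : ℝ) : Set (AddCircle (1 : ℝ)) :=
  (fun r : ℝ => (r : AddCircle (1 : ℝ))) '' Set.Icc a b

def gridCube {m : ℕ} (γ : Fin m → ℝ) (k : ℕ) (u : Fin m → ℤ) : Set (Torus m) :=
  {t | ∀ i, t i ∈ torusIcc (γ i + (u i : ℝ) / k) (γ i + ((u i : ℝ) + 1) / k)}

def torusCube {m : ℕ} (γ : Fin m → ℝ) (s : ℝ) : Set (Torus m) :=
  {t | ∀ i, t i ∈ torusIcc (γ i) (γ i + s)}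

def cubesIn {m : ℕ} (Ω : Set (Torus m)) (γ : Fin m → ℝ) (k : ℕ) : Set (Set (Torus m)) :=
  {Γ | (∃ u : Fin m → ℤ, Γ = gridCube γ k u) ∧ Γ ⊆ Ω}

def dyadicB {m : ℕ} (Ω : Set (Torus m)) (γ : Fin m → ℝ) (i : ℕ) : Set (Set (Torus m)) :=
  if i = 1 then cubesIn Ω γ 2
  else {Γ | Γ ∈ cubesIn Ω γ (2 ^ i) ∧ ∀ Γ' ∈ cubesIn Ω γ (2 ^ (i - 1)), ¬ Γ ⊆ Γ'}

def polySolutions (p : ℕ) {m n : ℕ} (F : Fin n → MvPolynomial (Fin m) ℤ) :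
    Set (Fin m → Fin p) :=
  {x | ∀ j, ((MvPolynomial.eval (fun i => ((x i : ℕ) : ℤ)) (F j) : ℤ) : ZMod p) = 0}

noncomputable def Tcount (p : ℕ) {m n : ℕ} (F : Fin n → MvPolynomial (Fin m) ℤ)
    (S : Set (Torus m)) : ℕ :=
  (polySolutions p F ∩ {x | torusPt p x ∈ S}).ncard

end

open Polynomial in
def DegLe {K : Type*} [Field K] (N : ℕ) (u : Polynomial (Polynomial K)) : Prop :=
  ∀ s, (u.coeff s).natDegree ≤ N

section StepA
open Polynomial

variable {K : Type*} [Field K]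

lemma DegLe.mono {a b : ℕ} {u : K[X][X]} (h : DegLe a u) (hab : a ≤ b) : DegLe b u :=
  fun s => (h s).trans hab

lemma DegLe.mul {a b : ℕ} {u w : K[X][X]} (h : DegLe a u) (h' : DegLe b w) :
    DegLe (a + b) (u * w) := by
  intro s
  rw [coeff_mul]
  refine natDegree_sum_le_of_forall_le _ _ ?_
  intro x _
  exact natDegree_mul_le.trans (Nat.add_le_add (h _) (h' _))

lemma DegLe.add {a : ℕ} {u w : K[X][X]} (h : DegLe a u) (h' : DegLe a w) :
    DegLe a (u + w) := by
  intro s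
  rw [coeff_add]
  exact natDegree_add_le_of_degree_le (h s) (h' s)

lemma DegLe.sub {a : ℕ} {u w : K[X][X]} (h : DegLe a u) (h' : DegLe a w) :
    DegLe a (u - w) := by
  intro s
  rw [coeff_sub]
  exact (natDegree_sub_le_of_le (h s) (h' s)).trans (max_self a).le

lemma DegLe.CC (a : ℕ) (g : K[X]) (hg : g.natDegree ≤ a) : DegLe a (C g : K[X][X]) := by
  intro s
  rw [coeff_C]
  split_ifs
  · exact hg
  · simp

lemma DegLe.pow {a : ℕ} {u : K[X][X]} (h : DegLe a u) (n : ℕ) : DegLe (n * a) (u ^ n) := by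
  induction n with
  | zero => simpa using DegLe.CC 0 1 (by simp)
  | succ n ih => rw [pow_succ, Nat.succ_mul]; exact ih.mul h

lemma DegLe.var : DegLe 1 (C X + X : K[X][X]) := by
  refine DegLe.add (DegLe.CC 1 X (by simp)) ?_
  intro s
  rw [coeff_X]
  split_ifs <;> simp

lemma DegLe.sum {a : ℕ} {ι : Type*} (s : Finset ι) (u : ι → K[X][X]) (h : ∀ i ∈ s, DegLe a (u i)) :
    DegLe a (∑ i ∈ s, u i) := by
  intro t
  rw [finsetSum_coeff]
  exact natDegree_sum_le_of_forall_le _ _ (fun i hi => h i hi t)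

lemma DegLe.shift (g : K[X]) : DegLe g.natDegree (eval₂ ((C : K[X] →+* K[X][X]).comp C) (C X + X) g) := by
  rw [eval₂_eq_sum_range]
  apply DegLe.sum
  intro i hi
  have h1 : DegLe 0 (C (C (g.coeff i)) : K[X][X]) := DegLe.CC 0 _ (by simp)
  have := h1.mul ((DegLe.var (K := K)).pow i)
  refine this.mono ?_
  simp at hi; omega

lemma X_sub_C_dvd_sub (g : K[X]) (x : K) : (X - C x) ∣ g - C (g.eval x) := by
  rw [dvd_iff_isRoot]; simp

lemma stepanov_inj (p : ℕ) (hp : p.Prime) (D : ℕ) (hD1 : 1 ≤ D) (hDp : D < p) (r1 : ℕ) (hr1p : 0 < r1)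
    (i1 i2 i3 j1 j2 j3 : ℕ) (hi1 : i1 < r1) (hj1 : j1 < r1) (hi3 : i3 < p) (hj3 : j3 < p)
    (h' : i1 + r1 * (p * i2 + D * i3) = j1 + r1 * (p * j2 + D * j3)) :
    i1 = j1 ∧ i2 = j2 ∧ i3 = j3 := by
  have e1 : (i1 : ℕ) = j1 := by
    have := congrArg (· % r1) h'
    simpa [Nat.add_mul_mod_self_left, Nat.mod_eq_of_lt hi1, Nat.mod_eq_of_lt hj1] using this
  have e2 : p * (i2 : ℕ) + D * i3 = p * j2 + D * j3 := by
    rw [e1] at h'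
    exact Nat.eq_of_mul_eq_mul_left hr1p (by omega)
  have e3 : (i3 : ℕ) = j3 := by
    have h1 : D * (i3 : ℕ) ≡ D * j3 [MOD p] := by
      have := congrArg (· % p) e2
      simpa [Nat.ModEq, Nat.mul_add_mod] using this
    have hco : Nat.gcd p D = 1 := by
      exact (Nat.Prime.coprime_iff_not_dvd hp).mpr (Nat.not_dvd_of_pos_of_lt (by omega) hDp)
    have h2 := Nat.ModEq.cancel_left_of_coprime hco h1
    exact Nat.ModEq.eq_of_lt_of_lt h2 hi3 hj3
  have e4 : (i2 : ℕ) = j2 := by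
    rw [e3] at e2
    exact Nat.eq_of_mul_eq_mul_left (by omega : 0 < p) (by omega)
  exact ⟨e1, e4, e3⟩

set_option maxHeartbeats 1600000 in
theorem stepanov (p : ℕ) [hp : Fact p.Prime] [CharP K p] (f : K[X]) (hD1 : 1 ≤ f.natDegree)
    (hDp : f.natDegree < p) (k μ : ℕ) (hμ : 1 ≤ μ) (hk : 2 * μ ≤ k) (b : K) (Z : Finset K)
    (hZ : ∀ x ∈ Z, x ^ p ^ k = x ∧ ∑ r ∈ Finset.range k, (f.eval x) ^ p ^ r = b) :
    Z.card ≤ p ^ (k - 1) + p ^ (k - μ) * (2 * p * f.natDegree + f.natDegree + 2) := by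
  classical
  set D := f.natDegree with hD
  set q := p ^ k with hq
  set q0 := p ^ μ with hq0
  set r1 := p ^ (k - 1) with hr1
  have hp2 : 2 ≤ p := hp.out.two_le
  have hqr : q = r1 * p := by rw [hq, hr1, ← pow_succ]; congr 1; omega
  set L := p ^ (μ - 1) + 2 * p * D + 2 with hL
  set g : K[X] := ∑ r ∈ Finset.range μ, f ^ p ^ r with hg
  set g' : K[X] := ∑ r ∈ Finset.range (k - μ), f ^ p ^ r with hg'
  set T : K[X] := ∑ r ∈ Finset.range k, f ^ p ^ r with hT
  have hTg : T = g + g' ^ q0 := by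
    rw [hT, hg, hg', hq0, sum_pow_char_pow]
    conv_lhs => rw [show k = μ + (k - μ) by omega, Finset.sum_range_add]
    congr 1
    apply Finset.sum_congr rfl
    intro r _
    rw [← pow_mul, ← pow_add, add_comm]
  have hgdeg : g.natDegree ≤ D * q0 := by
    apply natDegree_sum_le_of_forall_le
    intro r hr
    rw [natDegree_pow, mul_comm]
    exact Nat.mul_le_mul_left _ (Nat.pow_le_pow_right (by omega) (Finset.mem_range.mp hr).le)
  have hf0 : f ≠ 0 := by rintro rfl; simp at hD; omega
  have hTdeg : T.natDegree = D * r1 := by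
    rw [hT, show k = (k - 1) + 1 by omega, Finset.sum_range_succ]
    have h2 : (f ^ p ^ (k - 1)).natDegree = D * r1 := by rw [natDegree_pow, mul_comm]
    rw [natDegree_add_eq_right_of_natDegree_lt, h2]
    rw [h2]
    have : (∑ x ∈ Finset.range (k - 1), f ^ p ^ x).natDegree ≤ D * p ^ (k - 2) := by
      apply natDegree_sum_le_of_forall_le
      intro r hr
      rw [natDegree_pow, mul_comm]
      refine Nat.mul_le_mul_left _ (Nat.pow_le_pow_right (by omega) ?_)
      have := Finset.mem_range.mp hr
      omega
    refine this.trans_lt ?_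
    refine Nat.mul_lt_mul_of_pos_left ?_ (by omega)
    exact Nat.pow_lt_pow_right (by omega) (by omega)
  have hT0 : T ≠ 0 := by
    intro h
    rw [h] at hTdeg
    have : 0 < D * r1 := by positivity
    rw [natDegree_zero] at hTdeg; omega
  -- index
  let ι := Fin r1 × Fin L × Fin p
  let B := r1 + L + p * (D * q0)
  let gs : K[X][X] := eval₂ ((C : K[X] →+* K[X][X]).comp C) (C X + X) g
  let term : ι → K[X][X] := fun i =>
    (C X + X) ^ (i.1 : ℕ) * (C (X ^ (i.2.1 : ℕ)) * (gs - C g + C (C b)) ^ (i.2.2 : ℕ))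
  have hterm : ∀ i, ∀ s, ((term i).coeff s).natDegree < B := by
    intro i s
    have h1 : DegLe (D * q0) (gs - C g + C (C b)) :=
      (((DegLe.shift g).mono hgdeg).sub (DegLe.CC _ g hgdeg)).add (DegLe.CC _ (C b) (by simp))
    have h2 := ((DegLe.var (K := K)).pow (i.1 : ℕ)).mul ((DegLe.CC (i.2.1 : ℕ) (X ^ (i.2.1 : ℕ)) (by simp)).mul
      (h1.pow (i.2.2 : ℕ)))
    refine (h2 s).trans_lt ?_
    have a1 := i.1.2
    have a2 := i.2.1.2
    have a3 : (i.2.2 : ℕ) * (D * q0) ≤ p * (D * q0) := Nat.mul_le_mul_right _ i.2.2.2.le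
    simp only [B]
    omega
  let Ψ : (ι → K) →ₗ[K] K[X][X] :=
    ∑ i, (LinearMap.proj i : (ι → K) →ₗ[K] K).smulRight (term i)
  have hΨ : ∀ c, Ψ c = ∑ i, c i • term i := by
    intro c; simp [Ψ]
  let Φ : (ι → K) →ₗ[K] (Fin q0 × Fin B → K) :=
    LinearMap.pi fun st => (lcoeff K (st.2 : ℕ)) ∘ₗ ((lcoeff K[X] (st.1 : ℕ)).restrictScalars K) ∘ₗ Ψ
  have hrank : Module.finrank K (Fin q0 × Fin B → K) < Module.finrank K (ι → K) := by
    simp only [Module.finrank_fintype_fun_eq_card, Fintype.card_prod, Fintype.card_fin, ι, B]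
    have e1 : r1 * (L * p) = q * L := by rw [hqr]; ring
    rw [e1]
    have hq00 : q0 = p ^ (μ - 1) * p := by rw [hq0, ← pow_succ]; congr 1; omega
    set s := p ^ (μ - 1) with hs
    have hs1 : 1 ≤ s := Nat.one_le_pow _ _ (by omega)
    have hqq : q0 * q0 ≤ q := by
      rw [hq0, hq, ← pow_add]; exact Nat.pow_le_pow_right (by omega) (by omega)
    have hq0r : q0 * r1 = s * q := by rw [hqr, hq00]; ring
    have hD1' : 1 ≤ p * D := Nat.mul_pos (by omega) (by omega)
    have b1 : 2 * q0 ≤ q := by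
      refine le_trans ?_ hqq
      refine Nat.mul_le_mul_right _ ?_
      rw [hq00]; nlinarith
    have b2 : 2 * (q0 * s) ≤ q := by
      refine le_trans ?_ hqq
      nlinarith
    have hq0p : 1 ≤ q0 := Nat.one_le_pow _ _ (by omega)
    have : q0 * (r1 + L + p * (D * q0)) = s * q + q0 * L + (p * D) * (q0 * q0) := by
      rw [← hq0r]; ring
    rw [this, hL]
    have b3 : (p * D) * (q0 * q0) ≤ (p * D) * q := Nat.mul_le_mul_left _ hqq
    have b4 : (p * D) * (2 * q0) ≤ (p * D) * q := Nat.mul_le_mul_left _ b1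
    nlinarith
  obtain ⟨c, hcker, hc0⟩ := (Submodule.ne_bot_iff _).mp (LinearMap.ker_ne_bot_of_finrank_lt (f := Φ) hrank)
  have hdvd : (X : K[X][X]) ^ q0 ∣ Ψ c := by
    rw [X_pow_dvd_iff]
    intro s hs
    ext t
    rw [coeff_zero]
    by_cases ht : t < B
    · have := congrFun (LinearMap.mem_ker.mp hcker) (⟨s, hs⟩, ⟨t, ht⟩)
      simpa [Φ] using this
    · apply coeff_eq_zero_of_natDegree_lt
      have : ((Ψ c).coeff s).natDegree ≤ B - 1 := by
        rw [hΨ, finsetSum_coeff]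
        apply natDegree_sum_le_of_forall_le
        intro i _
        rw [coeff_smul]
        refine (natDegree_smul_le _ _).trans ?_
        have := hterm i s
        omega
      have hB : 0 < B := by simp only [B]; omega
      omega
  let mon : ι → K[X] := fun i => X ^ (i.1 : ℕ) * (X ^ (q * (i.2.1 : ℕ)) * T ^ (i.2.2 : ℕ))
  have hmondeg : ∀ i, (mon i).natDegree = i.1 + (q * i.2.1 + i.2.2 * (D * r1)) := by
    intro i
    simp only [mon]
    rw [natDegree_mul (by simp) (by simp [hT0]), natDegree_mul (by simp) (by simp [hT0])]
    simp [hTdeg]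
  have hinj : ∀ i j : ι, (mon i).natDegree = (mon j).natDegree → i = j := by
    intro i j h
    rw [hmondeg, hmondeg] at h
    obtain ⟨i1, i2, i3⟩ := i
    obtain ⟨j1, j2, j3⟩ := j
    simp only at h
    obtain ⟨e1, e4, e3⟩ := stepanov_inj p hp.out D hD1 hDp r1 (by positivity) i1 i2 i3 j1 j2 j3 i1.2 j1.2 i3.2 j3.2 (by rw [hqr] at h; linarith)
    ext <;> simp [e1, e3, e4]
  let P : K[X] := ∑ i, c i • mon i
  have hmon0 : ∀ i, mon i ≠ 0 := by intro i; simp [mon, hT0]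
  have hP0 : P ≠ 0 := by
    obtain ⟨i0, hi0⟩ : ∃ i, c i ≠ 0 := by
      by_contra! h; exact hc0 (funext h)
    have hdeg := degree_sum_eq_of_disjoint (fun i => c i • mon i) Finset.univ (by
      intro i hi j hj hij h
      simp at hi hj
      apply hij
      apply hinj
      simp only [Function.comp] at h
      have := natDegree_eq_of_degree_eq h
      rwa [natDegree_smul _ hi.1, natDegree_smul _ hj.1] at this)
    intro h
    have h1 : degree (c i0 • mon i0) ≤ degree P := by
      show _ ≤ degree (∑ i, c i • mon i)
      rw [hdeg]; exact Finset.le_sup (f := fun i => degree (c i • mon i)) (Finset.mem_univ i0)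
    rw [h, degree_zero, le_bot_iff, degree_eq_bot] at h1
    exact (smul_ne_zero hi0 (hmon0 i0)) h1
  have hPdeg : P.natDegree ≤ q * (L + D) := by
    apply natDegree_sum_le_of_forall_le
    intro i _
    refine (natDegree_smul_le _ _).trans ?_
    rw [hmondeg]
    have a1 := i.1.2
    have a2 : q * (i.2.1 : ℕ) + q ≤ q * L := by
      have := i.2.1.2
      rw [← Nat.mul_succ]; exact Nat.mul_le_mul_left _ this
    have a3 : (i.2.2 : ℕ) * (D * r1) ≤ p * (D * r1) := Nat.mul_le_mul_right _ i.2.2.2.le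
    have a4 : p * (D * r1) = q * D := by rw [hqr]; ring
    have a5 : r1 ≤ q := by rw [hqr]; exact Nat.le_mul_of_pos_right _ (by omega)
    rw [mul_add]
    omega
  have hroot : ∀ x ∈ Z, (X - C x) ^ q0 ∣ P := by
    intro x hx
    obtain ⟨hx1, hx2⟩ := hZ x hx
    let σ : K[X][X] →+* K[X] := eval₂RingHom ((C : K →+* K[X]).comp (evalRingHom x)) (X - C x)
    have h1 : (X - C x) ^ q0 ∣ σ (Ψ c) := by
      have := map_dvd σ hdvd
      simpa [σ] using this
    have hσgs : σ gs = g := by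
      simp only [gs, σ]
      rw [← coe_eval₂RingHom, ← RingHom.comp_apply]
      have : (eval₂RingHom ((C : K →+* K[X]).comp (evalRingHom x)) (X - C x)).comp
        (eval₂RingHom ((C : K[X] →+* K[X][X]).comp C) (C X + X)) = RingHom.id K[X] := by
        ext <;> simp
      rw [this]; rfl
    have hσt : ∀ i, σ (term i) = X ^ (i.1 : ℕ) * (C (x ^ (i.2.1 : ℕ)) * (g - C (g.eval x) + C b) ^ (i.2.2 : ℕ)) := by
      intro i
      simp only [term, map_mul, map_pow, map_add, map_sub, hσgs]
      simp [σ]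
    have hσ : σ (Ψ c) = ∑ i, c i • (X ^ (i.1 : ℕ) * (C (x ^ (i.2.1 : ℕ)) * (g - C (g.eval x) + C b) ^ (i.2.2 : ℕ))) := by
      rw [hΨ, map_sum]
      apply Finset.sum_congr rfl
      intro i _
      rw [← hσt i, ← algebraMap_smul K[X] (c i) (term i), smul_eq_C_mul]
      rw [map_mul]
      rw [← C_mul']
      congr 1
      simp [σ]
    have hfrob : ∀ (u w : K[X]), (u - w) ^ q0 = u ^ q0 - w ^ q0 := fun u w => sub_pow_char_pow u w μ
    have hXq : (X - C x) ^ q0 ∣ X ^ q - C x := by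
      have : X ^ q - C x = (X - C x) ^ q := by
        rw [hq, sub_pow_char_pow, ← C_pow, hx1]
      rw [this]
      exact pow_dvd_pow _ (Nat.pow_le_pow_right (by omega) (by omega))
    have hTd : (X - C x) ^ q0 ∣ T - (g - C (g.eval x) + C b) := by
      have hb : b = g.eval x + (g'.eval x) ^ q0 := by
        rw [← eval_pow, ← eval_add, ← hTg, ← hx2, hT, eval_finsetSum]
        simp
      have : T - (g - C (g.eval x) + C b) = (g' - C (g'.eval x)) ^ q0 := by
        rw [hfrob, hTg, hb, C_add, C_pow]; ring
      rw [this]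
      exact pow_dvd_pow_of_dvd (X_sub_C_dvd_sub _ _) _
    have h2 : (X - C x) ^ q0 ∣ P - σ (Ψ c) := by
      rw [hσ, ← Finset.sum_sub_distrib]
      apply Finset.dvd_sum
      intro i _
      rw [← smul_sub, ← C_mul']
      apply Dvd.dvd.mul_left
      simp only [mon]
      rw [← mul_sub]
      apply Dvd.dvd.mul_left
      rw [pow_mul, C_pow]
      have e1 : (X - C x) ^ q0 ∣ (X ^ q) ^ (i.2.1 : ℕ) - (C x) ^ (i.2.1 : ℕ) :=
        hXq.trans (sub_dvd_pow_sub_pow _ _ _)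
      have e2 : (X - C x) ^ q0 ∣ T ^ (i.2.2 : ℕ) - (g - C (g.eval x) + C b) ^ (i.2.2 : ℕ) :=
        hTd.trans (sub_dvd_pow_sub_pow _ _ _)
      have := (e1.mul_right (T ^ (i.2.2 : ℕ))).add (e2.mul_left ((C x) ^ (i.2.1 : ℕ)))
      convert this using 1
      ring
    have := h2.add h1
    simpa using this
  have hprod : ∏ x ∈ Z, (X - C x) ^ q0 ∣ P := by
    apply Finset.prod_dvd_of_coprime
    · intro x _ y _ hxy
      exact (pairwise_coprime_X_sub_C Function.injective_id hxy).pow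
    · exact hroot
  have h3 := natDegree_le_of_dvd hprod hP0
  rw [natDegree_prod _ _ (fun x _ => pow_ne_zero _ (X_sub_C_ne_zero x))] at h3
  simp only [natDegree_pow, natDegree_X_sub_C, mul_one, Finset.sum_const, smul_eq_mul] at h3
  have h4 := h3.trans hPdeg
  have hq1 : q = q0 * p ^ (k - μ) := by rw [hq, hq0, ← pow_add]; congr 1; omega
  have h5 : Z.card ≤ p ^ (k - μ) * (L + D) := by
    have : q0 * Z.card ≤ q0 * (p ^ (k - μ) * (L + D)) := by
      rw [← mul_assoc, ← hq1, mul_comm]; exact h4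
    exact Nat.le_of_mul_le_mul_left this (by positivity)
  refine h5.trans (le_of_eq ?_)
  rw [hL, hr1, show k - 1 = (k - μ) + (μ - 1) by omega, pow_add]
  ring
end StepA

section LB
open Polynomial

lemma newton_multiset {K : Type*} [Field K] (s : Multiset K) (k : ℕ) (hk : 0 < k) :
    (s.map (· ^ k)).sum = (-1) ^ (k + 1) * k * s.esymm k -
      ∑ a ∈ Finset.HasAntidiagonal.antidiagonal k with a.1 ∈ Set.Ioo 0 k,
        (-1) ^ a.1 * s.esymm a.1 * (s.map (· ^ a.2)).sum := by
  obtain ⟨l, rfl⟩ := Quot.exists_rep s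
  let x : Fin l.length → K := fun i => l.get i
  have hx : (Finset.univ.val.map x : Multiset K) = (l : Multiset K) := by
    simp [x]
  have h := congrArg (MvPolynomial.aeval (R := K) x) (MvPolynomial.psum_eq_mul_esymm_sub_sum (Fin l.length) K k hk)
  have hps : ∀ j, MvPolynomial.aeval (R := K) x (MvPolynomial.psum (Fin l.length) K j) = ((l : Multiset K).map (· ^ j)).sum := by
    intro j
    rw [← hx, Multiset.map_map]
    simp only [MvPolynomial.psum, map_sum, map_pow, MvPolynomial.aeval_X]
    rfl
  have hes : ∀ j, MvPolynomial.aeval (R := K) x (MvPolynomial.esymm (Fin l.length) K j) = (l : Multiset K).esymm j := by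
    intro j
    rw [← hx, MvPolynomial.aeval_esymm_eq_multiset_esymm]
  simp only [map_sub, map_mul, map_sum, map_pow, map_neg, map_one, hps, hes, map_natCast] at h
  exact h

lemma newton_compare {K : Type*} [Field K] (s s' : Multiset K) (hc : s.card = s'.card) (D : ℕ)
    (h : ∀ j < D, s.esymm j = s'.esymm j) :
    ∀ j < D, (s.map (· ^ j)).sum = (s'.map (· ^ j)).sum := by
  intro j
  induction j using Nat.strong_induction_on with
  | _ j ih =>
    intro hj
    rcases Nat.eq_zero_or_pos j with rfl | hj0
    · simp [hc]
    rw [newton_multiset s j hj0, newton_multiset s' j hj0, h j hj]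
    congr 1
    apply Finset.sum_congr rfl
    intro a ha
    simp only [Finset.mem_filter, Finset.HasAntidiagonal.mem_antidiagonal, Set.mem_Ioo] at ha
    rw [h a.1 (by omega), ih a.2 (by omega) (by omega)]

lemma newton_diff {K : Type*} [Field K] (s s' : Multiset K) (hc : s.card = s'.card) (D : ℕ) (hD : 0 < D)
    (h : ∀ j < D, s.esymm j = s'.esymm j) :
    (s'.map (· ^ D)).sum = (s.map (· ^ D)).sum + (-1) ^ (D + 1) * D * (s'.esymm D - s.esymm D) := by
  have key : ∑ a ∈ Finset.HasAntidiagonal.antidiagonal D with a.1 ∈ Set.Ioo 0 D,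
        (-1) ^ a.1 * s.esymm a.1 * (s.map (· ^ a.2)).sum = ∑ a ∈ Finset.HasAntidiagonal.antidiagonal D with a.1 ∈ Set.Ioo 0 D,
        (-1) ^ a.1 * s'.esymm a.1 * (s'.map (· ^ a.2)).sum := by
    apply Finset.sum_congr rfl
    intro a ha
    simp only [Finset.mem_filter, Finset.HasAntidiagonal.mem_antidiagonal, Set.mem_Ioo] at ha
    rw [h a.1 (by omega), newton_compare s s' hc D h a.2 (by omega)]
  rw [newton_multiset s D hD, newton_multiset s' D hD, key]
  ring

lemma eval_sum_multiset {K : Type*} [Field K] (f : K[X]) (s : Multiset K) :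
    (s.map (fun x => f.eval x)).sum = ∑ i ∈ Finset.range (f.natDegree + 1), f.coeff i * (s.map (· ^ i)).sum := by
  induction s using Multiset.induction_on with
  | empty => simp
  | cons a s ih =>
    simp only [Multiset.map_cons, Multiset.sum_cons, ih, mul_add, Finset.sum_add_distrib]
    rw [eval_eq_sum_range]

/-- perturbing one coefficient -/
lemma rootsum_perturb {K : Type*} [Field K] [IsAlgClosed K] (f g : K[X]) (n : ℕ) (hg : g.Monic) (hn : g.natDegree = n)
    (hD : 0 < f.natDegree) (hDn : f.natDegree ≤ n) (τ : K) :
    (((g + C τ * X ^ (n - f.natDegree)).roots).map (fun x => f.eval x)).sum =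
      (g.roots.map (fun x => f.eval x)).sum - f.leadingCoeff * f.natDegree * τ := by
  set D := f.natDegree with hDdef
  set g' := g + C τ * X ^ (n - D) with hg'
  have hlt : (C τ * X ^ (n - D)).degree < g.degree := by
    refine (degree_C_mul_X_pow_le _ _).trans_lt ?_
    rw [degree_eq_natDegree hg.ne_zero, hn]
    exact_mod_cast (by omega : n - D < n)
  have hg'm : g'.Monic := hg.add_of_left hlt
  have hg'n : g'.natDegree = n := by
    rw [hg', natDegree_add_eq_left_of_degree_lt hlt, hn]
  have hcg : g.roots.card = n := by rw [← hn]; exact (IsAlgClosed.splits g).natDegree_eq_card_roots.symm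
  have hcg' : g'.roots.card = n := by rw [← hg'n]; exact (IsAlgClosed.splits g').natDegree_eq_card_roots.symm
  have hes : ∀ (u : K[X]), u.Monic → u.natDegree = n → u.roots.card = n → ∀ j ≤ n,
      u.roots.esymm j = (-1) ^ j * u.coeff (n - j) := by
    intro u hu hun huc j hj
    have := coeff_eq_esymm_roots_of_card (p := u) (by rw [huc, hun]) (k := n - j) (by omega)
    rw [this, hu.leadingCoeff, hun, show n - (n - j) = j by omega, one_mul, ← mul_assoc, ← mul_pow]
    simp
  have hco : ∀ i, g'.coeff i = g.coeff i + if i = n - D then τ else 0 := by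
    intro i
    simp [hg', coeff_X_pow]
  have hlow : ∀ j < D, g.roots.esymm j = g'.roots.esymm j := by
    intro j hj
    rw [hes g hg hn hcg j (by omega), hes g' hg'm hg'n hcg' j (by omega), hco, if_neg (by omega), add_zero]
  have hpow := newton_compare g.roots g'.roots (by rw [hcg, hcg']) D hlow
  have hpD := newton_diff g.roots g'.roots (by rw [hcg, hcg']) D hD hlow
  rw [eval_sum_multiset, eval_sum_multiset, ← hDdef, Finset.sum_range_succ, Finset.sum_range_succ, hpD]
  have : ∑ x ∈ Finset.range D, f.coeff x * (g'.roots.map (· ^ x)).sum = ∑ x ∈ Finset.range D, f.coeff x * (g.roots.map (· ^ x)).sum := by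
    apply Finset.sum_congr rfl
    intro i hi
    rw [hpow i (Finset.mem_range.mp hi)]
  rw [this, hes g hg hn hcg D hDn, hes g' hg'm hg'n hcg' D hDn, hco, if_pos rfl]
  have e : ((-1 : K)) ^ (D + 1) * (-1) ^ D = -1 := by
    rw [← pow_add, show D + 1 + D = 2 * D + 1 by ring, pow_succ, pow_mul]; simp
  have hl : f.leadingCoeff = f.coeff D := rfl
  rw [hl]
  linear_combination (f.coeff D * D * τ) * e
end LB

section LB2
open Polynomial

def Qm {K : Type*} [Field K] (φ : K →+* K) (x : K) (r : ℕ) : Multiset K :=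
  (Multiset.range r).map (fun i => φ^[i] x)

def Mset {K : Type*} [Field K] (φ : K →+* K) (n : ℕ) : Set K[X] :=
  {g | g.Monic ∧ g.natDegree = n ∧ g.map φ = g}

variable {K : Type*} [Field K]

lemma Mset_finite (φ : K →+* K) (h1 : {x | φ x = x}.Finite) (n : ℕ) : (Mset φ n).Finite := by
  have hpi : (Set.univ.pi (fun _ : Fin (n + 1) => {x | φ x = x})).Finite := Set.Finite.pi (fun _ => h1)
  refine Set.Finite.of_finite_image (f := fun (g : K[X]) (i : Fin (n + 1)) => g.coeff i) (hpi.subset ?_) ?_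
  · rintro _ ⟨g, hg, rfl⟩
    intro i _
    have := congrArg (fun u => coeff u (i : ℕ)) hg.2.2
    simpa using this
  · intro g hg g' hg' h
    ext i
    by_cases hi : i < n + 1
    · exact congrFun h ⟨i, hi⟩
    · rw [coeff_eq_zero_of_natDegree_lt (by rw [hg.2.1]; omega), coeff_eq_zero_of_natDegree_lt (by rw [hg'.2.1]; omega)]

lemma Qm_card (φ : K →+* K) (x : K) (r : ℕ) : (Qm φ x r).card = r := by simp [Qm]

lemma Qm_mul (φ : K →+* K) (x : K) (δ a : ℕ) (h : φ^[δ] x = x) : Qm φ x (a * δ) = a • Qm φ x δ := by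
  induction a with
  | zero => simp [Qm]
  | succ a ih =>
    rw [Nat.succ_mul, succ_nsmul', ← ih, add_comm (a * δ) δ]
    unfold Qm
    rw [Multiset.range_add, Multiset.map_add, Multiset.map_map]
    congr 1
    apply Multiset.map_congr rfl
    intro i _
    simp only [Function.comp]
    rw [add_comm, Function.iterate_add_apply, h]

lemma Qm_map (φ : K →+* K) (x : K) (r : ℕ) (h : φ^[r] x = x) : (Qm φ x r).map φ = Qm φ x r := by
  have e1 : (Qm φ x r).map φ + {x} = Qm φ x r + {x} := by
    have h1 : Qm φ x (r + 1) = Qm φ x r + {x} := by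
      unfold Qm
      rw [Multiset.range_succ, Multiset.map_cons, h, ← Multiset.singleton_add, add_comm]
    have h2 : Qm φ x (1 + r) = {x} + (Qm φ x r).map φ := by
      unfold Qm
      rw [Multiset.range_add, Multiset.map_add, Multiset.map_map, Multiset.map_map]
      congr 1
      apply Multiset.map_congr rfl
      intro i _
      simp only [Function.comp]
      rw [add_comm, Function.iterate_succ_apply']
    rw [← h1, add_comm r 1, h2, add_comm]
  exact add_right_cancel e1

lemma roots_fixed [IsAlgClosed K] (φ : K →+* K) (g : K[X]) (hg : g.map φ = g) : g.roots.map φ = g.roots := by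
  have := (IsAlgClosed.splits g).roots_map (φ)
  rw [hg] at this
  exact this.symm

lemma count_fixed [IsAlgClosed K] (φ : K →+* K) (g : K[X]) (hg : g.map φ = g) (x : K) [DecidableEq K] (i : ℕ) :
    g.roots.count (φ^[i] x) = g.roots.count x := by
  induction i with
  | zero => rfl
  | succ i ih =>
    rw [Function.iterate_succ_apply', ← ih]
    conv_lhs => rw [← roots_fixed φ g hg]
    rw [Multiset.count_map_eq_count' _ _ φ.injective]

lemma periodic_root [IsAlgClosed K] (φ : K →+* K) (g : K[X]) (hg : g.map φ = g) (x : K)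
    (hx : x ∈ g.roots) : 0 < Function.minimalPeriod φ x := by
  classical
  have hmem : ∀ i : ℕ, φ^[i] x ∈ (g.roots.toFinset : Set K) := by
    intro i
    simp only [Finset.mem_coe, Multiset.mem_toFinset]
    rw [← Multiset.count_pos, count_fixed φ g hg, Multiset.count_pos]
    exact hx
  obtain ⟨a, b, hab, h⟩ := Set.Finite.exists_lt_map_eq_of_forall_mem hmem (Finset.finite_toSet _)
  apply Function.minimalPeriod_pos_of_mem_periodicPts
  refine ⟨b - a, by omega, ?_⟩
  have hinj : Function.Injective (φ^[a]) := φ.injective.iterate a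
  apply hinj
  rw [← Function.iterate_add_apply, show a + (b - a) = b by omega]
  exact h.symm

lemma count_r [IsAlgClosed K] [DecidableEq K] (φ : K →+* K) (g : K[X]) (n : ℕ) (hg : g ∈ Mset φ n) (x : K)
    (hx : x ∈ g.roots) :
    ((Finset.Icc 1 n).filter (fun r => φ^[r] x = x ∧ Qm φ x r ≤ g.roots)).card = g.roots.count x := by
  classical
  have hδ := periodic_root φ g hg.2.2 x hx
  set δ := Function.minimalPeriod φ x with hδdef
  have hper : φ^[δ] x = x := Function.iterate_minimalPeriod
  have hnd : (Qm φ x δ).Nodup := by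
    unfold Qm
    refine Multiset.Nodup.map_on ?_ (Multiset.nodup_range δ)
    intro i hi j hj hij
    exact Function.iterate_injOn_Iio_minimalPeriod (by simpa using hi) (by simpa using hj) hij
  have hx1 : (Qm φ x δ).count x = 1 := by
    apply Multiset.count_eq_one_of_mem hnd
    unfold Qm
    rw [Multiset.mem_map]
    exact ⟨0, by simpa using hδ, rfl⟩
  have hle : ∀ a, Qm φ x (a * δ) ≤ g.roots ↔ a ≤ g.roots.count x := by
    intro a
    rw [Qm_mul φ x δ a hper]
    constructor
    · intro h
      have := Multiset.le_iff_count.mp h x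
      rwa [Multiset.count_nsmul, hx1, mul_one] at this
    · intro h
      rw [Multiset.le_iff_count]
      intro y
      rw [Multiset.count_nsmul]
      by_cases hy : y ∈ Qm φ x δ
      · rw [Multiset.count_eq_one_of_mem hnd hy, mul_one]
        obtain ⟨i, _, rfl⟩ := Multiset.mem_map.mp hy
        rwa [count_fixed φ g hg.2.2]
      · rw [Multiset.count_eq_zero_of_notMem hy]; simp
  have hcard : g.roots.card = n := by
    rw [← hg.2.1]; exact (IsAlgClosed.splits g).natDegree_eq_card_roots.symm
  have : (Finset.Icc 1 n).filter (fun r => φ^[r] x = x ∧ Qm φ x r ≤ g.roots) =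
      (Finset.Icc 1 (g.roots.count x)).image (fun a => a * δ) := by
    ext r
    simp only [Finset.mem_filter, Finset.mem_Icc, Finset.mem_image]
    constructor
    · rintro ⟨⟨h1, h2⟩, h3, h4⟩
      obtain ⟨a, ha⟩ := Function.IsPeriodicPt.minimalPeriod_dvd (f := φ) h3
      rw [← hδdef, mul_comm] at ha
      subst ha
      refine ⟨a, ⟨?_, (hle a).mp h4⟩, rfl⟩
      by_contra h
      have : a = 0 := by omega
      simp [this] at h1
    · rintro ⟨a, ⟨h1, h2⟩, rfl⟩
      have h4 := (hle a).mpr h2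
      refine ⟨⟨Nat.mul_pos (by omega) hδ, ?_⟩, ?_, h4⟩
      · have := Multiset.card_le_card h4
        rwa [Qm_card, hcard] at this
      · have : Function.IsPeriodicPt φ (a * δ) x := Function.IsPeriodicPt.const_mul (f := φ) hper a
        exact this
  rw [this, Finset.card_image_of_injective, Nat.card_Icc]
  · omega
  · intro a b h
    exact Nat.eq_of_mul_eq_mul_right hδ h

lemma count_total [IsAlgClosed K] [DecidableEq K] (φ : K →+* K) (F : ℕ → Finset K)
    (hF : ∀ r, 1 ≤ r → ∀ x, x ∈ F r ↔ φ^[r] x = x) (g : K[X]) (n : ℕ) (hg : g ∈ Mset φ n) :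
    ∑ r ∈ Finset.Icc 1 n, ((F r).filter (fun x => Qm φ x r ≤ g.roots)).card = n := by
  classical
  have hcard : g.roots.card = n := by
    rw [← hg.2.1]; exact (IsAlgClosed.splits g).natDegree_eq_card_roots.symm
  have h1 : ∀ r ∈ Finset.Icc 1 n, (F r).filter (fun x => Qm φ x r ≤ g.roots) =
      g.roots.toFinset.filter (fun x => φ^[r] x = x ∧ Qm φ x r ≤ g.roots) := by
    intro r hr
    ext x
    have hr1 := (Finset.mem_Icc.mp hr).1
    simp only [Finset.mem_filter, hF r hr1, Multiset.mem_toFinset]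
    constructor
    · rintro ⟨a, b⟩
      refine ⟨Multiset.mem_of_le b ?_, a, b⟩
      unfold Qm
      rw [Multiset.mem_map]
      exact ⟨0, by simp; omega, rfl⟩
    · rintro ⟨_, a, b⟩; exact ⟨a, b⟩
  rw [Finset.sum_congr rfl (fun r hr => by rw [h1 r hr])]
  simp_rw [Finset.card_filter]
  rw [Finset.sum_comm]
  simp_rw [← Finset.card_filter]
  rw [← hcard, ← Multiset.toFinset_sum_count_eq]
  apply Finset.sum_congr rfl
  intro x hx
  have := count_r φ g n hg x (Multiset.mem_toFinset.mp hx)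
  rw [Multiset.toFinset_sum_count_eq, hcard]
  exact this

lemma newton_L [IsAlgClosed K] (φ : K →+* K) (F : ℕ → Finset K)
    (hF : ∀ r, 1 ≤ r → ∀ x, x ∈ F r ↔ φ^[r] x = x) (M : ℕ → Finset K[X])
    (hM : ∀ n g, g ∈ M n ↔ g ∈ Mset φ n) (Ψ : AddChar K ℂ) (f : K[X]) (n : ℕ) :
    (n : ℂ) * ∑ g ∈ M n, Ψ ((g.roots.map (fun x => f.eval x)).sum) =
      ∑ r ∈ Finset.Icc 1 n, (∑ x ∈ F r, Ψ (∑ i ∈ Finset.range r, f.eval (φ^[i] x))) *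
        ∑ g ∈ M (n - r), Ψ ((g.roots.map (fun x => f.eval x)).sum) := by
  classical
  set lam : K[X] → ℂ := fun g => Ψ ((g.roots.map (fun x => f.eval x)).sum) with hlam
  have h1 : (n : ℂ) * ∑ g ∈ M n, lam g = ∑ g ∈ M n, ∑ r ∈ Finset.Icc 1 n, ∑ x ∈ F r,
      if Qm φ x r ≤ g.roots then lam g else 0 := by
    rw [Finset.mul_sum]
    apply Finset.sum_congr rfl
    intro g hg
    have := count_total φ F hF g n ((hM n g).mp hg)
    have h' : (n : ℂ) = ∑ r ∈ Finset.Icc 1 n, ∑ x ∈ F r, if Qm φ x r ≤ g.roots then (1:ℂ) else 0 := by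
      conv_lhs => rw [← this]
      push_cast
      apply Finset.sum_congr rfl
      intro r _
      rw [Finset.card_filter]; push_cast; rfl
    conv_lhs => rw [h']
    rw [Finset.sum_mul]
    apply Finset.sum_congr rfl
    intro r _
    rw [Finset.sum_mul]
    apply Finset.sum_congr rfl
    intro x _
    split_ifs <;> simp
  show (n : ℂ) * ∑ g ∈ M n, lam g = _
  rw [h1, Finset.sum_comm]
  apply Finset.sum_congr rfl
  intro r hr
  obtain ⟨hr1, hrn⟩ := Finset.mem_Icc.mp hr
  rw [Finset.sum_comm, Finset.sum_mul]
  apply Finset.sum_congr rfl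
  intro x hx
  have hxr := (hF r hr1 x).mp hx
  rw [← Finset.sum_filter, Finset.mul_sum]
  symm
  set Q : K[X] := ((Qm φ x r).map (fun a => X - C a)).prod with hQ
  have hQm : Q.Monic := monic_multiset_prod_of_monic _ _ (fun a _ => monic_X_sub_C a)
  have hQd : Q.natDegree = r := by
    rw [hQ, natDegree_multiset_prod_X_sub_C_eq_card, Qm_card]
  have hQφ : Q.map φ = Q := by
    rw [hQ, Polynomial.map_multiset_prod, Multiset.map_map]
    conv_rhs => rw [← Qm_map φ x r hxr, Multiset.map_map]
    congr 1
    apply Multiset.map_congr rfl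
    intro a _
    simp
  have hQr : Q.roots = Qm φ x r := roots_multiset_prod_X_sub_C _
  refine Finset.sum_bij (fun h _ => Q * h) ?_ ?_ ?_ ?_
  · intro h hh
    obtain ⟨a1, a2, a3⟩ := (hM _ _).mp hh
    rw [Finset.mem_filter, hM]
    refine ⟨⟨hQm.mul a1, ?_, ?_⟩, ?_⟩
    · rw [hQm.natDegree_mul a1, hQd, a2]; omega
    · rw [Polynomial.map_mul, hQφ, a3]
    · rw [roots_mul (hQm.mul a1).ne_zero, hQr]; exact Multiset.le_add_right _ _
  · intro h _ h' _ e
    exact mul_left_cancel₀ hQm.ne_zero e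
  · intro g hg
    rw [Finset.mem_filter, hM] at hg
    obtain ⟨⟨a1, a2, a3⟩, a4⟩ := hg
    obtain ⟨h, hh⟩ := (Multiset.prod_X_sub_C_dvd_iff_le_roots a1.ne_zero (Qm φ x r)).mpr a4
    rw [← hQ] at hh
    have hm : h.Monic := hQm.of_mul_monic_left (by rw [← hh]; exact a1)
    refine ⟨h, ?_, hh.symm⟩
    rw [hM]
    refine ⟨hm, ?_, ?_⟩
    · rw [hh, hQm.natDegree_mul hm, hQd] at a2; omega
    · apply mul_left_cancel₀ hQm.ne_zero
      rw [← hh]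
      conv_rhs => rw [← a3, hh, Polynomial.map_mul, hQφ]
  · intro h hh
    obtain ⟨a1, a2, a3⟩ := (hM _ _).mp hh
    simp only [hlam]
    rw [roots_mul (hQm.mul a1).ne_zero, hQr, Multiset.map_add, Multiset.sum_add, AddChar.map_add_eq_mul]
    congr 2
    unfold Qm
    rw [Multiset.map_map]
    rfl
end LB2

section LB3
open Polynomial

variable {K : Type*} [Field K]

lemma Mset_shift (φ : K →+* K) (n e : ℕ) (he : e < n) (τ : K) (hτ : φ τ = τ) (g : K[X])
    (hg : g ∈ Mset φ n) : g + C τ * X ^ e ∈ Mset φ n := by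
  obtain ⟨h1, h2, h3⟩ := hg
  have hd : (C τ * X ^ e : K[X]).degree < g.degree := by
    rw [degree_eq_natDegree h1.ne_zero, h2]
    exact (degree_C_mul_X_pow_le e τ).trans_lt (by exact_mod_cast he)
  refine ⟨h1.add_of_left hd, ?_, ?_⟩
  · rw [natDegree_add_eq_left_of_degree_lt hd, h2]
  · simp [h3, hτ]

lemma L_vanish [IsAlgClosed K] (φ : K →+* K) (M : ℕ → Finset K[X])
    (hM : ∀ n g, g ∈ M n ↔ g ∈ Mset φ n) (Ψ : AddChar K ℂ) (f : K[X]) (hD : 1 ≤ f.natDegree)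
    (hD0 : (f.natDegree : K) ≠ 0) (hf : f.map φ = f) (t : K) (ht : φ t = t) (hΨ : Ψ t ≠ 1)
    (n : ℕ) (hn : f.natDegree ≤ n) :
    ∑ g ∈ M n, Ψ ((g.roots.map (fun x => f.eval x)).sum) = 0 := by
  have hlc : f.leadingCoeff ≠ 0 := by
    intro h
    rw [leadingCoeff_eq_zero] at h
    simp [h] at hD
  have hlcφ : φ f.leadingCoeff = f.leadingCoeff := by
    conv_rhs => rw [← hf]
    rw [leadingCoeff_map]
  set τ : K := -t / (f.leadingCoeff * f.natDegree) with hτdef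
  have hτ : φ τ = τ := by simp [hτdef, ht, hlcφ]
  have key : ∑ g ∈ M n, Ψ ((g.roots.map (fun x => f.eval x)).sum) =
      ∑ g ∈ M n, Ψ t * Ψ ((g.roots.map (fun x => f.eval x)).sum) := by
    symm
    refine Finset.sum_bij' (fun g _ => g + C τ * X ^ (n - f.natDegree))
      (fun g _ => g + C (-τ) * X ^ (n - f.natDegree)) ?_ ?_ ?_ ?_ ?_
    · intro g hg
      rw [hM] at hg ⊢
      exact Mset_shift φ n _ (by omega) τ hτ g hg
    · intro g hg
      rw [hM] at hg ⊢
      exact Mset_shift φ n _ (by omega) _ (by simp [hτ]) g hg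
    · intro g hg; simp
    · intro g hg; simp
    · intro g hg
      rw [hM] at hg
      rw [rootsum_perturb f g n hg.1 hg.2.1 (by omega) hn τ, ← AddChar.map_add_eq_mul]
      congr 1
      rw [hτdef]
      field_simp
      ring
  rw [← Finset.mul_sum] at key
  have : (Ψ t - 1) * ∑ g ∈ M n, Ψ ((g.roots.map (fun x => f.eval x)).sum) = 0 := by
    rw [sub_mul, ← key]; ring
  rcases mul_eq_zero.mp this with h | h
  · exact absurd (sub_eq_zero.mp h) hΨ
  · exact h

lemma L_root (A S : ℕ → ℂ) (D : ℕ) (hA0 : A 0 = 1) (hA : ∀ n, D ≤ n → A n = 0)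
    (hN : ∀ n : ℕ, (n : ℂ) * A n = ∑ r ∈ Finset.Icc 1 n, S r * A (n - r)) (R B : ℝ) (hR : 0 < R)
    (hS : ∀ r, 1 ≤ r → ‖S r‖ ≤ B * R ^ r) (T0 : ℂ)
    (hT0 : (∑ j ∈ Finset.range D, C (A j) * X ^ j : ℂ[X]).eval T0 = 0) : R⁻¹ ≤ ‖T0‖ := by
  by_contra hlt
  push Not at hlt
  set L : ℂ[X] := ∑ j ∈ Finset.range D, C (A j) * X ^ j with hL
  have hDpos : 0 < D := by
    by_contra h
    have := hA 0 (by omega)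
    rw [hA0] at this
    exact one_ne_zero this
  have hLev : ∀ T, L.eval T = ∑ j ∈ Finset.range D, A j * T ^ j := by
    intro T; simp [hL, eval_finsetSum]
  have hL0 : L.eval 0 = 1 := by
    rw [hLev, Finset.sum_eq_single 0]
    · simp [hA0]
    · intro b _ hb; simp [hb]
    · intro h; simp at h; omega
  have hLne : L ≠ 0 := by
    intro h; rw [h] at hL0; simp at hL0
  have hT0ne : T0 ≠ 0 := by
    rintro rfl; rw [hL0] at hT0; exact one_ne_zero hT0
  set q := R * ‖T0‖ with hq
  have hq1 : q < 1 := by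
    have := mul_lt_mul_of_pos_left hlt hR
    rwa [mul_inv_cancel₀ hR.ne'] at this
  have hq0 : 0 ≤ q := by positivity
  have hB0 : 0 ≤ B := by
    have h1 := (norm_nonneg _).trans (hS 1 le_rfl)
    simp only [pow_one] at h1
    exact nonneg_of_mul_nonneg_left h1 hR
  set S' : ℕ → ℂ := fun r => if r = 0 then 0 else S r with hS'
  have hS'b : ∀ r, ‖S' r‖ ≤ B * R ^ r := by
    intro r
    by_cases hr : r = 0
    · simp [hS', hr, hB0]
    · simp only [hS', hr, if_false]; exact hS r (by omega)
  set M := ∑' r, B * q ^ r with hM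
  have hsumq : Summable (fun r : ℕ => B * q ^ r) :=
    (summable_geometric_of_lt_one hq0 hq1).mul_left B
  -- main estimate
  have main : ∀ T : ℂ, ‖T‖ ≤ ‖T0‖ → ‖T * (derivative L).eval T‖ ≤ ‖L.eval T‖ * M := by
    intro T hT
    have hterm : ∀ r, ‖S' r * T ^ r‖ ≤ B * q ^ r := by
      intro r
      rw [norm_mul, norm_pow, hq, mul_pow, ← mul_assoc]
      exact mul_le_mul (hS'b r) (pow_le_pow_left₀ (norm_nonneg _) hT r) (by positivity) (by positivity)
    have hs1 : Summable (fun r => ‖S' r * T ^ r‖) :=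
      Summable.of_nonneg_of_le (fun _ => norm_nonneg _) hterm hsumq
    have hs2 : Summable (fun r => ‖A r * T ^ r‖) := by
      apply summable_of_ne_finset_zero (s := Finset.range D)
      intro b hb
      simp at hb
      simp [hA b hb]
    have hLts : ∑' j, A j * T ^ j = L.eval T := by
      rw [hLev]
      apply tsum_eq_sum
      intro b hb
      simp at hb
      simp [hA b hb]
    have hprod := tsum_mul_tsum_eq_tsum_sum_antidiagonal_of_summable_norm hs1 hs2
    have hconv : ∀ k : ℕ, ∑ kl ∈ Finset.HasAntidiagonal.antidiagonal k, S' kl.1 * T ^ kl.1 * (A kl.2 * T ^ kl.2)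
        = (k : ℂ) * A k * T ^ k := by
      intro k
      rw [hN k, Finset.Nat.sum_antidiagonal_eq_sum_range_succ_mk, Finset.sum_mul,
        Finset.sum_range_succ', ]
      simp only [hS', if_true, zero_mul, add_zero]
      rw [← Finset.sum_image (s := Finset.range k) (g := fun i => i + 1)
        (f := fun r => (if r = 0 then 0 else S r) * T ^ r * (A (k - r) * T ^ (k - r)))]
      · apply Finset.sum_congr
        · ext a
          simp only [Finset.mem_image, Finset.mem_range, Finset.mem_Icc]
          constructor
          · rintro ⟨b, hb, rfl⟩; omega
          · intro h; exact ⟨a - 1, by omega, by omega⟩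
        · intro r hr
          simp only [Finset.mem_Icc] at hr
          rw [if_neg (by omega)]
          have : T ^ k = T ^ r * T ^ (k - r) := by rw [← pow_add]; congr 1; omega
          rw [this]; ring
      · intro a _ b _ h; simpa using h
    have hder : ∑' k : ℕ, (k : ℂ) * A k * T ^ k = T * (derivative L).eval T := by
      rw [tsum_eq_sum (s := Finset.range D)]
      · rw [hL, derivative_sum, eval_finsetSum, Finset.mul_sum]
        apply Finset.sum_congr rfl
        intro j _
        rw [derivative_C_mul_X_pow]
        simp
        rcases j with _ | j
        · simp
        · simp [pow_succ]; ring
      · intro b hb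
        simp at hb
        simp [hA b hb]
    rw [← hder, ← tsum_congr hconv, ← hprod, hLts, norm_mul, mul_comm]
    refine mul_le_mul_of_nonneg_left ?_ (norm_nonneg _)
    exact tsum_of_norm_bounded hsumq.hasSum hterm
  -- multiplicity
  obtain ⟨Q, hQ, hQn⟩ := L.exists_eq_pow_rootMultiplicity_mul_and_not_dvd hLne T0
  set k := L.rootMultiplicity T0 with hk
  have hk1 : 0 < k := (rootMultiplicity_pos hLne).mpr hT0
  have hQ0 : Q.eval T0 ≠ 0 := by
    intro h; exact hQn (dvd_iff_isRoot.mpr h)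
  have hineq : ∀ T : ℂ, ‖T‖ ≤ ‖T0‖ → T ≠ T0 →
      ‖T * (k * Q.eval T + (T - T0) * (derivative Q).eval T)‖ ≤ ‖T - T0‖ * ‖Q.eval T‖ * M := by
    intro T hT hne
    have h1 := main T hT
    have hLT : L.eval T = (T - T0) ^ k * Q.eval T := by
      conv_lhs => rw [hQ]
      simp
    have hdT : (derivative L).eval T = (T - T0) ^ (k - 1) * (k * Q.eval T + (T - T0) * (derivative Q).eval T) := by
      conv_lhs => rw [hQ]
      simp only [derivative_mul, derivative_X_sub_C_pow, eval_add, eval_mul, eval_pow, eval_sub, eval_X, eval_C, eval_natCast]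
      have : (T - T0) ^ k = (T - T0) ^ (k - 1) * (T - T0) := by
        rw [← pow_succ]; congr 1; omega
      rw [this]; ring
    have hpos : 0 < ‖(T - T0) ^ (k - 1)‖ := norm_pos_iff.mpr (pow_ne_zero _ (sub_ne_zero.mpr hne))
    have : (T - T0) ^ k = (T - T0) ^ (k - 1) * (T - T0) := by
        rw [← pow_succ]; congr 1; omega
    rw [hLT, hdT, this] at h1
    refine le_of_mul_le_mul_left ?_ hpos
    calc _ = ‖T * ((T - T0) ^ (k - 1) * (k * Q.eval T + (T - T0) * (derivative Q).eval T))‖ := by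
            rw [← norm_mul]; congr 1; ring
      _ ≤ _ := h1
      _ = _ := by simp only [norm_mul]; ring
  -- limit
  have hlim : ‖T0 * (k * Q.eval T0 + (T0 - T0) * (derivative Q).eval T0)‖ ≤ ‖T0 - T0‖ * ‖Q.eval T0‖ * M := by
    have hcurve : Filter.Tendsto (fun s : ℝ => (s : ℂ) * T0) (nhdsWithin 1 (Set.Ioo 0 1)) (nhds T0) := by
      have : Continuous (fun s : ℝ => (s : ℂ) * T0) := by fun_prop
      have h2 := this.tendsto 1
      simp only [Complex.ofReal_one, one_mul] at h2
      exact h2.mono_left nhdsWithin_le_nhds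
    have c1 : Continuous (fun T : ℂ => ‖T * (k * Q.eval T + (T - T0) * (derivative Q).eval T)‖) := by
      fun_prop
    have c2 : Continuous (fun T : ℂ => ‖T - T0‖ * ‖Q.eval T‖ * M) := by fun_prop
    have : (nhdsWithin (1:ℝ) (Set.Ioo 0 1)).NeBot := by
      apply right_nhdsWithin_Ioo_neBot; norm_num
    refine le_of_tendsto_of_tendsto ((c1.tendsto T0).comp hcurve) ((c2.tendsto T0).comp hcurve) ?_
    filter_upwards [self_mem_nhdsWithin] with s hs
    apply hineq
    · rw [norm_mul, Complex.norm_real, Real.norm_eq_abs, abs_of_pos hs.1]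
      exact mul_le_of_le_one_left (norm_nonneg _) hs.2.le
    · intro h
      have : (s : ℂ) = 1 := mul_right_cancel₀ hT0ne (by rw [one_mul]; exact h)
      have : s = 1 := by exact_mod_cast this
      linarith [hs.2]
  simp only [sub_self, zero_mul, add_zero, norm_zero] at hlim
  have : T0 * (k * Q.eval T0) ≠ 0 := by
    refine mul_ne_zero hT0ne (mul_ne_zero ?_ hQ0)
    exact_mod_cast hk1.ne'
  exact this (norm_le_zero_iff.mp hlim)

lemma L_bound (A S : ℕ → ℂ) (D : ℕ) (hA0 : A 0 = 1) (hA : ∀ n, D ≤ n → A n = 0)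
    (hN : ∀ n : ℕ, (n : ℂ) * A n = ∑ r ∈ Finset.Icc 1 n, S r * A (n - r)) (R B : ℝ) (hR : 0 < R)
    (hS : ∀ r, 1 ≤ r → ‖S r‖ ≤ B * R ^ r) : ‖S 1‖ ≤ D * R := by
  set L : ℂ[X] := ∑ j ∈ Finset.range D, C (A j) * X ^ j with hL
  have hDpos : 0 < D := by
    by_contra h
    have := hA 0 (by omega)
    rw [hA0] at this
    exact one_ne_zero this
  have hcoeff : ∀ j, L.coeff j = A j := by
    intro j
    rw [hL, finsetSum_coeff]
    simp only [coeff_C_mul_X_pow]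
    rw [Finset.sum_ite_eq]
    split_ifs with h
    · rfl
    · rw [hA j (by simpa using h)]
  have hdeg : L.natDegree ≤ D := by
    rw [natDegree_le_iff_coeff_eq_zero]
    intro N hN
    rw [hcoeff, hA N hN.le]
  have hL0 : L.eval 0 = 1 := by
    rw [← coeff_zero_eq_eval_zero, hcoeff, hA0]
  have hL1 : (derivative L).eval 0 = S 1 := by
    rw [← coeff_zero_eq_eval_zero, coeff_derivative, hcoeff]
    have := hN 1
    simp [hA0] at this
    simp [this]
  have hsp : L.Splits := IsAlgClosed.splits L
  have h := hsp.eval_derivative_div_eval_of_ne_zero (x := 0) (by rw [hL0]; exact one_ne_zero)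
  rw [hL0, hL1, div_one] at h
  rw [h]
  have hcard : L.roots.card ≤ D := (card_roots' L).trans hdeg
  have : ‖(Multiset.map (fun z => 1 / (0 - z)) L.roots).sum‖ ≤ (Multiset.map (fun z : ℂ => R) L.roots).sum := by
    refine (norm_multiset_sum_le _).trans ?_
    rw [Multiset.map_map]
    apply Multiset.sum_map_le_sum_map
    intro z hz
    have h1 := L_root A S D hA0 hA hN R B hR hS z (isRoot_of_mem_roots hz)
    simp only [Function.comp, zero_sub, norm_inv, norm_neg, one_div]
    exact inv_le_of_inv_le₀ hR h1
  refine this.trans ?_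
  rw [Multiset.map_const', Multiset.sum_replicate, nsmul_eq_mul]
  exact mul_le_mul_of_nonneg_right (by exact_mod_cast hcard) hR.le

end LB3

section LC
open Polynomial

lemma fix_finset {K : Type*} [Field K] [IsAlgClosed K] (p : ℕ) [Fact p.Prime] [CharP K p] (r : ℕ)
    (hr : 1 ≤ r) : ∃ F : Finset K, (∀ x, x ∈ F ↔ x ^ p ^ r = x) ∧ F.card = p ^ r := by
  classical
  have hp : 1 < p := (Fact.out : p.Prime).one_lt
  have hq : 1 < p ^ r := Nat.one_lt_pow (by omega) hp
  have hne : (X ^ p ^ r - X : K[X]) ≠ 0 := FiniteField.X_pow_card_sub_X_ne_zero K hq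
  refine ⟨(X ^ p ^ r - X : K[X]).roots.toFinset, ?_, ?_⟩
  · intro x
    rw [Multiset.mem_toFinset, mem_roots hne]
    simp [sub_eq_zero]
  · have hsep : (X ^ p ^ r - X : K[X]).Separable := by
      apply galois_poly_separable p
      exact dvd_pow_self p (by omega)
    rw [Multiset.toFinset_card_of_nodup (nodup_roots hsep)]
    rw [← (IsAlgClosed.splits (X ^ p ^ r - X : K[X])).natDegree_eq_card_roots]
    exact FiniteField.X_pow_card_sub_X_natDegree_eq K hq

lemma eval_frob_iter {K : Type*} [Field K] (p : ℕ) [Fact p.Prime] [CharP K p] (f : K[X])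
    (hf : f.map (frobenius K p) = f) (x : K) (i : ℕ) :
    f.eval ((frobenius K p)^[i] x) = (f.eval x) ^ p ^ i := by
  rw [← iterate_frobenius]
  induction i with
  | zero => rfl
  | succ i ih =>
    rw [Function.iterate_succ_apply', Function.iterate_succ_apply', ← ih]
    conv_lhs => rw [← hf]
    rw [eval_map_apply]

lemma S_bound {K : Type*} [Field K] [IsAlgClosed K] (p : ℕ) [Fact p.Prime] [CharP K p] (f : K[X])
    (hD1 : 1 ≤ f.natDegree) (hDp : f.natDegree < p) (hf : f.map (frobenius K p) = f)
    (Ψ : AddChar K ℂ) (hΨ1 : ∀ x, ‖Ψ x‖ ≤ 1) (t : K) (ht : t ^ p = t) (hΨ : Ψ t ≠ 1)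
    (r : ℕ) (hr : 1 ≤ r) (F : Finset K) (hF : ∀ x, x ∈ F ↔ x ^ p ^ r = x) (hFc : F.card = p ^ r) :
    ‖∑ x ∈ F, Ψ (∑ i ∈ Finset.range r, f.eval ((frobenius K p)^[i] x))‖ ≤
      (p * p * (2 * p * f.natDegree + f.natDegree + 2)) * (Real.sqrt p) ^ r := by
  classical
  have hp : 1 < p := (Fact.out : p.Prime).one_lt
  have hp1 : (1:ℝ) ≤ p := by exact_mod_cast hp.le
  have hs1 : 1 ≤ Real.sqrt p := by rw [Real.one_le_sqrt]; exact hp1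
  have hss : Real.sqrt p * Real.sqrt p = p := Real.mul_self_sqrt (by linarith)
  set E : ℝ := 2 * p * f.natDegree + f.natDegree + 2 with hE
  have hE1 : 1 ≤ E := by
    have : 0 ≤ 2 * (p:ℝ) * f.natDegree + f.natDegree := by positivity
    linarith
  obtain rfl | hr2 : r = 1 ∨ 2 ≤ r := by omega
  · refine (norm_sum_le_of_le _ (fun x _ => hΨ1 _)).trans ?_
    rw [Finset.sum_const, hFc]
    simp only [pow_one, nsmul_eq_mul, mul_one]
    calc (p:ℝ) = p * 1 * 1 * 1 := by ring
      _ ≤ p * p * E * Real.sqrt p := by gcongr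
  obtain ⟨F1, hF1, hF1c⟩ := fix_finset (K := K) p 1 le_rfl
  simp only [pow_one] at hF1 hF1c
  set T : K → K := fun x => ∑ i ∈ Finset.range r, (f.eval x) ^ p ^ i with hT
  have hTe : ∀ x, ∑ i ∈ Finset.range r, f.eval ((frobenius K p)^[i] x) = T x := by
    intro x
    exact Finset.sum_congr rfl (fun i _ => eval_frob_iter p f hf x i)
  simp_rw [hTe]
  have hTF : ∀ x ∈ F, T x ∈ F1 := by
    intro x hx
    rw [hF1]
    have hx' := (hF x).mp hx
    have hfr : (f.eval x) ^ p ^ r = f.eval x := by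
      rw [← eval_frob_iter p f hf, iterate_frobenius, hx']
    change frobenius K p (T x) = T x
    simp only [hT, map_sum, map_pow, frobenius_def]
    have e1 : ∀ i, ((f.eval x) ^ p) ^ p ^ i = (f.eval x) ^ p ^ (i + 1) := by
      intro i; rw [← pow_mul, pow_succ, mul_comm]
    simp_rw [e1]
    have e2 := Finset.sum_range_succ (fun i => (f.eval x) ^ p ^ i) r
    have e3 := Finset.sum_range_succ' (fun i => (f.eval x) ^ p ^ i) r
    rw [e2] at e3
    simp only [hfr, pow_zero, pow_one] at e3
    exact (add_right_cancel e3).symm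
  set err : ℕ := p ^ (r - r / 2) * (2 * p * f.natDegree + f.natDegree + 2) with herr
  have hZ : ∀ b, ((F.filter (fun x => T x = b)).card : ℝ) ≤ p ^ (r - 1) + err := by
    intro b
    have := stepanov p f hD1 hDp r (r / 2) (by omega) (by omega) b (F.filter (fun x => T x = b)) (by
      intro x hx
      rw [Finset.mem_filter] at hx
      exact ⟨(hF x).mp hx.1, hx.2⟩)
    exact_mod_cast this
  have hsumΨ : ∑ b ∈ F1, Ψ b = 0 := by
    have key : ∑ b ∈ F1, Ψ b = ∑ b ∈ F1, Ψ t * Ψ b := by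
      symm
      refine Finset.sum_bij' (fun b _ => t + b) (fun b _ => b - t) ?_ ?_ ?_ ?_ ?_
      · intro b hb
        rw [hF1] at hb ⊢
        rw [add_pow_char, ht, hb]
      · intro b hb
        rw [hF1] at hb ⊢
        rw [sub_pow_char, ht, hb]
      · intro b hb; ring
      · intro b hb; ring
      · intro b hb; rw [AddChar.map_add_eq_mul]
    rw [← Finset.mul_sum] at key
    have : (Ψ t - 1) * ∑ b ∈ F1, Ψ b = 0 := by
      rw [sub_mul, ← key]; ring
    rcases mul_eq_zero.mp this with h | h
    · exact absurd (sub_eq_zero.mp h) hΨ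
    · exact h
  have hfib : ∑ x ∈ F, Ψ (T x) = ∑ b ∈ F1, ((F.filter (fun x => T x = b)).card : ℂ) * Ψ b := by
    rw [← Finset.sum_fiberwise_of_maps_to hTF]
    apply Finset.sum_congr rfl
    intro b _
    rw [← nsmul_eq_mul, ← Finset.sum_const]
    apply Finset.sum_congr rfl
    intro x hx
    rw [(Finset.mem_filter.mp hx).2]
  have hcardsum : ∑ b ∈ F1, ((F.filter (fun x => T x = b)).card : ℝ) = p ^ r := by
    have := Finset.card_eq_sum_card_fiberwise hTF
    rw [hFc] at this
    exact_mod_cast this.symm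
  have h2 : ∑ x ∈ F, Ψ (T x) = - ∑ b ∈ F1, (((p : ℝ) ^ (r - 1) + err - (F.filter (fun x => T x = b)).card : ℝ) : ℂ) * Ψ b := by
    rw [hfib]
    have : ∑ b ∈ F1, (((p : ℝ) ^ (r - 1) + err : ℝ) : ℂ) * Ψ b = 0 := by
      rw [← Finset.mul_sum, hsumΨ, mul_zero]
    rw [eq_neg_iff_add_eq_zero, ← this, ← Finset.sum_add_distrib]
    apply Finset.sum_congr rfl
    intro b _
    push_cast
    ring
  have h3 : ‖∑ x ∈ F, Ψ (T x)‖ ≤ p * err := by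
    rw [h2, norm_neg]
    refine (norm_sum_le_of_le _ (f := _) (n := fun b => (p : ℝ) ^ (r - 1) + err - (F.filter (fun x => T x = b)).card) ?_).trans ?_
    · intro b _
      rw [norm_mul, Complex.norm_real, Real.norm_eq_abs, abs_of_nonneg (by linarith [hZ b])]
      exact mul_le_of_le_one_right (by linarith [hZ b]) (hΨ1 b)
    · rw [Finset.sum_sub_distrib, hcardsum, Finset.sum_const, hF1c, nsmul_eq_mul, mul_add, ← pow_succ',
        Nat.sub_add_cancel hr]
      linarith
  refine h3.trans ?_
  have h4 : (p : ℝ) ^ (r - r / 2) ≤ p * Real.sqrt p ^ r := by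
    calc (p : ℝ) ^ (r - r / 2) = (Real.sqrt p * Real.sqrt p) ^ (r - r / 2) := by rw [hss]
      _ = Real.sqrt p ^ (2 * (r - r / 2)) := by rw [← sq, ← pow_mul]
      _ ≤ Real.sqrt p ^ (r + 2) := pow_le_pow_right₀ hs1 (by omega)
      _ = p * Real.sqrt p ^ r := by rw [pow_add, sq, hss]; ring
  rw [herr]
  push_cast
  rw [← hE]
  calc (p : ℝ) * (p ^ (r - r / 2) * E) ≤ p * ((p * Real.sqrt p ^ r) * E) := by gcongr
    _ = _ := by ring

theorem weil_bound (p : ℕ) [Fact p.Prime] (ψ : AddChar (ZMod p) ℂ) (t : ZMod p) (ht : ψ t ≠ 1)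
    (f : (ZMod p)[X]) (hD1 : 1 ≤ f.natDegree) (hDp : f.natDegree < p) :
    ‖∑ x, ψ (f.eval x)‖ ≤ f.natDegree * Real.sqrt p := by
  classical
  have hp : 1 < p := (Fact.out : p.Prime).one_lt
  let K := AlgebraicClosure (ZMod p)
  have : CharP K p := charP_of_injective_algebraMap (algebraMap (ZMod p) K).injective p
  obtain ⟨π, hπ⟩ := LinearMap.exists_leftInverse_of_injective (Algebra.linearMap (ZMod p) K)
    (LinearMap.ker_eq_bot.mpr (algebraMap (ZMod p) K).injective)
  have hπ' : ∀ x : ZMod p, π (algebraMap (ZMod p) K x) = x := fun x => LinearMap.congr_fun hπ x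
  let Ψ : AddChar K ℂ := ψ.compAddMonoidHom π.toAddMonoidHom
  have hΨ : ∀ x, Ψ x = ψ (π x) := fun x => rfl
  have hΨ1 : ∀ x, ‖Ψ x‖ ≤ 1 := fun x => by rw [hΨ, AddChar.norm_apply]
  let φ := frobenius K p
  have hfix : ∀ x : ZMod p, (algebraMap (ZMod p) K x) ^ p = algebraMap (ZMod p) K x := by
    intro x; rw [← map_pow, ZMod.pow_card]
  set g : K[X] := f.map (algebraMap (ZMod p) K) with hg
  have hgd : g.natDegree = f.natDegree := natDegree_map _
  have hgφ : g.map φ = g := by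
    rw [hg, map_map]
    congr 1
    ext x
    exact hfix x
  choose F hF hFc using fun (r : ℕ) (hr : 1 ≤ r) => fix_finset (K := K) p r hr
  let F' : ℕ → Finset K := fun r => if hr : 1 ≤ r then F r hr else ∅
  have hF' : ∀ r, 1 ≤ r → ∀ x, x ∈ F' r ↔ φ^[r] x = x := by
    intro r hr x
    simp only [F', dif_pos hr, hF]
    rw [show φ^[r] x = x ^ p ^ r from by rw [← iterate_frobenius]]
  have hF'c : ∀ r, 1 ≤ r → (F' r).card = p ^ r := by
    intro r hr; simp only [F', dif_pos hr, hFc]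
  have hfin : {x | φ x = x}.Finite := by
    apply (F' 1).finite_toSet.subset
    intro x hx
    exact (hF' 1 le_rfl x).mpr hx
  let M : ℕ → Finset K[X] := fun n => (Mset_finite φ hfin n).toFinset
  have hM : ∀ n g, g ∈ M n ↔ g ∈ Mset φ n := fun n g => by simp [M]
  have htt : Ψ (algebraMap (ZMod p) K t) ≠ 1 := by rw [hΨ, hπ']; exact ht
  have hD0 : (g.natDegree : K) ≠ 0 := by
    rw [hgd, Ne, CharP.cast_eq_zero_iff K p]
    intro h
    exact absurd (Nat.le_of_dvd (by omega) h) (by omega)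
  have hM0 : M 0 = {1} := by
    ext h
    rw [hM, Finset.mem_singleton]
    constructor
    · rintro ⟨h1, h2, -⟩; exact h1.natDegree_eq_zero.mp h2
    · rintro rfl; exact ⟨monic_one, natDegree_one, by simp⟩
  have key := L_bound (fun n => ∑ h ∈ M n, Ψ ((h.roots.map (fun x => g.eval x)).sum))
    (fun r => ∑ x ∈ F' r, Ψ (∑ i ∈ Finset.range r, g.eval (φ^[i] x))) g.natDegree
    (by simp [hM0]) (fun n hn => L_vanish φ M hM Ψ g (by omega) hD0 hgφ _ (hfix t) htt n hn)
    (fun n => newton_L φ F' hF' M hM Ψ g n) (Real.sqrt p)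
    (p * p * (2 * p * g.natDegree + g.natDegree + 2)) (Real.sqrt_pos.mpr (by exact_mod_cast (by omega : 0 < p)))
    (fun r hr => S_bound p g (by omega) (by omega) hgφ Ψ hΨ1 _ (hfix t) htt r hr (F' r)
      (fun x => by rw [hF' r hr, show φ^[r] x = x ^ p ^ r from by rw [← iterate_frobenius]]) (hF'c r hr))
  have hF1 : F' 1 = Finset.univ.image (algebraMap (ZMod p) K) := by
    symm
    apply Finset.eq_of_subset_of_card_le
    · intro y hy
      obtain ⟨x, -, rfl⟩ := Finset.mem_image.mp hy
      exact (hF' 1 le_rfl _).mpr (hfix x)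
    · rw [hF'c 1 le_rfl, Finset.card_image_of_injective _ (algebraMap (ZMod p) K).injective,
        Finset.card_univ, ZMod.card, pow_one]
  rw [hgd] at key
  convert key using 2
  rw [hF1, Finset.sum_image (fun a _ b _ h => (algebraMap (ZMod p) K).injective h)]
  apply Finset.sum_congr rfl
  intro x _
  simp only [Finset.range_one, Finset.sum_singleton, Function.iterate_zero, id]
  rw [hg, eval_map_algebraMap, Polynomial.aeval_algebraMap_apply_eq_algebraMap_eval, hΨ]
  simp [hπ']

end LC

section LD
open Polynomial

noncomputable def hhat {p : ℕ} [NeZero p] (h : ZMod p → ℂ) (a : ZMod p) : ℂ :=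
  (p : ℂ)⁻¹ * ∑ t, ZMod.stdAddChar (-(t * a)) * h t

lemma hhat_inv {p : ℕ} [NeZero p] (h : ZMod p → ℂ) (t : ZMod p) :
    h t = ∑ a, hhat h a * ZMod.stdAddChar (a * t) := by
  have h1 : h = ZMod.dft.symm (ZMod.dft h) := by simp
  have h2 := congrFun h1 t
  rw [ZMod.invDFT_apply] at h2
  simp only [ZMod.dft_apply, smul_eq_mul] at h2
  rw [h2, Finset.mul_sum]
  apply Finset.sum_congr rfl
  intro a _
  unfold hhat
  ring

lemma hhat_zero {p : ℕ} [NeZero p] (h : ZMod p → ℂ) : hhat h 0 = (p : ℂ)⁻¹ * ∑ t, h t := by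
  simp [hhat]

lemma norm_std {p : ℕ} [NeZero p] (a : ZMod p) : ‖(ZMod.stdAddChar a : ℂ)‖ = 1 := by
  rw [AddChar.norm_apply]

lemma hhat_mul {p : ℕ} [NeZero p] (h : ZMod p → ℂ) (a : ZMod p) :
    ‖(ZMod.stdAddChar a : ℂ) - 1‖ * ‖hhat h a‖ ≤ (p : ℝ)⁻¹ * ∑ t, ‖h (t + 1) - h t‖ := by
  have e : ((ZMod.stdAddChar a : ℂ) - 1) * hhat h a =
      (p : ℂ)⁻¹ * ∑ t, ZMod.stdAddChar (-(t * a)) * (h (t + 1) - h t) := by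
    have e1 : ∑ t, (ZMod.stdAddChar (-(t * a)) : ℂ) * h (t + 1) =
        ZMod.stdAddChar a * ∑ t, (ZMod.stdAddChar (-(t * a)) : ℂ) * h t := by
      rw [← Equiv.sum_comp (Equiv.addRight (1 : ZMod p)) (fun t => (ZMod.stdAddChar (-(t * a)) : ℂ) * h t),
        Finset.mul_sum]
      apply Finset.sum_congr rfl
      intro t _
      rw [← mul_assoc, ← AddChar.map_add_eq_mul]
      simp only [Equiv.coe_addRight]
      congr 2
      ring
    simp_rw [mul_sub, Finset.sum_sub_distrib]
    rw [e1]
    unfold hhat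
    ring
  rw [← norm_mul, e, norm_mul, norm_inv, Complex.norm_natCast]
  gcongr
  refine norm_sum_le_of_le _ ?_
  intro t _
  rw [norm_mul, norm_std, one_mul]

lemma two_mul_le_sin (x : ℝ) (h0 : 0 ≤ x) (h1 : x ≤ 1) : 2 * x * (1 - x) ≤ Real.sin (Real.pi * x) := by
  have hpi := Real.pi_pos
  rcases le_total x (1 / 2) with h | h
  · have := Real.mul_le_sin (x := Real.pi * x) (by positivity) (by nlinarith)
    have e : 2 / Real.pi * (Real.pi * x) = 2 * x := by field_simp
    nlinarith
  · have := Real.mul_le_sin (x := Real.pi - Real.pi * x) (by nlinarith) (by nlinarith)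
    rw [Real.sin_pi_sub] at this
    have e : 2 / Real.pi * (Real.pi - Real.pi * x) = 2 * (1 - x) := by field_simp
    nlinarith

lemma std_lower {p : ℕ} [NeZero p] (a : ZMod p) :
    4 * ((a.val : ℝ) / p) * (1 - (a.val : ℝ) / p) ≤ ‖(ZMod.stdAddChar a : ℂ) - 1‖ := by
  have hp : (0:ℝ) < p := by exact_mod_cast Nat.pos_of_ne_zero (NeZero.ne p)
  have hlt : (a.val : ℝ) < p := by exact_mod_cast ZMod.val_lt a
  rw [ZMod.stdAddChar_apply, ZMod.toCircle_apply]
  have := Complex.norm_exp_I_mul_ofReal_sub_one (2 * Real.pi * (a.val / p))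
  have e : 2 * (Real.pi : ℂ) * Complex.I * a.val / p = Complex.I * ((2 * Real.pi * (a.val / p) : ℝ) : ℂ) := by
    push_cast; ring
  rw [e, this]
  have h2 := two_mul_le_sin ((a.val : ℝ) / p) (by positivity) (by rw [div_le_one hp]; exact hlt.le)
  have e2 : 2 * Real.pi * ((a.val : ℝ) / p) / 2 = Real.pi * (a.val / p) := by ring
  rw [e2]
  refine le_trans ?_ (Real.le_norm_self _)
  linarith

lemma sum_val_inv (p : ℕ) [NeZero p] : ∑ a : ZMod p, (a.val : ℝ)⁻¹ ≤ 1 + Real.log p := by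
  obtain ⟨n, rfl⟩ : ∃ n, p = n + 1 := ⟨p - 1, by have := NeZero.ne p; omega⟩
  have h1 : ∑ a : ZMod (n + 1), (a.val : ℝ)⁻¹ = ∑ i ∈ Finset.range (n + 1), (i : ℝ)⁻¹ :=
    Fin.sum_univ_eq_sum_range (fun i : ℕ => (i : ℝ)⁻¹) (n + 1)
  rw [h1, Finset.sum_range_succ']
  have h2 := harmonic_le_one_add_log n
  have h3 : ((harmonic n : ℚ) : ℝ) = ∑ i ∈ Finset.range n, ((i + 1 : ℕ) : ℝ)⁻¹ := by
    simp [harmonic]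
  rw [h3] at h2
  simp only [Nat.cast_zero, inv_zero, add_zero]
  refine h2.trans ?_
  rcases Nat.eq_zero_or_pos n with rfl | hn
  · simp
  · gcongr
    · simp

lemma hhat_l1 {p : ℕ} [Fact p.Prime] (h : ZMod p → ℂ) :
    ∑ a ∈ Finset.univ.erase 0, ‖hhat h a‖ ≤ 2 * Real.log p * ∑ t, ‖h (t + 1) - h t‖ := by
  have hp2 : 2 ≤ p := (Fact.out : p.Prime).two_le
  have hp : (0:ℝ) < p := by exact_mod_cast (by omega : 0 < p)
  set V := ∑ t, ‖h (t + 1) - h t‖ with hV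
  have hV0 : 0 ≤ V := Finset.sum_nonneg (fun _ _ => norm_nonneg _)
  have hb : ∀ a ∈ Finset.univ.erase (0 : ZMod p), ‖hhat h a‖ ≤ V / 4 * ((a.val : ℝ)⁻¹ + ((-a).val : ℝ)⁻¹) := by
    intro a ha
    have ha0 : a ≠ 0 := (Finset.mem_erase.mp ha).1
    have h1 := hhat_mul h a
    have h2 := std_lower a
    have hlt : a.val < p := ZMod.val_lt a
    have hpos : 0 < a.val := Nat.pos_of_ne_zero (fun h => ha0 ((ZMod.val_eq_zero a).mp h))
    have hneg : ((-a).val : ℝ) = p - a.val := by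
      rw [ZMod.neg_val, if_neg ha0, Nat.cast_sub hlt.le]
    rw [hneg]
    set x : ℝ := (a.val : ℝ) with hx
    have hx0 : 0 < x := Nat.cast_pos.mpr hpos
    have hx1 : 0 < (p:ℝ) - x := by
      have : x < p := Nat.cast_lt.mpr hlt
      linarith
    have h3 : 4 * (x / p) * (1 - x / p) * ‖hhat h a‖ ≤ (p:ℝ)⁻¹ * V :=
      (mul_le_mul_of_nonneg_right h2 (norm_nonneg _)).trans h1
    have e : V / 4 * (x⁻¹ + (p - x)⁻¹) = ((p:ℝ)⁻¹ * V) / (4 * (x / p) * (1 - x / p)) := by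
      have : (1 - x / p) = (p - x) / p := by field_simp
      rw [this]
      field_simp
      ring
    rw [e, le_div_iff₀ (by
      have : (1 - x / p) = (p - x) / p := by field_simp
      rw [this]; positivity)]
    linarith
  refine (Finset.sum_le_sum hb).trans ?_
  rw [← Finset.mul_sum]
  have h4 : ∑ a ∈ Finset.univ.erase (0 : ZMod p), ((a.val : ℝ)⁻¹ + ((-a).val : ℝ)⁻¹) ≤
      ∑ a : ZMod p, ((a.val : ℝ)⁻¹ + ((-a).val : ℝ)⁻¹) :=
    Finset.sum_le_sum_of_subset_of_nonneg (Finset.subset_univ _) (fun _ _ _ => by positivity)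
  have h5 : ∑ a : ZMod p, (((-a).val : ℝ)⁻¹) = ∑ a : ZMod p, (a.val : ℝ)⁻¹ :=
    Equiv.sum_comp (Equiv.neg (ZMod p)) (fun a => (a.val : ℝ)⁻¹)
  have h45 : ∑ a : ZMod p, ((a.val : ℝ)⁻¹ + ((-a).val : ℝ)⁻¹) = 2 * ∑ a : ZMod p, (a.val : ℝ)⁻¹ := by
    rw [Finset.sum_add_distrib, h5]; ring
  rw [h45] at h4
  have h6 := sum_val_inv p
  have hlog : Real.log 2 ≤ Real.log p := Real.log_le_log (by norm_num) (by exact_mod_cast hp2)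
  have := Real.log_two_gt_d9
  calc _ ≤ V / 4 * (8 * Real.log p) := by
        apply mul_le_mul_of_nonneg_left _ (by positivity)
        linarith
    _ = _ := by ring

lemma exp_sum_poly {p : ℕ} [Fact p.Prime] (h : ZMod p → ℂ) (f : (ZMod p)[X]) (h2 : 2 ≤ f.natDegree)
    (hfp : f.natDegree < p) :
    ‖∑ t, h t * ZMod.stdAddChar (f.eval t)‖ ≤ f.natDegree * Real.sqrt p *
      ((p : ℝ)⁻¹ * ‖∑ t, h t‖ + 2 * Real.log p * ∑ t, ‖h (t + 1) - h t‖) := by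
  have hp2 : 2 ≤ p := (Fact.out : p.Prime).two_le
  have e : ∑ t, h t * ZMod.stdAddChar (f.eval t) =
      ∑ a, hhat h a * ∑ t, ZMod.stdAddChar ((f + C a * X).eval t) := by
    simp_rw [Finset.mul_sum]
    rw [Finset.sum_comm]
    apply Finset.sum_congr rfl
    intro t _
    rw [hhat_inv h t, Finset.sum_mul]
    apply Finset.sum_congr rfl
    intro a _
    rw [mul_assoc, ← AddChar.map_add_eq_mul]
    simp [add_comm]
  rw [e]
  have hb : ∀ a, ‖hhat h a * ∑ t, ZMod.stdAddChar ((f + C a * X).eval t)‖ ≤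
      f.natDegree * Real.sqrt p * ‖hhat h a‖ := by
    intro a
    have hd : (f + C a * X).natDegree = f.natDegree := by
      apply natDegree_add_eq_left_of_natDegree_lt
      exact (natDegree_C_mul_le a X).trans_lt (by rw [natDegree_X]; omega)
    have hne : (ZMod.stdAddChar (1 : ZMod p) : ℂ) ≠ 1 := by
      intro hh
      have : (1 : ZMod p) = 0 := ZMod.injective_stdAddChar (by rw [hh]; simp)
      exact one_ne_zero this
    have := weil_bound p ZMod.stdAddChar 1 hne (f + C a * X) (by omega) (by omega)
    rw [hd] at this
    rw [norm_mul, mul_comm]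
    exact mul_le_mul_of_nonneg_right this (norm_nonneg _)
  refine (norm_sum_le_of_le _ (fun a _ => hb a)).trans ?_
  rw [← Finset.mul_sum]
  apply mul_le_mul_of_nonneg_left _ (by positivity)
  rw [← Finset.add_sum_erase _ _ (Finset.mem_univ 0)]
  have h0 : ‖hhat h 0‖ = (p : ℝ)⁻¹ * ‖∑ t, h t‖ := by
    rw [hhat_zero, norm_mul, norm_inv, Complex.norm_natCast]
  rw [h0]
  gcongr
  exact hhat_l1 h

open Classical in
noncomputable def cInd (p : ℕ) (α β : ℝ) (y : ZMod p) : ℝ :=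
  if α ≤ (y.val : ℝ) / p ∧ (y.val : ℝ) / p < β then 1 else 0

lemma cInd_var (p : ℕ) [Fact p.Prime] (α β : ℝ) :
    ∑ t : ZMod p, ‖(cInd p α β (t + 1) : ℂ) - cInd p α β t‖ ≤ 3 := by
  classical
  have hp2 : 2 ≤ p := (Fact.out : p.Prime).two_le
  have hp : (0:ℝ) < p := by exact_mod_cast (by omega : 0 < p)
  let A : ℕ → ℝ := fun k => if α ≤ (k : ℝ) / p then 1 else 0
  let B : ℕ → ℝ := fun k => if (k : ℝ) / p < β then 1 else 0
  let g : ℕ → ℝ := fun k => A k * B k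
  have hg : ∀ y : ZMod p, cInd p α β y = g y.val := by
    intro y
    simp only [cInd, g, A, B]
    rw [ite_and]
    split_ifs <;> norm_num
  have hA : ∀ k, 0 ≤ A k ∧ A k ≤ 1 := by intro k; simp only [A]; split_ifs <;> simp
  have hB : ∀ k, 0 ≤ B k ∧ B k ≤ 1 := by intro k; simp only [B]; split_ifs <;> simp
  have hlt : ∀ k : ℕ, (k : ℝ) / p < ((k + 1 : ℕ) : ℝ) / p := by
    intro k; apply div_lt_div_of_pos_right _ hp; push_cast; linarith
  have hA' : ∀ k, A k ≤ A (k + 1) := by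
    intro k; simp only [A]; split_ifs with h1 h2
    · simp
    · exact absurd (h1.trans (hlt k).le) h2
    · simp
    · simp
  have hB' : ∀ k, B (k + 1) ≤ B k := by
    intro k; simp only [B]; split_ifs with h1 h2
    · simp
    · exact absurd ((hlt k).trans h1) h2
    · simp
    · simp
  have hstep : ∀ k, |g (k + 1) - g k| ≤ (A (k + 1) - A k) + (B k - B (k + 1)) := by
    intro k
    simp only [g]
    have e : A (k + 1) * B (k + 1) - A k * B k = (A (k + 1) - A k) * B (k + 1) - A k * (B k - B (k + 1)) := by ring
    have a1 := hA k
    have b1 := hB (k + 1)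
    have a2 := hA' k
    have b2 := hB' k
    rw [e, abs_le]
    constructor <;> nlinarith [mul_nonneg (sub_nonneg.mpr a2) b1.1, mul_nonneg a1.1 (sub_nonneg.mpr b2)]
  have hgb : ∀ k, 0 ≤ g k ∧ g k ≤ 1 := fun k =>
    ⟨mul_nonneg (hA k).1 (hB k).1, mul_le_one₀ (hA k).2 (hB k).1 (hB k).2⟩
  have hnorm : ∀ t : ZMod p, ‖(cInd p α β (t + 1) : ℂ) - cInd p α β t‖ = |g (t + 1).val - g t.val| := by
    intro t
    rw [hg, hg, ← Complex.ofReal_sub, Complex.norm_real, Real.norm_eq_abs]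
  simp_rw [hnorm]
  have hle : ∀ t : ZMod p, |g (t + 1).val - g t.val| ≤
      (if t.val = p - 1 then 1 else 0) + ((A (t.val + 1) - A t.val) + (B t.val - B (t.val + 1))) := by
    intro t
    have htl := ZMod.val_lt t
    by_cases ht : t.val = p - 1
    · rw [if_pos ht]
      have h1 := hgb (t + 1).val
      have h2 := hgb t.val
      have h3 := hA' t.val
      have h4 := hB' t.val
      have : |g (t + 1).val - g t.val| ≤ 1 := by rw [abs_le]; constructor <;> linarith
      linarith
    · rw [if_neg ht, zero_add]
      have : (t + 1).val = t.val + 1 := by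
        rw [ZMod.val_add_of_lt]
        · rw [ZMod.val_one]
        · rw [ZMod.val_one]; omega
      rw [this]
      exact hstep _
  refine (Finset.sum_le_sum (fun t _ => hle t)).trans ?_
  have htr : ∀ F : ℕ → ℝ, ∑ t : ZMod p, F t.val = ∑ k ∈ Finset.range p, F k := by
    intro F
    obtain ⟨n, rfl⟩ : ∃ n, p = n + 1 := ⟨p - 1, by omega⟩
    exact Fin.sum_univ_eq_sum_range F (n + 1)
  rw [htr (fun k => (if k = p - 1 then 1 else 0) + ((A (k + 1) - A k) + (B k - B (k + 1))))]
  rw [Finset.sum_add_distrib, Finset.sum_add_distrib, Finset.sum_range_sub, Finset.sum_range_sub']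
  rw [Finset.sum_ite_eq', if_pos (by simp; omega)]
  linarith [(hA p).2, (hA 0).1, (hB 0).2, (hB p).1]

lemma cInd_l1 (p : ℕ) [Fact p.Prime] (α β : ℝ) :
    ∑ a, ‖hhat (fun y => (cInd p α β y : ℂ)) a‖ ≤ 8 * Real.log p := by
  have hp2 : 2 ≤ p := (Fact.out : p.Prime).two_le
  have hp : (0:ℝ) < p := by exact_mod_cast (by omega : 0 < p)
  rw [← Finset.add_sum_erase _ _ (Finset.mem_univ 0)]
  have h1 := hhat_l1 (fun y => (cInd p α β y : ℂ))
  have h2 := cInd_var p α β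
  have hlog : Real.log 2 ≤ Real.log p := Real.log_le_log (by norm_num) (by exact_mod_cast hp2)
  have := Real.log_two_gt_d9
  have h3 : ‖hhat (fun y => (cInd p α β y : ℂ)) 0‖ ≤ 1 := by
    rw [hhat_zero, norm_mul, norm_inv, Complex.norm_natCast, inv_mul_le_iff₀ hp, mul_one]
    refine (norm_sum_le_of_le _ (n := fun _ => 1) ?_).trans (by simp [ZMod.card])
    intro t _
    rw [Complex.norm_real]
    unfold cInd
    split_ifs <;> simp
  have h4 : 2 * Real.log p * ∑ t : ZMod p, ‖(cInd p α β (t + 1) : ℂ) - cInd p α β t‖ ≤ 2 * Real.log p * 3 :=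
    mul_le_mul_of_nonneg_left h2 (by linarith)
  linarith

/-- number of residues in the interval -/
lemma cInd_sum (p : ℕ) [Fact p.Prime] (α β : ℝ) (h0 : 0 ≤ α) (h1 : α ≤ β) (h2 : β ≤ 1) :
    (β - α) * p - 1 ≤ ∑ y : ZMod p, cInd p α β y := by
  classical
  have hp2 : 2 ≤ p := (Fact.out : p.Prime).two_le
  have hp : (0:ℝ) < p := by exact_mod_cast (by omega : 0 < p)
  let F : ℕ → ℝ := fun k => if α ≤ (k : ℝ) / p ∧ (k : ℝ) / p < β then 1 else 0
  have htr : ∑ t : ZMod p, cInd p α β t = ∑ k ∈ Finset.range p, F k := by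
    obtain ⟨n, rfl⟩ : ∃ n, p = n + 1 := ⟨p - 1, by omega⟩
    exact Fin.sum_univ_eq_sum_range F (n + 1)
  rw [htr]
  simp only [F]
  rw [← Finset.sum_filter, Finset.sum_const, nsmul_eq_mul, mul_one]
  have hsub : Finset.Ico ⌈α * p⌉₊ ⌈β * p⌉₊ ⊆
      Finset.filter (fun k : ℕ => α ≤ (k : ℝ) / p ∧ (k : ℝ) / p < β) (Finset.range p) := by
    intro k hk
    rw [Finset.mem_Ico, Nat.ceil_le, Nat.lt_ceil] at hk
    rw [Finset.mem_filter, Finset.mem_range, le_div_iff₀ hp, div_lt_iff₀ hp]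
    refine ⟨?_, hk.1, hk.2⟩
    have : (k : ℝ) < p := by nlinarith [hk.2]
    exact_mod_cast this
  have hc := Finset.card_le_card hsub
  rw [Nat.card_Ico] at hc
  have hc' : ((⌈β * p⌉₊ - ⌈α * p⌉₊ : ℕ) : ℝ) ≤ ((Finset.filter (fun k : ℕ => α ≤ (k : ℝ) / p ∧ (k : ℝ) / p < β) (Finset.range p)).card : ℝ) := by
    exact_mod_cast hc
  refine le_trans ?_ hc'
  have hmono : ⌈α * p⌉₊ ≤ ⌈β * p⌉₊ := Nat.ceil_mono (by nlinarith)
  rw [Nat.cast_sub hmono]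
  have c1 := Nat.le_ceil (β * p)
  have c2 := Nat.ceil_lt_add_one (show 0 ≤ α * p by positivity)
  nlinarith

end LD

section LE

lemma coeff_prod_le {R ι : Type*} [CommRing R] (s : Finset ι) (f : ι → Polynomial R) (k : ι → ℕ)
    (hf : ∀ i ∈ s, (f i).natDegree ≤ k i) :
    (∏ i ∈ s, f i).natDegree ≤ ∑ i ∈ s, k i ∧
      (∏ i ∈ s, f i).coeff (∑ i ∈ s, k i) = ∏ i ∈ s, (f i).coeff (k i) := by
  classical
  induction s using Finset.induction_on with
  | empty => simp
  | insert a s ha ih =>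
    have ih' := ih (fun i hi => hf i (Finset.mem_insert_of_mem hi))
    have h1 := hf a (Finset.mem_insert_self a s)
    rw [Finset.prod_insert ha, Finset.sum_insert ha, Finset.prod_insert ha]
    refine ⟨Polynomial.natDegree_mul_le_of_le h1 ih'.1, ?_⟩
    rw [Polynomial.coeff_mul_add_eq_of_natDegree_le h1 ih'.1, ih'.2]

lemma line_poly {p m : ℕ} [Fact p.Prime] (F : MvPolynomial (Fin m) (ZMod p)) (x v : Fin m → ZMod p)
    (hv : MvPolynomial.eval v (MvPolynomial.homogeneousComponent F.totalDegree F) ≠ 0) :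
    ∃ f : Polynomial (ZMod p), f.natDegree = F.totalDegree ∧
      ∀ t, f.eval t = MvPolynomial.eval (fun i => x i + t * v i) F := by
  classical
  set L : Fin m → Polynomial (ZMod p) := fun i => Polynomial.C (x i) + Polynomial.C (v i) * Polynomial.X with hL
  have hLd : ∀ i, (L i).natDegree ≤ 1 := by
    intro i
    simp only [hL]
    compute_degree
  have hLc : ∀ i, (L i).coeff 1 = v i := by
    intro i
    simp [hL, Polynomial.coeff_C]
  have hmon : ∀ s : Fin m →₀ ℕ, (∏ i, L i ^ s i).natDegree ≤ s.degree ∧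
      (∏ i, L i ^ s i).coeff s.degree = ∏ i, v i ^ s i := by
    intro s
    have := coeff_prod_le Finset.univ (fun i => L i ^ s i) (fun i => s i) (by
      intro i _
      have := Polynomial.natDegree_pow_le_of_le (s i) (hLd i)
      simpa using this)
    have e : s.degree = ∑ i, s i := by
      rw [Finsupp.degree_eq_sum]
    rw [e]
    refine ⟨this.1, this.2.trans ?_⟩
    apply Finset.prod_congr rfl
    intro i _
    have := Polynomial.coeff_pow_of_natDegree_le (m := s i) (hLd i)
    rw [mul_one] at this
    rw [this, hLc]
  have hdeg : ∀ s ∈ F.support, s.degree ≤ F.totalDegree := by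
    intro s hs
    exact MvPolynomial.le_totalDegree hs
  set f := MvPolynomial.eval₂ Polynomial.C L F with hf
  have hfs : f = ∑ s ∈ F.support, Polynomial.C (F.coeff s) * ∏ i, L i ^ s i := by
    rw [hf, MvPolynomial.eval₂_eq']
  have hc : f.coeff F.totalDegree = MvPolynomial.eval v (MvPolynomial.homogeneousComponent F.totalDegree F) := by
    rw [hfs, Polynomial.finsetSum_coeff, MvPolynomial.homogeneousComponent_apply, map_sum, Finset.sum_filter]
    apply Finset.sum_congr rfl
    intro s hs
    rw [Polynomial.coeff_C_mul]
    split_ifs with h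
    · rw [← h, (hmon s).2, MvPolynomial.eval_monomial, Finsupp.prod_fintype]
      intro i; simp
    · rw [Polynomial.coeff_eq_zero_of_natDegree_lt, mul_zero]
      exact (hmon s).1.trans_lt (lt_of_le_of_ne (hdeg s hs) h)
  refine ⟨f, ?_, ?_⟩
  · apply le_antisymm
    · rw [hfs]
      apply Polynomial.natDegree_sum_le_of_forall_le
      intro s hs
      exact (Polynomial.natDegree_C_mul_le _ _).trans ((hmon s).1.trans (hdeg s hs))
    · apply Polynomial.le_natDegree_of_ne_zero
      rw [hc]; exact hv
  · intro t
    rw [hf, ← Polynomial.coe_evalRingHom, MvPolynomial.hom_eval₂, MvPolynomial.eval, MvPolynomial.coe_eval₂Hom]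
    congr 1
    · exact RingHom.ext (fun a => Polynomial.eval_C)
    · funext i
      change Polynomial.eval t (Polynomial.C (x i) + Polynomial.C (v i) * Polynomial.X) = x i + t * v i
      rw [Polynomial.eval_add, Polynomial.eval_C, Polynomial.eval_mul, Polynomial.eval_C,
        Polynomial.eval_X, mul_comm]

lemma exists_dir {p m : ℕ} [Fact p.Prime] (F : MvPolynomial (Fin m) (ZMod p)) (d : ℕ)
    (h2 : 2 ≤ F.totalDegree) (hd : F.totalDegree ≤ d) (hdp : d < p) :
    ∃ v : Fin m → ℕ, (∀ i, v i ≤ d) ∧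
      MvPolynomial.eval (fun i => (v i : ZMod p)) (MvPolynomial.homogeneousComponent F.totalDegree F) ≠ 0 := by
  classical
  by_contra hcon
  push Not at hcon
  have hz : MvPolynomial.homogeneousComponent F.totalDegree F = 0 := by
    apply MvPolynomial.eq_zero_of_eval_zero_at_prod_finset _
      (fun _ => (Finset.range (d + 1)).image (fun k : ℕ => (k : ZMod p)))
    · intro i
      rw [Finset.card_image_of_injOn, Finset.card_range]
      · have h1 := MvPolynomial.degreeOf_le_totalDegree (MvPolynomial.homogeneousComponent F.totalDegree F) i
        have h3 := (MvPolynomial.homogeneousComponent_isHomogeneous F.totalDegree F).totalDegree_le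
        omega
      · intro a ha b hb hab
        simp only [Finset.coe_range, Set.mem_Iio] at ha hb
        have := congrArg ZMod.val hab
        rwa [ZMod.val_natCast_of_lt (by omega), ZMod.val_natCast_of_lt (by omega)] at this
    · intro x hx
      choose v hv1 hv2 using fun i => Finset.mem_image.mp (hx i)
      have := hcon v (fun i => by have := Finset.mem_range.mp (hv1 i); omega)
      have e : (fun i => (v i : ZMod p)) = x := funext hv2
      rwa [e] at this
  have hne : F.support.Nonempty := by
    rw [Finset.nonempty_iff_ne_empty]
    intro h
    rw [MvPolynomial.support_eq_empty] at h
    simp [h] at h2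
  obtain ⟨s, hs, hs'⟩ := Finset.exists_mem_eq_sup F.support hne (fun s : Fin m →₀ ℕ => s.sum fun _ e => e)
  have h3 := MvPolynomial.coeff_homogeneousComponent F.totalDegree F s
  rw [if_pos (show s.degree = F.totalDegree from hs'.symm), hz] at h3
  simp at h3
  exact (MvPolynomial.mem_support_iff.mp hs) h3.symm

lemma multi_sum {p m : ℕ} [Fact p.Prime] (F : MvPolynomial (Fin m) (ZMod p)) (d : ℕ)
    (h2 : 2 ≤ F.totalDegree) (hd : F.totalDegree ≤ d) (hdp : d < p) :
    ∃ v : Fin m → ℕ, (∀ i, v i ≤ d) ∧ ∀ h : (Fin m → ZMod p) → ℂ,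
      ‖∑ x, h x * ZMod.stdAddChar (MvPolynomial.eval x F)‖ ≤
        d * Real.sqrt p * ((p : ℝ)⁻¹ * ∑ x, ‖h x‖ +
          2 * Real.log p * ∑ x, ‖h (fun i => x i + (v i : ZMod p)) - h x‖) := by
  obtain ⟨v, hvd, hv⟩ := exists_dir F d h2 hd hdp
  refine ⟨v, hvd, ?_⟩
  intro h
  have hp : (0:ℝ) < p := by exact_mod_cast (by omega : 0 < p)
  have hpC : (p : ℂ) ≠ 0 := by exact_mod_cast (by omega : p ≠ 0)
  have hlog : 0 ≤ Real.log p := Real.log_natCast_nonneg p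
  set w : Fin m → ZMod p := fun i => (v i : ZMod p) with hw
  have hshift : ∀ {E : Type} [AddCommMonoid E] (g : (Fin m → ZMod p) → E) (t : ZMod p),
      ∑ x, g (x + t • w) = ∑ x, g x := by
    intro E _ g t
    exact Equiv.sum_comp (Equiv.addRight (t • w)) g
  have hav : ∀ {E : Type} [AddCommMonoid E] (g : (Fin m → ZMod p) → E),
      ∑ x, ∑ t : ZMod p, g (x + t • w) = p • ∑ x, g x := by
    intro E _ g
    rw [Finset.sum_comm]
    rw [Finset.sum_congr rfl (fun t _ => hshift g t), Finset.sum_const, Finset.card_univ, ZMod.card]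
  have e1 := hav (fun x => h x * ZMod.stdAddChar (MvPolynomial.eval x F))
  rw [nsmul_eq_mul] at e1
  have e2 : (p:ℝ) * ‖∑ x, h x * ZMod.stdAddChar (MvPolynomial.eval x F)‖ =
      ‖∑ x, ∑ t : ZMod p, h (x + t • w) * ZMod.stdAddChar (MvPolynomial.eval (x + t • w) F)‖ := by
    rw [e1, norm_mul, Complex.norm_natCast]
  have hb : ∀ x, ‖∑ t : ZMod p, h (x + t • w) * ZMod.stdAddChar (MvPolynomial.eval (x + t • w) F)‖ ≤
      d * Real.sqrt p * ((p : ℝ)⁻¹ * ∑ t : ZMod p, ‖h (x + t • w)‖ +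
          2 * Real.log p * ∑ t : ZMod p, ‖h (x + t • w + w) - h (x + t • w)‖) := by
    intro x
    obtain ⟨f, hfd, hfe⟩ := line_poly F x w hv
    have := exp_sum_poly (fun t => h (x + t • w)) f (by omega) (by omega)
    have e3 : ∀ t, MvPolynomial.eval (x + t • w) F = f.eval t := fun t => (hfe t).symm
    simp_rw [e3]
    refine this.trans ?_
    have e4 : ∀ t : ZMod p, x + (t + 1) • w = x + t • w + w := by
      intro t; rw [add_smul, one_smul, add_assoc]
    simp only [e4]
    have hfd' : (f.natDegree : ℝ) ≤ d := by exact_mod_cast (by omega : f.natDegree ≤ d)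
    gcongr
    exact norm_sum_le _ _
  have h5 := norm_sum_le_of_le Finset.univ (fun x _ => hb x)
  rw [← e2, ← Finset.mul_sum, Finset.sum_add_distrib, ← Finset.mul_sum, ← Finset.mul_sum,
    hav (fun x => ‖h x‖), hav (fun x => ‖h (x + w) - h x‖), nsmul_eq_mul, nsmul_eq_mul] at h5
  refine le_of_mul_le_mul_left ?_ hp
  refine h5.trans (le_of_eq ?_)
  have : ∀ x, (fun i => x i + (v i : ZMod p)) = x + w := fun x => rfl
  simp only [this]
  ring

end LE

section LF

lemma shell_mem {m : ℕ} (Ω : Set (Torus m)) (ε : ℝ) (u w : Torus m) (hu : u ∈ Ω) (hw : w ∉ Ω)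
    (h : torusDist u w < ε) : u ∈ innerShell Ω ε := by
  refine ⟨hu, ?_⟩
  refine lt_of_le_of_lt ?_ h
  unfold torusDistSet
  refine ciInf_le (f := fun w : (Ωᶜ : Set (Torus m)) => torusDist u (w : Torus m)) ⟨0, ?_⟩ ⟨w, hw⟩
  rintro _ ⟨z, rfl⟩
  exact Real.sqrt_nonneg _

/-- arc cell -/
def qcell (p : ℕ) (a : ZMod p) : Set (AddCircle (1 : ℝ)) :=
  (fun r : ℝ => (r : AddCircle (1 : ℝ))) '' Set.Ico ((a.val : ℝ) / p) (((a.val : ℝ) + 1) / p)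

def Qcell (p : ℕ) {m : ℕ} (x : Fin m → ZMod p) : Set (Torus m) :=
  Set.univ.pi (fun i => qcell p (x i))

lemma qcell_sub {p : ℕ} (hp : 2 ≤ p) (a : ZMod p) :
    Set.Ico ((a.val : ℝ) / p) (((a.val : ℝ) + 1) / p) ⊆ Set.Ico (0 : ℝ) (0 + 1) := by
  haveI : NeZero p := ⟨by omega⟩
  have hp0 : (0:ℝ) < p := by exact_mod_cast (by omega : 0 < p)
  have hlt : ((a.val : ℝ) + 1) ≤ p := by exact_mod_cast ZMod.val_lt a
  intro y hy
  refine ⟨le_trans (by positivity) hy.1, lt_of_lt_of_le hy.2 ?_⟩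
  rw [zero_add, div_le_one hp0]; exact hlt

lemma coe_inj01 {y z : ℝ} (hy : y ∈ Set.Ico (0 : ℝ) (0 + 1)) (hz : z ∈ Set.Ico (0 : ℝ) (0 + 1))
    (h : (y : AddCircle (1 : ℝ)) = z) : y = z := by
  haveI : Fact ((0 : ℝ) < 1) := ⟨one_pos⟩
  exact (AddCircle.coe_eq_coe_iff_of_mem_Ico hy hz).mp h

lemma qcell_meas {p : ℕ} (hp : 2 ≤ p) (a : ZMod p) : MeasurableSet (qcell p a) := by
  refine MeasurableSet.image_of_continuousOn_injOn measurableSet_Ico ?_ ?_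
  · exact (AddCircle.continuous_mk' (1:ℝ)).continuousOn
  · intro y hy z hz h
    exact coe_inj01 (qcell_sub hp a hy) (qcell_sub hp a hz) h

lemma qcell_cover {p : ℕ} (hp : 2 ≤ p) (u : AddCircle (1 : ℝ)) : ∃ a : ZMod p, u ∈ qcell p a := by
  haveI : Fact ((0 : ℝ) < 1) := ⟨one_pos⟩
  have hp0 : (0:ℝ) < p := by exact_mod_cast (by omega : 0 < p)
  have hu : u ∈ (fun r : ℝ => (r : AddCircle (1 : ℝ))) '' Set.Ico (0 : ℝ) (0 + 1) := by
    have := AddCircle.coe_image_Ico_eq (1 : ℝ) 0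
    rw [this]; trivial
  obtain ⟨y, hy, rfl⟩ := hu
  rw [zero_add] at hy
  have h1 : ⌊y * p⌋₊ < p := by
    rw [Nat.floor_lt (by have := hy.1; positivity)]
    nlinarith [hy.2]
  refine ⟨(⌊y * p⌋₊ : ZMod p), y, ?_, rfl⟩
  rw [ZMod.val_natCast_of_lt h1]
  constructor
  · rw [div_le_iff₀ hp0]
    exact Nat.floor_le (by have := hy.1; positivity)
  · rw [lt_div_iff₀ hp0]
    exact Nat.lt_floor_add_one _

lemma qcell_unique {p : ℕ} (hp : 2 ≤ p) (a b : ZMod p) (u : AddCircle (1 : ℝ)) (ha : u ∈ qcell p a)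
    (hb : u ∈ qcell p b) : a = b := by
  haveI : NeZero p := ⟨by omega⟩
  have hp0 : (0:ℝ) < p := by exact_mod_cast (by omega : 0 < p)
  obtain ⟨y, hy, rfl⟩ := ha
  obtain ⟨z, hz, h⟩ := hb
  have e := coe_inj01 (qcell_sub hp b hz) (qcell_sub hp a hy) h
  subst e
  rw [Set.mem_Ico, div_le_iff₀ hp0, lt_div_iff₀ hp0] at hy hz
  apply ZMod.val_injective p
  have h1 : (a.val : ℝ) < (b.val : ℝ) + 1 := by linarith
  have h2 : (b.val : ℝ) < (a.val : ℝ) + 1 := by linarith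
  have h1' : a.val < b.val + 1 := by
    rw [← Nat.cast_succ] at h1; exact Nat.cast_lt.mp h1
  have h2' : b.val < a.val + 1 := by
    rw [← Nat.cast_succ] at h2; exact Nat.cast_lt.mp h2
  omega

lemma qcell_vol {p : ℕ} (hp : 2 ≤ p) (a : ZMod p) :
    volume (qcell p a) = ENNReal.ofReal ((p : ℝ)⁻¹) := by
  haveI : Fact ((0 : ℝ) < 1) := ⟨one_pos⟩
  have hp0 : (0:ℝ) < p := by exact_mod_cast (by omega : 0 < p)
  have hp2 : (2:ℝ) ≤ p := by exact_mod_cast hp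
  set b : ℝ := ((a.val : ℝ) + 1) / p with hb
  have hab : (a.val : ℝ) / p = b - (p : ℝ)⁻¹ := by rw [hb]; field_simp; ring
  have hpinv : (p:ℝ)⁻¹ < 1 := by
    apply inv_lt_one_of_one_lt₀; linarith
  have hmp := AddCircle.measurePreserving_mk (1 : ℝ) (b - 1)
  rw [← hmp.measure_preimage (qcell_meas hp a).nullMeasurableSet]
  rw [Measure.restrict_apply (hmp.measurable (qcell_meas hp a))]
  have e : ((fun r : ℝ => (r : AddCircle (1 : ℝ))) ⁻¹' qcell p a) ∩ Set.Ioc (b - 1) (b - 1 + 1) =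
      Set.Ico (b - (p:ℝ)⁻¹) b := by
    ext y
    constructor
    · rintro ⟨⟨z, hz, h⟩, hy⟩
      rw [hab, ← hb] at hz
      have h' : (z : AddCircle (1:ℝ)) = y := h
      have h0 : ((y - z : ℝ) : AddCircle (1:ℝ)) = 0 := by rw [AddCircle.coe_sub, h', sub_self]
      rw [AddCircle.coe_eq_zero_iff] at h0
      obtain ⟨k, hk⟩ := h0
      simp only [zsmul_eq_mul, mul_one] at hk
      have h1 : (k : ℝ) < 1 := by linarith [hz.1, hz.2, hy.1, hy.2]
      have h2 : (-1 : ℝ) < k := by linarith [hz.1, hz.2, hy.1, hy.2]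
      have h1' : k < 1 := by exact_mod_cast h1
      have h2' : -1 < k := by exact_mod_cast h2
      have : k = 0 := by omega
      rw [this] at hk
      have : y = z := by push_cast at hk; linarith
      rw [this]; exact hz
    · intro hy
      refine ⟨⟨y, by rw [hab]; exact hy, rfl⟩, ?_⟩
      constructor
      · linarith [hy.1]
      · linarith [hy.2]
  have e' := congrArg volume e
  refine e'.trans ?_
  rw [Real.volume_Ico]
  congr 1
  ring

lemma Qcell_meas {p m : ℕ} (hp : 2 ≤ p) (x : Fin m → ZMod p) : MeasurableSet (Qcell p x) :=
  MeasurableSet.univ_pi (fun i => qcell_meas hp (x i))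

lemma Qcell_vol {p m : ℕ} (hp : 2 ≤ p) (x : Fin m → ZMod p) :
    volume (Qcell p x) = ENNReal.ofReal (((p : ℝ) ^ m)⁻¹) := by
  unfold Qcell
  rw [volume_pi_pi]
  simp only [qcell_vol hp]
  rw [Finset.prod_const, Finset.card_univ, Fintype.card_fin, ← ENNReal.ofReal_pow (by positivity), inv_pow]

lemma Qcell_disj {p m : ℕ} (hp : 2 ≤ p) (x y : Fin m → ZMod p) (h : x ≠ y) :
    Disjoint (Qcell p x) (Qcell p y) := by
  rw [Set.disjoint_left]
  intro u hx hy
  apply h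
  funext i
  exact qcell_unique hp _ _ (u i) (hx i trivial) (hy i trivial)

lemma cells_le {p m : ℕ} (hp : 2 ≤ p) (S : Finset (Fin m → ZMod p)) (A : Set (Torus m))
    (h : ∀ x ∈ S, Qcell p x ⊆ A) : (S.card : ℝ) * ((p : ℝ) ^ m)⁻¹ ≤ tmeas A := by
  have h1 : volume (⋃ x ∈ S, Qcell p x) = ∑ x ∈ S, volume (Qcell p x) :=
    measure_biUnion_finset (fun x _ y _ hxy => Qcell_disj hp x y hxy) (fun x _ => Qcell_meas hp x)
  simp only [Qcell_vol hp, Finset.sum_const] at h1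
  have h2 : volume (⋃ x ∈ S, Qcell p x) ≤ volume A := measure_mono (Set.iUnion₂_subset h)
  rw [h1] at h2
  have h3 := ENNReal.toReal_mono (measure_ne_top _ _) h2
  rw [nsmul_eq_mul, ENNReal.toReal_mul, ENNReal.toReal_ofReal (by positivity)] at h3
  simpa [tmeas] using h3

lemma le_cells {p m : ℕ} (hp : 2 ≤ p) (S : Finset (Fin m → ZMod p)) (A B : Set (Torus m))
    (h : A ⊆ (⋃ x ∈ S, Qcell p x) ∪ B) : tmeas A ≤ (S.card : ℝ) * ((p : ℝ) ^ m)⁻¹ + tmeas B := by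
  have h1 : volume (⋃ x ∈ S, Qcell p x) ≤ ∑ x ∈ S, volume (Qcell p x) := measure_biUnion_finset_le _ _
  simp only [Qcell_vol hp, Finset.sum_const, nsmul_eq_mul] at h1
  have h2 : volume A ≤ S.card * ENNReal.ofReal (((p : ℝ) ^ m)⁻¹) + volume B :=
    (measure_mono h).trans ((measure_union_le _ _).trans (add_le_add_left h1 _))
  have h4 : (S.card * ENNReal.ofReal (((p : ℝ) ^ m)⁻¹) : ENNReal) ≠ ⊤ :=
    ENNReal.mul_ne_top (by simp) ENNReal.ofReal_ne_top
  have h3 := ENNReal.toReal_mono (ENNReal.add_ne_top.mpr ⟨h4, measure_ne_top _ _⟩) h2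
  rw [ENNReal.toReal_add h4 (measure_ne_top _ _), ENNReal.toReal_mul,
    ENNReal.toReal_ofReal (by positivity)] at h3
  simpa [tmeas] using h3

lemma cell_dist {p m d : ℕ} (hp : 2 ≤ p) (hm : 0 < m) (x : Fin m → ZMod p) (v : Fin m → ℕ) (hv : ∀ i, v i ≤ d)
    (u w : Torus m) (hu : u ∈ Qcell p x) (hw : w ∈ Qcell p (fun i => x i + (v i : ZMod p))) :
    torusDist u w < m * (d + 2) / p ∧ torusDist w u < m * (d + 2) / p := by
  haveI : NeZero p := ⟨by omega⟩
  have hp0 : (0:ℝ) < p := by exact_mod_cast (by omega : 0 < p)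
  have hm1 : (1:ℝ) ≤ m := by exact_mod_cast hm
  have hd : ∀ i, dist (u i) (w i) ≤ (d + 1) / p := by
    intro i
    obtain ⟨y, hy, hyu⟩ := hu i trivial
    obtain ⟨z, hz, hzw⟩ := hw i trivial
    rw [← hyu, ← hzw]
    obtain ⟨k, hk⟩ : ∃ k : ℕ, (x i).val + v i = (x i + (v i : ZMod p)).val + p * k := by
      have h1 : ((x i + (v i : ZMod p)).val) = ((x i).val + v i) % p := by
        rw [← ZMod.val_natCast]
        congr 1
        push_cast
        rw [ZMod.natCast_zmod_val]
      refine ⟨((x i).val + v i) / p, ?_⟩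
      rw [h1, Nat.mod_add_div]
    have hk' : ((x i).val : ℝ) + v i = (x i + (v i : ZMod p)).val + p * k := by
      have := congrArg (fun n : ℕ => (n : ℝ)) hk
      simpa only [Nat.cast_add, Nat.cast_mul] using this
    set A : ℝ := ((x i).val : ℝ) with hA
    set B : ℝ := ((x i + (v i : ZMod p)).val : ℝ) with hB
    have hz' : ((z : ℝ) : AddCircle (1:ℝ)) = ((z + k : ℝ) : AddCircle (1:ℝ)) := by
      have h0 : ((k : ℝ) : AddCircle (1:ℝ)) = 0 := by
        rw [AddCircle.coe_eq_zero_iff]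
        exact ⟨(k : ℤ), by simp⟩
      rw [AddCircle.coe_add, h0, add_zero]
    simp only
    rw [hz', dist_eq_norm, ← AddCircle.coe_sub]
    have hn : ‖((y - (z + k) : ℝ) : AddCircle (1:ℝ))‖ ≤ |y - (z + k)| := by
      rw [← Real.norm_eq_abs]
      exact QuotientAddGroup.norm_mk_le_norm
    refine hn.trans ?_
    have hvi : (v i : ℝ) ≤ d := by exact_mod_cast hv i
    have hvi0 : (0 : ℝ) ≤ v i := by positivity
    have hyB := hy
    rw [Set.mem_Ico, div_le_iff₀ hp0, lt_div_iff₀ hp0] at hy hz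
    rw [le_div_iff₀ hp0]
    have : |y - (z + k)| * p = |(y - (z + k)) * p| := by rw [abs_mul, abs_of_pos hp0]
    rw [this, abs_le]
    constructor <;> nlinarith [hy.1, hy.2, hz.1, hz.2]
  have hsum : Real.sqrt (∑ i, dist (u i) (w i) ^ 2) < m * (d + 2) / p := by
    rw [Real.sqrt_lt' (by positivity)]
    calc ∑ i, dist (u i) (w i) ^ 2 ≤ ∑ i : Fin m, (((d : ℝ) + 1) / p) ^ 2 := by
          apply Finset.sum_le_sum
          intro i _
          exact pow_le_pow_left₀ dist_nonneg (hd i) 2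
      _ = m * (((d : ℝ) + 1) / p) ^ 2 := by simp
      _ ≤ (m * (((d : ℝ) + 1) / p)) ^ 2 := by
          rw [mul_pow]
          apply mul_le_mul_of_nonneg_right _ (by positivity)
          nlinarith
      _ < (m * (d + 2) / p) ^ 2 := by
          apply pow_lt_pow_left₀ _ (by positivity) (by norm_num)
          rw [mul_div_assoc]
          apply mul_lt_mul_of_pos_left _ (by linarith)
          apply div_lt_div_of_pos_right _ hp0
          linarith
  refine ⟨hsum, ?_⟩
  unfold torusDist
  simp_rw [dist_comm (w _) (u _)]
  exact hsum

open Classical in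
lemma geom {p m d : ℕ} (hp : 2 ≤ p) [NeZero p] (hm : 0 < m) (Ω : Set (Torus m)) (b : ℝ)
    (hb : tmeas (innerShell Ω (m * (d + 2) / p)) ≤ b) :
    ∃ U : Finset (Fin m → ZMod p),
      (∀ x ∈ U, (fun i => ((((x i).val : ℝ) / p : ℝ) : AddCircle (1 : ℝ))) ∈ Ω) ∧
      (U.card : ℝ) * ((p : ℝ) ^ m)⁻¹ ≤ tmeas Ω ∧
      tmeas Ω ≤ (U.card : ℝ) * ((p : ℝ) ^ m)⁻¹ + b ∧
      ∀ v : Fin m → ℕ, (∀ i, v i ≤ d) →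
        ∑ x : Fin m → ZMod p, ‖((if (fun i => x i + (v i : ZMod p)) ∈ U then 1 else 0) : ℂ) - (if x ∈ U then 1 else 0)‖
          ≤ 2 * b * (p : ℝ) ^ m := by
  have hp0 : (0:ℝ) < p := by exact_mod_cast (by omega : 0 < p)
  set ε : ℝ := m * (d + 2) / p with hε
  set U : Finset (Fin m → ZMod p) := Finset.univ.filter (fun x => Qcell p x ⊆ Ω) with hU
  have hmU : ∀ x, x ∈ U ↔ Qcell p x ⊆ Ω := by intro x; simp [hU]
  refine ⟨U, ?_, ?_, ?_, ?_⟩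
  · intro x hx
    apply (hmU x).mp hx
    intro i _
    refine ⟨_, ⟨le_rfl, ?_⟩, rfl⟩
    apply div_lt_div_of_pos_right _ hp0
    linarith
  · exact cells_le hp U Ω (fun x hx => (hmU x).mp hx)
  · refine (le_cells hp U Ω (innerShell Ω ε) ?_).trans (by linarith)
    intro u hu
    choose x hx using fun i => qcell_cover hp (u i)
    have hux : u ∈ Qcell p x := fun i _ => hx i
    by_cases hxU : x ∈ U
    · left
      exact Set.mem_biUnion hxU hux
    · right
      rw [hmU, Set.not_subset] at hxU
      obtain ⟨w, hw, hwn⟩ := hxU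
      refine shell_mem Ω ε u w hu hwn ?_
      exact (cell_dist (d := d) hp hm x (fun _ => 0) (fun _ => Nat.zero_le _) u w hux (by simpa using hw)).1
  · intro v hv
    set sh : (Fin m → ZMod p) → (Fin m → ZMod p) := fun x i => x i + (v i : ZMod p) with hsh
    have hshinj : Function.Injective sh := by
      intro x y h
      funext i
      have := congrFun h i
      simpa [hsh] using this
    set S1 := Finset.univ.filter (fun x => x ∈ U ∧ sh x ∉ U) with hS1
    set S2 := Finset.univ.filter (fun x => sh x ∈ U ∧ x ∉ U) with hS2
    have h1 : (S1.card : ℝ) * ((p : ℝ) ^ m)⁻¹ ≤ b := by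
      refine (cells_le hp S1 (innerShell Ω ε) ?_).trans hb
      intro x hx u hu
      obtain ⟨-, hxU, hsU⟩ := Finset.mem_filter.mp hx
      rw [hmU] at hxU
      rw [hmU, Set.not_subset] at hsU
      obtain ⟨w, hw, hwn⟩ := hsU
      exact shell_mem Ω ε u w (hxU hu) hwn (cell_dist hp hm x v hv u w hu hw).1
    have h2 : (S2.card : ℝ) * ((p : ℝ) ^ m)⁻¹ ≤ b := by
      rw [← Finset.card_image_of_injective S2 hshinj]
      refine (cells_le hp (S2.image sh) (innerShell Ω ε) ?_).trans hb
      intro y hy u hu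
      obtain ⟨x, hx, rfl⟩ := Finset.mem_image.mp hy
      obtain ⟨-, hsU, hxU⟩ := Finset.mem_filter.mp hx
      rw [hmU] at hsU
      rw [hmU, Set.not_subset] at hxU
      obtain ⟨w, hw, hwn⟩ := hxU
      exact shell_mem Ω ε u w (hsU hu) hwn (cell_dist hp hm x v hv w u hw hu).2
    have h3 : ∀ x, ‖((if sh x ∈ U then 1 else 0) : ℂ) - (if x ∈ U then 1 else 0)‖ =
        (if x ∈ U ∧ sh x ∉ U then 1 else 0) + (if sh x ∈ U ∧ x ∉ U then (1:ℝ) else 0) := by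
      intro x
      by_cases a : x ∈ U <;> by_cases c : sh x ∈ U <;> simp [a, c]
    rw [Finset.sum_congr rfl (fun x _ => h3 x), Finset.sum_add_distrib, Finset.sum_boole, Finset.sum_boole]
    rw [mul_inv_le_iff₀ (by positivity)] at h1 h2
    linarith

end LF

section LG

lemma cInd_nonneg (p : ℕ) (α β : ℝ) (y : ZMod p) : 0 ≤ cInd p α β y := by
  unfold cInd; split_ifs <;> norm_num

lemma cInd_le_one (p : ℕ) (α β : ℝ) (y : ZMod p) : cInd p α β y ≤ 1 := by
  unfold cInd; split_ifs <;> norm_num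

lemma prod_diff {ι : Type*} (s : Finset ι) (t c : ι → ℝ) (e : ℝ) (he : 0 ≤ e)
    (ht0 : ∀ i, 0 ≤ t i) (ht1 : ∀ i, t i ≤ 1) (hc0 : ∀ i, 0 ≤ c i) (hc1 : ∀ i, c i ≤ 1)
    (h : ∀ i, t i - e ≤ c i) : ∏ i ∈ s, t i - s.card * e ≤ ∏ i ∈ s, c i := by
  classical
  induction s using Finset.induction_on with
  | empty => simp
  | insert a s ha ih =>
    rw [Finset.prod_insert ha, Finset.prod_insert ha, Finset.card_insert_of_notMem ha]
    have hT0 : 0 ≤ ∏ i ∈ s, t i := Finset.prod_nonneg fun i _ => ht0 i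
    have hT1 : ∏ i ∈ s, t i ≤ 1 := Finset.prod_le_one (fun i _ => ht0 i) fun i _ => ht1 i
    set T := ∏ i ∈ s, t i
    set D := ∏ i ∈ s, c i
    push_cast
    have hk : (0:ℝ) ≤ s.card * e := by positivity
    have h1 : (t a - c a) * T ≤ e := by
      have : (t a - c a) * T ≤ e * T := mul_le_mul_of_nonneg_right (by linarith [h a]) hT0
      nlinarith
    have h2 : c a * (T - D) ≤ s.card * e := by
      have : c a * (T - D) ≤ c a * (s.card * e) := mul_le_mul_of_nonneg_left (by linarith) (hc0 a)
      nlinarith [hc1 a]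
    nlinarith

lemma std_sum {p : ℕ} [NeZero p] {ι : Type*} (s : Finset ι) (f : ι → ZMod p) :
    (ZMod.stdAddChar (∑ i ∈ s, f i) : ℂ) = ∏ i ∈ s, ZMod.stdAddChar (f i) := by
  classical
  induction s using Finset.induction_on with
  | empty => simp
  | insert a s ha ih =>
    rw [Finset.sum_insert ha, Finset.prod_insert ha, AddChar.map_add_eq_mul, ih]

lemma char_sum_eq {p m n : ℕ} [Fact p.Prime] (G : Fin n → MvPolynomial (Fin m) (ZMod p))
    (c : Fin n → ZMod p → ℂ) (x : Fin m → ZMod p) :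
    ∏ j, c j (MvPolynomial.eval x (G j)) =
      ∑ a : Fin n → ZMod p, (∏ j, hhat (c j) (a j)) *
        ZMod.stdAddChar (MvPolynomial.eval x (∑ j, a j • G j)) := by
  have h1 : ∏ j, c j (MvPolynomial.eval x (G j)) =
      ∏ j, ∑ a, hhat (c j) a * ZMod.stdAddChar (a * MvPolynomial.eval x (G j)) :=
    Finset.prod_congr rfl fun j _ => hhat_inv _ _
  rw [h1, Finset.prod_univ_sum, Fintype.piFinset_univ]
  refine Finset.sum_congr rfl fun a _ => ?_
  rw [Finset.prod_mul_distrib]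
  congr 1
  simp only [map_sum, MvPolynomial.smul_eval]
  exact (std_sum _ _).symm

open Classical in
lemma count_lower {p m n d : ℕ} [Fact p.Prime] (hdp : d < p)
    (G : Fin n → MvPolynomial (Fin m) (ZMod p)) (hd : ∀ j, (G j).totalDegree ≤ d)
    (hind : Degree2Independent G) (U : Finset (Fin m → ZMod p)) (b : ℝ)
    (hU : ∀ v : Fin m → ℕ, (∀ i, v i ≤ d) →
        ∑ x : Fin m → ZMod p, ‖((if (fun i => x i + (v i : ZMod p)) ∈ U then 1 else 0) : ℂ) -
          (if x ∈ U then 1 else 0)‖ ≤ 2 * b * (p : ℝ) ^ m)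
    (α β : Fin n → ℝ) (hab : ∀ j, 0 ≤ α j ∧ α j ≤ β j ∧ β j ≤ 1) :
    (∏ j, (β j - α j) - n * (p : ℝ)⁻¹) * U.card -
      (8 * Real.log p) ^ n * (d * Real.sqrt p * ((p : ℝ)⁻¹ * U.card +
        2 * Real.log p * (2 * b * (p : ℝ) ^ m))) ≤
      ∑ x ∈ U, ∏ j, cInd p (α j) (β j) (MvPolynomial.eval x (G j)) := by
  have hp2 : 2 ≤ p := (Fact.out : p.Prime).two_le
  have hp : (0:ℝ) < p := by exact_mod_cast (by omega : 0 < p)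
  have hlog : 0 ≤ Real.log p := Real.log_natCast_nonneg p
  set h : (Fin m → ZMod p) → ℂ := fun x => if x ∈ U then 1 else 0 with hh
  set c : Fin n → ZMod p → ℂ := fun j y => (cInd p (α j) (β j) y : ℂ) with hc
  set B : ℝ := d * Real.sqrt p * ((p : ℝ)⁻¹ * U.card +
        2 * Real.log p * (2 * b * (p : ℝ) ^ m)) with hB
  have hsumh : ∑ x, ‖h x‖ = U.card := by
    have : ∀ x, ‖h x‖ = if x ∈ U then 1 else 0 := by
      intro x; simp only [hh]; split_ifs <;> simp
    simp only [this]; simp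
  have hsumh' : ∑ x, h x = U.card := by simp [hh]
  have key : (((∑ x ∈ U, ∏ j, cInd p (α j) (β j) (MvPolynomial.eval x (G j)) : ℝ)) : ℂ) =
      ∑ a : Fin n → ZMod p, (∏ j, hhat (c j) (a j)) *
        ∑ x, h x * ZMod.stdAddChar (MvPolynomial.eval x (∑ j, a j • G j)) := by
    push_cast
    have e1 : ∀ x, (∏ j, (cInd p (α j) (β j) (MvPolynomial.eval x (G j)) : ℂ)) = _ :=
      fun x => char_sum_eq G c x
    rw [Finset.sum_congr rfl fun x _ => e1 x, Finset.sum_comm]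
    refine Finset.sum_congr rfl fun a _ => ?_
    rw [← Finset.mul_sum]
    congr 1
    simp [hh]
  rw [← Finset.add_sum_erase _ _ (Finset.mem_univ (0 : Fin n → ZMod p))] at key
  set R := ∑ a ∈ Finset.univ.erase (0 : Fin n → ZMod p), (∏ j, hhat (c j) (a j)) *
        ∑ x, h x * ZMod.stdAddChar (MvPolynomial.eval x (∑ j, a j • G j)) with hR
  have hz : (∏ j, hhat (c j) ((0 : Fin n → ZMod p) j)) *
        ∑ x, h x * ZMod.stdAddChar (MvPolynomial.eval x (∑ j, (0 : Fin n → ZMod p) j • G j)) =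
      (((∏ j, ((p:ℝ)⁻¹ * ∑ y, cInd p (α j) (β j) y)) * U.card : ℝ) : ℂ) := by
    simp only [Pi.zero_apply, zero_smul, Finset.sum_const_zero, map_zero, AddChar.map_zero_eq_one,
      mul_one, hhat_zero, hsumh']
    push_cast
    rfl
  have hBnn : ∀ a : Fin n → ZMod p, a ≠ 0 →
      ‖∑ x, h x * ZMod.stdAddChar (MvPolynomial.eval x (∑ j, a j • G j))‖ ≤ B := by
    intro a ha
    have ht : (∑ j, a j • G j).totalDegree ≤ d := by
      refine MvPolynomial.totalDegree_finsetSum_le fun j _ => ?_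
      exact (MvPolynomial.totalDegree_smul_le _ _).trans (hd j)
    obtain ⟨v, hv, H⟩ := multi_sum _ d (hind a ha) ht hdp
    refine (H h).trans ?_
    rw [hsumh, hB]
    have := hU v hv
    gcongr
  have hRB : ‖R‖ ≤ (8 * Real.log p) ^ n * B := by
    have hB0 : n = 0 ∨ 0 ≤ B := by
      rcases Nat.eq_zero_or_pos n with h0 | h0
      · exact Or.inl h0
      · right
        have := hBnn (fun _ => 1) (by
          intro h'; have := congrFun h' ⟨0, h0⟩; simp at this)
        exact (norm_nonneg _).trans this
    rcases hB0 with h0 | hB0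
    · subst h0
      have hb0 : 0 ≤ 2 * b * (p:ℝ)^m := le_trans (Finset.sum_nonneg fun _ _ => norm_nonneg _) (hU (fun _ => 0) (fun _ => Nat.zero_le _))
      have : R = 0 := by
        rw [hR]; apply Finset.sum_eq_zero
        intro a ha
        exact absurd (Subsingleton.elim a 0) (Finset.ne_of_mem_erase ha)
      rw [this, norm_zero, hB]; positivity
    calc ‖R‖ ≤ ∑ a ∈ Finset.univ.erase (0 : Fin n → ZMod p), (∏ j, ‖hhat (c j) (a j)‖) * B := by
          refine (norm_sum_le _ _).trans (Finset.sum_le_sum fun a ha => ?_)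
          rw [norm_mul, norm_prod]
          exact mul_le_mul_of_nonneg_left (hBnn a (Finset.ne_of_mem_erase ha))
            (Finset.prod_nonneg fun _ _ => norm_nonneg _)
      _ ≤ ∑ a : Fin n → ZMod p, (∏ j, ‖hhat (c j) (a j)‖) * B := by
          refine Finset.sum_le_sum_of_subset_of_nonneg (Finset.erase_subset _ _) fun a _ _ => ?_
          exact mul_nonneg (Finset.prod_nonneg fun _ _ => norm_nonneg _) hB0
      _ = (∏ j, ∑ a, ‖hhat (c j) a‖) * B := by
          rw [← Finset.sum_mul, Finset.prod_univ_sum, Fintype.piFinset_univ]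
      _ ≤ (8 * Real.log p) ^ n * B := by
          refine mul_le_mul_of_nonneg_right ?_ hB0
          calc _ ≤ ∏ j : Fin n, 8 * Real.log p := Finset.prod_le_prod
                (fun j _ => Finset.sum_nonneg fun _ _ => norm_nonneg _) fun j _ => cInd_l1 p _ _
            _ = _ := by simp
  have hprod : ∏ j, (β j - α j) - n * (p : ℝ)⁻¹ ≤
      ∏ j, ((p:ℝ)⁻¹ * ∑ y, cInd p (α j) (β j) y) := by
    have := prod_diff Finset.univ (fun j => β j - α j)
      (fun j => (p:ℝ)⁻¹ * ∑ y, cInd p (α j) (β j) y) (p:ℝ)⁻¹ (by positivity)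
      (fun j => by linarith [(hab j).2.1]) (fun j => by linarith [(hab j).1, (hab j).2.2])
      (fun j => mul_nonneg (by positivity) (Finset.sum_nonneg fun y _ => cInd_nonneg _ _ _ _))
      (fun j => by
        have : ∑ y, cInd p (α j) (β j) y ≤ ∑ y : ZMod p, (1:ℝ) :=
          Finset.sum_le_sum fun y _ => cInd_le_one _ _ _ _
        simp only [Finset.sum_const, Finset.card_univ, ZMod.card, nsmul_eq_mul, mul_one] at this
        rw [inv_mul_le_iff₀ hp]; linarith)
      (fun j => by
        have := cInd_sum p (α j) (β j) (hab j).1 (hab j).2.1 (hab j).2.2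
        rw [le_inv_mul_iff₀ hp]
        have e : (p:ℝ) * (β j - α j - (p:ℝ)⁻¹) = (β j - α j) * p - 1 := by field_simp
        linarith)
    simpa using this
  rw [hz] at key
  set S := ∑ x ∈ U, ∏ j, cInd p (α j) (β j) (MvPolynomial.eval x (G j))
  set Z := (∏ j, ((p:ℝ)⁻¹ * ∑ y, cInd p (α j) (β j) y)) * U.card with hZ
  have hre := congrArg Complex.re key
  simp only [Complex.add_re, Complex.ofReal_re] at hre
  have h1 := (abs_le.mp (Complex.abs_re_le_norm R)).1
  have h2 : (∏ j, (β j - α j) - n * (p : ℝ)⁻¹) * U.card ≤ Z :=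
    mul_le_mul_of_nonneg_right hprod (Nat.cast_nonneg _)
  linarith

open Classical in
lemma count_ncard {p m n : ℕ} [Fact p.Prime]
    (G : Fin n → MvPolynomial (Fin m) (ZMod p)) (Ω : Set (Torus m))
    (U : Finset (Fin m → ZMod p))
    (hU : ∀ x ∈ U, (fun i => ((((x i).val : ℝ) / p : ℝ) : AddCircle (1 : ℝ))) ∈ Ω)
    (α β : Fin n → ℝ) :
    ∑ x ∈ U, ∏ j, cInd p (α j) (β j) (MvPolynomial.eval x (G j)) ≤
      ({x : Fin m → Fin p | torusPt p x ∈ Ω ∧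
                    ∀ j, α j ≤ fracPt G (fun i => ((x i : ℕ) : ℤ)) j ∧
                      fracPt G (fun i => ((x i : ℕ) : ℤ)) j < β j}.ncard : ℝ) := by
  set P : (Fin m → ZMod p) → Prop := fun x => ∀ j, α j ≤ ((MvPolynomial.eval x (G j)).val : ℝ) / p ∧
    ((MvPolynomial.eval x (G j)).val : ℝ) / p < β j with hP
  have e : ∑ x ∈ U, ∏ j, cInd p (α j) (β j) (MvPolynomial.eval x (G j)) =
      ((U.filter P).card : ℝ) := by
    rw [Finset.card_filter]
    push_cast
    refine Finset.sum_congr rfl fun x _ => ?_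
    unfold cInd
    rw [Finset.prod_ite_zero]
    simp
  rw [e]
  refine Nat.cast_le.mpr ?_
  rw [← Set.ncard_coe_finset]
  refine Set.ncard_le_ncard_of_injOn
    (fun x i => (⟨(x i).val, ZMod.val_lt (x i)⟩ : Fin p)) ?_ ?_ (Set.toFinite _)
  · intro x hx
    rw [Finset.mem_coe, Finset.mem_filter] at hx
    refine ⟨hU x hx.1, fun j => ?_⟩
    have := hx.2 j
    have e2 : fracPt G (fun i => (((⟨(x i).val, ZMod.val_lt (x i)⟩ : Fin p) : ℕ) : ℤ)) j =
      ((MvPolynomial.eval x (G j)).val : ℝ) / p := by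
      unfold fracPt
      have : (fun i => (((((⟨(x i).val, ZMod.val_lt (x i)⟩ : Fin p) : ℕ) : ℤ)) : ZMod p)) = x := by
        funext i
        simp
      rw [this]
    rw [e2]; exact this
  · intro x _ y _ hxy
    funext i
    have := congrFun hxy i
    simp only [Fin.mk.injEq] at this
    exact ZMod.val_injective p this

lemma final_ineq (n : ℕ) (P L s M Q u t μ b K d S : ℝ) (hP : 1 ≤ P) (hL : 1 ≤ L) (hs : 1 ≤ s)
    (hM : 0 ≤ M) (hQ : 0 < Q) (hu : 0 ≤ u) (ht0 : 0 ≤ t) (ht1 : t ≤ 1) (hd : 0 ≤ d)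
    (hb0 : 0 ≤ b) (hK : 0 ≤ K) (hμM : μ ≤ M)
    (h1 : u ≤ μ * (P * Q)) (h2 : μ * (P * Q) ≤ u + b * (P * Q)) (h3 : b * (P * Q) ≤ K * (M * Q))
    (hS : (t - n * P⁻¹) * u - (8 * L) ^ n * (d * s * (P⁻¹ * u + 2 * L * (2 * (b * (P * Q))))) ≤ S) :
    t * μ * (P * Q) - (K + n + 8 ^ n * d * (1 + 4 * K)) * M * (s * Q) * L ^ (n + 2) ≤ S := by
  have hP0 : 0 < P := by linarith
  set W := M * Q with hW
  have hW0 : 0 ≤ W := by positivity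
  have hu' : P⁻¹ * u ≤ W := by
    rw [inv_mul_le_iff₀ hP0]
    calc u ≤ μ * (P * Q) := h1
      _ ≤ M * (P * Q) := by gcongr
      _ = P * W := by rw [hW]; ring
  have hL1 : 1 ≤ L ^ (n + 1) := one_le_pow₀ hL
  have hL2 : L ^ (n + 1) ≤ L ^ (n + 2) := pow_le_pow_right₀ hL (by omega)
  have e1 : t * μ * (P * Q) - K * W ≤ t * u := by
    have h4 : μ * (P * Q) - K * W ≤ u := by linarith
    have h5 := mul_le_mul_of_nonneg_left h4 ht0
    have h6 : t * (K * W) ≤ 1 * (K * W) := by gcongr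
    nlinarith
  have e2 : n * P⁻¹ * u ≤ n * W := by
    rw [mul_assoc]; gcongr
  have e3 : (8 * L) ^ n * (d * s * (P⁻¹ * u + 2 * L * (2 * (b * (P * Q))))) ≤
      8 ^ n * d * (1 + 4 * K) * (W * s * L ^ (n + 1)) := by
    calc _ ≤ (8 * L) ^ n * (d * s * (W * L + 2 * L * (2 * (K * W)))) := by
          have hu'' : P⁻¹ * u ≤ W * L := by nlinarith
          gcongr
      _ = _ := by rw [mul_pow]; ring
  have hX : W * s * L ^ (n + 1) ≤ W * s * L ^ (n + 2) := by gcongr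
  have hY : W ≤ W * s * L ^ (n + 2) := by
    have : 1 ≤ s * L ^ (n + 2) := one_le_mul_of_one_le_of_one_le hs (hL1.trans hL2)
    nlinarith
  have e4 : 8 ^ n * d * (1 + 4 * K) * (W * s * L ^ (n + 1)) ≤
      8 ^ n * d * (1 + 4 * K) * (W * s * L ^ (n + 2)) := by gcongr
  have e5 : K * W ≤ K * (W * s * L ^ (n + 2)) := by gcongr
  have e6 : n * W ≤ n * (W * s * L ^ (n + 2)) := by gcongr
  have e7 : (K + n + 8 ^ n * d * (1 + 4 * K)) * M * (s * Q) * L ^ (n + 2) =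
      K * (W * s * L ^ (n + 2)) + n * (W * s * L ^ (n + 2)) +
      8 ^ n * d * (1 + 4 * K) * (W * s * L ^ (n + 2)) := by rw [hW]; ring
  rw [e7]
  have e8 : (t - n * P⁻¹) * u = t * u - n * P⁻¹ * u := by ring
  rw [e8] at hS
  linarith

lemma b_ineq (k : ℕ) (C0 M ε P Q A : ℝ) (hC : 0 ≤ C0) (hA0 : 0 < A) (hpm : P ^ (k+1) = P * Q)
    (hA : ε * P = A) (hMQ : 1 ≤ M * Q) :
    C0 * (M * ε + ε ^ (k+1)) * (P * Q) ≤ C0 * (A + A ^ (k+1)) * (M * Q) := by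
  have e : C0 * (M * ε + ε ^ (k+1)) * (P * Q) = C0 * (M * Q * A + A ^ (k+1)) := by
    rw [← hA, mul_pow, hpm]; ring
  have h : A ^ (k+1) ≤ A ^ (k+1) * (M * Q) := le_mul_of_one_le_right (by positivity) hMQ
  calc _ = C0 * (M * Q * A + A ^ (k+1)) := e
    _ ≤ C0 * (M * Q * A + A ^ (k+1) * (M * Q)) := by gcongr
    _ = _ := by ring

lemma tmeas_le_one {m : ℕ} (Ω : Set (Torus m)) : tmeas Ω ≤ 1 := by
  unfold tmeas
  have : volume Ω ≤ 1 := by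
    refine (measure_mono (Set.subset_univ Ω)).trans ?_
    rw [volume_pi, Measure.pi_univ]
    simp
  exact ENNReal.toReal_le_of_le_ofReal zero_le_one (by simpa using this)

end LG


/-- Counting lower bound for very well shaped sets: if `μ(Ω) ≥ p^{−m/2} (log p)^{m(n+2)}`
then for every box `Π = ∏_j [α_j, β_j) ⊆ 𝕋_n`,
`N(Ω;Π) ≥ λ(Π) μ(Ω) p^m − c μ(Ω)^{(m−1)/m} p^{m−1/2} (log p)^{n+2}` with `c = c(m,n,d,C)`. -/
theorem counting_very_well_shaped (m n d : ℕ) (hm : 0 < m) (hn : 0 < n) (C : ℝ) :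
    ∃ c : ℝ, 0 < c ∧
      ∀ p : ℕ, p.Prime →
        ∀ G : Fin n → MvPolynomial (Fin m) (ZMod p),
          (∀ j, (G j).totalDegree ≤ d) →
          Degree2Independent G →
          ∀ Ω : Set (Torus m), IsVeryWellShaped Ω C →
            (p : ℝ) ^ (-(m : ℝ) / 2) * Real.log p ^ (m * (n + 2)) ≤ tmeas Ω →
            ∀ α β : Fin n → ℝ, (∀ j, 0 ≤ α j ∧ α j ≤ β j ∧ β j ≤ 1) →
              (∏ j, (β j - α j)) * tmeas Ω * (p : ℝ) ^ m
                  - c * tmeas Ω ^ (((m : ℝ) - 1) / (m : ℝ)) *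
                      (p : ℝ) ^ ((m : ℝ) - 1 / 2) * Real.log p ^ (n + 2)
                ≤ ({x : Fin m → Fin p | torusPt p x ∈ Ω ∧
                    ∀ j, α j ≤ fracPt G (fun i => ((x i : ℕ) : ℤ)) j ∧
                      fracPt G (fun i => ((x i : ℕ) : ℤ)) j < β j}.ncard : ℝ) := by
  classical
  have hl2 : 0 < Real.log 2 := Real.log_pos (by norm_num)
  set A : ℝ := m * (d + 2) with hA
  have hA0 : 0 < A := by positivity
  set C0 : ℝ := max C 0 with hC0
  have hC00 : 0 ≤ C0 := le_max_right _ _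
  set K : ℝ := C0 * (A + A ^ m) with hK
  have hK0 : 0 ≤ K := by positivity
  set c1 : ℝ := K + n + 8 ^ n * d * (1 + 4 * K) with hc1
  have hc10 : 0 ≤ c1 := by positivity
  set c2 : ℝ := Real.sqrt (d + 2) / Real.log 2 ^ (n + 2) with hc2
  have hc20 : 0 < c2 := by positivity
  refine ⟨c1 + c2, by positivity, ?_⟩
  intro p hp G hd hind Ω hΩ hμ α β hab
  haveI : Fact p.Prime := ⟨hp⟩
  have hp2 : 2 ≤ p := hp.two_le
  have hpR : (2:ℝ) ≤ p := by exact_mod_cast hp2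
  have hp0 : (0:ℝ) < p := by linarith
  have hlog2 : Real.log 2 ≤ Real.log p := Real.log_le_log (by norm_num) hpR
  have hL0 : 0 < Real.log p := by linarith
  set μ := tmeas Ω with hμd
  have hμ0 : 0 < μ := lt_of_lt_of_le (by positivity) hμ
  have hμ1 : μ ≤ 1 := tmeas_le_one Ω
  set M := μ ^ (((m : ℝ) - 1) / (m : ℝ)) with hM
  have hM0 : 0 < M := Real.rpow_pos_of_pos hμ0 _
  have hmR : (0:ℝ) < m := by exact_mod_cast hm
  have hm1 : (1:ℝ) ≤ m := by exact_mod_cast hm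
  have hμM : μ ≤ M := by
    have := Real.rpow_le_rpow_of_exponent_ge hμ0 hμ1 (show ((m : ℝ) - 1) / (m : ℝ) ≤ 1 by
      rw [div_le_one hmR]; linarith)
    rwa [Real.rpow_one] at this
  obtain ⟨k, rfl⟩ : ∃ k, m = k + 1 := ⟨m - 1, by omega⟩
  set s := Real.sqrt p with hs
  have hss : s * s = p := Real.mul_self_sqrt hp0.le
  have hs1 : 1 ≤ s := by rw [hs]; exact Real.one_le_sqrt.mpr (by linarith)
  set Q : ℝ := (p:ℝ) ^ k with hQ
  have hQ0 : 0 < Q := by positivity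
  have hpm : (p:ℝ) ^ (k + 1) = p * Q := by rw [hQ]; ring
  have hpr : (p : ℝ) ^ (((k + 1 : ℕ) : ℝ) - 1 / 2) = s * Q := by
    rw [hs, hQ, Real.sqrt_eq_rpow, ← Real.rpow_natCast, ← Real.rpow_add hp0]
    congr 1; push_cast; ring
  rw [hpr, hpm]
  set t := ∏ j, (β j - α j) with ht
  have ht0 : 0 ≤ t := Finset.prod_nonneg fun j _ => by linarith [(hab j).2.1]
  have ht1 : t ≤ 1 := Finset.prod_le_one (fun j _ => by linarith [(hab j).2.1])
    fun j _ => by linarith [(hab j).1, (hab j).2.2]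
  set L := Real.log p with hL
  have hnn : 0 ≤ M * (s * Q) * L ^ (n + 2) := by positivity
  by_cases hbig : d < p ∧ 3 ≤ p
  · obtain ⟨hdp, hp3⟩ := hbig
    have hp3R : (3:ℝ) ≤ p := by exact_mod_cast hp3
    have hL1 : 1 ≤ L := by
      rw [hL, Real.le_log_iff_exp_le hp0]
      linarith [Real.exp_one_lt_d9]
    have hMQ : 1 ≤ M * Q := by
      have h1 : (p:ℝ) ^ (-((k+1:ℕ) : ℝ) / 2) ≤ μ := by
        refine le_trans ?_ hμ
        exact le_mul_of_one_le_right (by positivity) (one_le_pow₀ hL1)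
      have h2 : ((p:ℝ) ^ (-((k+1:ℕ) : ℝ) / 2)) ^ ((((k+1:ℕ) : ℝ) - 1) / ((k+1:ℕ) : ℝ)) ≤ M :=
        Real.rpow_le_rpow (by positivity) h1 (by
          apply div_nonneg <;> linarith)
      rw [← Real.rpow_mul hp0.le] at h2
      have e : -((k+1:ℕ) : ℝ) / 2 * ((((k+1:ℕ) : ℝ) - 1) / ((k+1:ℕ) : ℝ)) = -(k:ℝ) / 2 := by
        field_simp; push_cast; ring
      rw [e] at h2
      calc (1:ℝ) ≤ (p:ℝ) ^ ((k:ℝ) / 2) := Real.one_le_rpow (by linarith) (by positivity)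
        _ = (p:ℝ) ^ (-(k:ℝ)/2) * Q := by
            rw [hQ, ← Real.rpow_natCast, ← Real.rpow_add hp0]; congr 1; ring
        _ ≤ M * Q := by gcongr
    set ε : ℝ := ((k+1:ℕ):ℝ) * (d + 2) / p with hε
    have hε0 : 0 < ε := by positivity
    have hεA : ε * p = A := by rw [hε, hA]; field_simp
    set b : ℝ := C0 * (M * ε + ε ^ (k+1)) with hb
    have hb0 : 0 ≤ b := by positivity
    have hshell : tmeas (innerShell Ω ε) ≤ b := by
      refine ((hΩ ε hε0).2).trans ?_
      have e : (1 - 1 / (((k+1:ℕ)) : ℝ)) = (((k+1:ℕ) : ℝ) - 1) / ((k+1:ℕ) : ℝ) := by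
        field_simp
      rw [e, ← hμd, ← hM, hb]
      refine mul_le_mul_of_nonneg_right (le_max_left _ _) (by positivity)
    obtain ⟨U, hU1, hU2, hU3, hU4⟩ := geom hp2 hm Ω b hshell
    have h5 := count_lower hdp G hd hind U b hU4 α β hab
    have h6 := count_ncard G Ω U hU1 α β
    have h7 := h5.trans h6
    rw [mul_assoc 2 b, hpm] at h7
    have hpm0 : (0:ℝ) < p ^ (k+1) := by positivity
    have hfin := final_ineq n p L s M Q U.card t μ b K d _ (by linarith) hL1 hs1 hM0.le hQ0
      (Nat.cast_nonneg _) ht0 ht1 (Nat.cast_nonneg _) hb0 hK0 hμM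
      (by
        rw [← hpm]
        rwa [← div_eq_mul_inv, div_le_iff₀ hpm0] at hU2)
      (by
        rw [← hpm]
        have := mul_le_mul_of_nonneg_right hU3 hpm0.le
        rwa [add_mul, mul_assoc, inv_mul_cancel₀ hpm0.ne', mul_one] at this)
      (b_ineq k C0 M ε p Q A hC00 hA0 hpm hεA hMQ)
      h7
    refine le_trans ?_ hfin
    have : c1 * M * (s * Q) * L ^ (n+2) ≤ (c1 + c2) * M * (s * Q) * L ^ (n+2) := by
      gcongr; linarith
    linarith
  · have hpd : (p:ℝ) ≤ d + 2 := by
      have : p ≤ d + 2 := by omega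
      exact_mod_cast this
    have hsd : s ≤ Real.sqrt (d + 2) := Real.sqrt_le_sqrt hpd
    have h1 : s ≤ (c1 + c2) * L ^ (n + 2) := by
      calc s ≤ c2 * Real.log 2 ^ (n+2) := by rw [hc2, div_mul_cancel₀ _ (by positivity)]; exact hsd
        _ ≤ (c1 + c2) * L ^ (n+2) := by gcongr; linarith
    have h2 : t * μ * (p * Q) ≤ (c1 + c2) * M * (s * Q) * L ^ (n+2) := by
      calc t * μ * (p * Q) ≤ 1 * M * (p * Q) := by gcongr
        _ = (M * (s * Q)) * s := by rw [← hss]; ring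
        _ ≤ (M * (s * Q)) * ((c1 + c2) * L ^ (n + 2)) := by gcongr
        _ = _ := by ring
    have h3 : (0:ℝ) ≤ ({x : Fin (k+1) → Fin p | torusPt p x ∈ Ω ∧
                    ∀ j, α j ≤ fracPt G (fun i => ((x i : ℕ) : ℤ)) j ∧
                      fracPt G (fun i => ((x i : ℕ) : ℤ)) j < β j}.ncard : ℝ) := Nat.cast_nonneg _
    linarith
end

section
/- Lower bound in the proof of the main congruence theorem: let p be a prime, let m ≥ n + 1 ≥ 2 be integers, let F_1, …, F_n ∈ ℤ[X_1, …, X_m], and let X_p ⊆ {0, …, p−1}^m be the set of solutions of F_j(x) ≡ 0 (mod p), j = 1, …, n. Suppose there are constants ν ≥ 1 and A > 0 such that |#X_p − ν p^{m−n}| ≤ A p^{m−n−1/2} and such that for every integer k with 1 ≤ k ≤ p, every γ ∈ ℝ^m and every u ∈ ℤ^m, the number T_p(C) of points x ∈ X_p with x/p in the cube C = ∏_{j=1}^m [γ_j + u_j/k, γ_j + (u_j+1)/k] (taken modulo 1) satisfies |T_p(C) − #X_p · k^{−m}| ≤ A (p^{(m−n)/2}(log p)^m + k^{−(m−n−1)}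 p^{m−n−1/2}(log p)^{n+1}). Then for every very well shaped set Ω ⊆ 𝕋_m with constant C, T_p(Ω) ≥ #X_p · μ(Ω) − c (p^{m−n−1/(2(n+1))} μ(Ω)^{1−1/m} log p + p^{m−n−1/2} (log p)^{n+2}), where c depends only on m, n, ν, A and C. -/
open MeasureTheory

namespace CSL

noncomputable def ce (x : AddCircle (1 : ℝ)) : ℝ :=
  ((AddCircle.equivIoc (1 : ℝ) (√2) x : Set.Ioc (√2) (√2 + 1)) : ℝ) - √2

lemma ce_pos (x : AddCircle (1 : ℝ)) : 0 < ce x := by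
  have h := (AddCircle.equivIoc (1 : ℝ) (√2) x).2.1
  unfold ce; linarith

lemma ce_le (x : AddCircle (1 : ℝ)) : ce x ≤ 1 := by
  have h := (AddCircle.equivIoc (1 : ℝ) (√2) x).2.2
  unfold ce; linarith

lemma mk_ce (x : AddCircle (1 : ℝ)) : ((√2 + ce x : ℝ) : AddCircle (1 : ℝ)) = x := by
  have := AddCircle.coe_equivIoc (p := (1 : ℝ)) (a := √2) (y := x)
  unfold ce
  rw [add_sub_cancel]; exact this

lemma ce_mk (r : ℝ) (h : r ∈ Set.Ioc (√2) (√2 + 1)) : ce (r : AddCircle (1 : ℝ)) = r - √2 := by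
  unfold ce
  rw [AddCircle.equivIoc_coe_of_mem h]

lemma measurable_ce : Measurable ce := by
  have := (AddCircle.measurableEquivIoc (1 : ℝ) (√2)).measurable
  exact (measurable_subtype_coe.comp this).sub_const _

lemma dist_le_ce (x y : AddCircle (1 : ℝ)) : dist x y ≤ |ce x - ce y| := by
  conv_lhs => rw [← mk_ce x, ← mk_ce y]
  rw [dist_eq_norm, ← AddCircle.coe_sub]
  refine (QuotientAddGroup.norm_mk_le_norm).trans ?_
  rw [Real.norm_eq_abs]
  apply le_of_eq; congr 1; ring

noncomputable def idx1 (k : ℕ) (x : AddCircle (1 : ℝ)) : ℤ := ⌈(k : ℝ) * ce x⌉ - 1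

lemma idx1_eq (k : ℕ) (x : AddCircle (1 : ℝ)) (u : ℤ) :
    idx1 k x = u ↔ (u : ℝ) < k * ce x ∧ k * ce x ≤ u + 1 := by
  unfold idx1
  rw [sub_eq_iff_eq_add, Int.ceil_eq_iff]
  push_cast
  simp

lemma idx1_nonneg {k : ℕ} (hk : 1 ≤ k) (x : AddCircle (1 : ℝ)) : 0 ≤ idx1 k x := by
  have hk' : (0 : ℝ) < k := by exact_mod_cast hk
  have : 0 < ⌈(k : ℝ) * ce x⌉ := Int.ceil_pos.2 (mul_pos hk' (ce_pos x))
  unfold idx1; omega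

lemma idx1_lt {k : ℕ} (x : AddCircle (1 : ℝ)) : idx1 k x < k := by
  have : ⌈(k : ℝ) * ce x⌉ ≤ k := by
    apply Int.ceil_le.2
    have := mul_le_mul_of_nonneg_left (ce_le x) (Nat.cast_nonneg (α := ℝ) k)
    simpa using this
  unfold idx1; omega

lemma idx1_dist {k : ℕ} (hk : 1 ≤ k) (x y : AddCircle (1 : ℝ)) (h : idx1 k x = idx1 k y) :
    dist x y ≤ 1 / k := by
  have hk' : (0 : ℝ) < k := by exact_mod_cast hk
  obtain ⟨h1, h2⟩ := (idx1_eq k x _).1 rfl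
  obtain ⟨h3, h4⟩ := (idx1_eq k y _).1 h.symm
  refine (dist_le_ce x y).trans ?_
  rw [le_div_iff₀ hk']
  have e : |ce x - ce y| * k = |(ce x - ce y) * k| := by rw [abs_mul, abs_of_pos hk']
  rw [e, abs_le]
  constructor <;> nlinarith

lemma idx1_half {k : ℕ} (x y : AddCircle (1 : ℝ))
    (h : idx1 (2 * k) x = idx1 (2 * k) y) : idx1 k x = idx1 k y := by
  have key : ∀ z, idx1 k z = idx1 (2 * k) z / 2 := by
    intro z
    obtain ⟨h1, h2⟩ := (idx1_eq (2 * k) z _).1 rfl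
    rw [idx1_eq]
    generalize idx1 (2 * k) z = w at *
    push_cast at h1 h2
    have e : w % 2 + 2 * (w / 2) = w := by omega
    have e1 : (2 * (w / 2 : ℤ) : ℝ) ≤ w := by exact_mod_cast (by omega : 2 * (w / 2) ≤ w)
    have e2 : (w : ℝ) ≤ 2 * (w / 2 : ℤ) + 1 := by
      exact_mod_cast (by omega : w ≤ 2 * (w / 2) + 1)
    constructor <;> linarith
  rw [key, key, h]

lemma measurable_idx1 (k : ℕ) : Measurable (idx1 k) := by
  have h : Measurable fun x => ⌈(k : ℝ) * ce x⌉ := (measurable_ce.const_mul _).ceil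
  exact h.sub_const 1

lemma vol_idx1 {k : ℕ} (hk : 1 ≤ k) (u : ℤ) (h0 : 0 ≤ u) (h1 : u < k) :
    volume {x | idx1 k x = u} = ENNReal.ofReal (1 / k) := by
  have hk' : (0 : ℝ) < k := by exact_mod_cast hk
  have h0' : (0 : ℝ) ≤ u := by exact_mod_cast h0
  have h1' : (u : ℝ) + 1 ≤ k := by exact_mod_cast h1
  change volume (idx1 k ⁻¹' {u}) = _
  rw [AddCircle.add_projection_respects_measure (1 : ℝ) (√2)
    (measurable_idx1 k (measurableSet_singleton u))]
  have : (QuotientAddGroup.mk ⁻¹' (idx1 k ⁻¹' {u}) ∩ Set.Ioc (√2) (√2 + 1) : Set ℝ)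
      = Set.Ioc (√2 + u / k) (√2 + (u + 1) / k) := by
    ext r
    have hb1 : 0 ≤ (u : ℝ) / k := by positivity
    have hb2 : ((u : ℝ) + 1) / k ≤ 1 := by rw [div_le_one hk']; exact h1'
    have key : r ∈ Set.Ioc (√2) (√2 + 1) → (idx1 k (r : AddCircle (1 : ℝ)) = u ↔
        r ∈ Set.Ioc (√2 + u / k) (√2 + (u + 1) / k)) := by
      intro hr
      rw [idx1_eq, ce_mk r hr, Set.mem_Ioc, ← lt_sub_iff_add_lt',
        ← sub_le_iff_le_add' (a := r) (b := √2), div_lt_iff₀' hk', le_div_iff₀' hk']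
    constructor
    · rintro ⟨ha, hb⟩
      exact (key hb).1 ha
    · intro hr
      have hb : r ∈ Set.Ioc (√2) (√2 + 1) := ⟨by linarith [hr.1], by linarith [hr.2]⟩
      exact ⟨(key hb).2 hr, hb⟩
  rw [this, Real.volume_Ioc]
  congr 1
  ring

lemma mem_torusIcc {k : ℕ} (hk : 1 ≤ k) (x : AddCircle (1 : ℝ)) (u : ℤ) (h : idx1 k x = u) :
    x ∈ torusIcc (√2 + (u : ℝ) / k) (√2 + ((u : ℝ) + 1) / k) := by
  have hk' : (0 : ℝ) < k := by exact_mod_cast hk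
  obtain ⟨h1, h2⟩ := (idx1_eq k x u).1 h
  refine ⟨√2 + ce x, ⟨?_, ?_⟩, mk_ce x⟩
  · gcongr; rw [div_le_iff₀' hk']; exact h1.le
  · gcongr; rw [le_div_iff₀' hk']; exact h2

lemma idx1_of_mem {k : ℕ} (hk : 1 ≤ k) (q : ℚ) (u : ℤ) (h0 : 0 ≤ u) (h1 : u < k)
    (h : ((q : ℝ) : AddCircle (1 : ℝ)) ∈
      torusIcc (√2 + (u : ℝ) / k) (√2 + ((u : ℝ) + 1) / k)) :
    idx1 k ((q : ℝ) : AddCircle (1 : ℝ)) = u := by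
  have hk' : (0 : ℝ) < k := by exact_mod_cast hk
  have h0' : (0 : ℝ) ≤ u := by exact_mod_cast h0
  have h1' : (u : ℝ) + 1 ≤ k := by exact_mod_cast h1
  have hb1 : 0 ≤ (u : ℝ) / k := by positivity
  have hb2 : ((u : ℝ) + 1) / k ≤ 1 := by rw [div_le_one hk']; exact h1'
  obtain ⟨r, ⟨hr1, hr2⟩, hr⟩ := h
  simp only at hr
  have hne : r ≠ √2 + (u : ℝ) / k := by
    intro e
    have h3 : ((r - q : ℝ) : AddCircle (1 : ℝ)) = 0 := by rw [AddCircle.coe_sub, hr, sub_self]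
    obtain ⟨z, hz⟩ := (AddCircle.coe_eq_zero_iff (1 : ℝ)).1 h3
    refine irrational_sqrt_two ⟨(z : ℚ) + q - (u : ℚ) / k, ?_⟩
    push_cast
    simp at hz
    linarith
  have hr1' := lt_of_le_of_ne hr1 hne.symm
  rw [← hr, idx1_eq, ce_mk r ⟨by linarith, by linarith⟩]
  constructor
  · rw [← div_lt_iff₀' hk']; linarith
  · rw [← le_div_iff₀' hk']; linarith

noncomputable def idx {m : ℕ} (k : ℕ) (t : Torus m) : Fin m → ℤ := fun i => idx1 k (t i)

lemma measurable_idx {m : ℕ} (k : ℕ) : Measurable (idx (m := m) k) := by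
  refine measurable_pi_lambda _ fun i => ?_
  exact (measurable_idx1 k).comp (measurable_pi_apply i)

noncomputable def cells (m k : ℕ) : Finset (Fin m → ℤ) :=
  Fintype.piFinset fun _ => Finset.Ico 0 (k : ℤ)

lemma idx_mem_cells {m k : ℕ} (hk : 1 ≤ k) (t : Torus m) : idx k t ∈ cells m k := by
  rw [cells, Fintype.mem_piFinset]
  intro i
  exact Finset.mem_Ico.2 ⟨idx1_nonneg hk _, idx1_lt _⟩

lemma vol_cell {m k : ℕ} (hk : 1 ≤ k) (u : Fin m → ℤ) (hu : u ∈ cells m k) :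
    tmeas (idx k ⁻¹' {u} : Set (Torus m)) = 1 / (k : ℝ) ^ m := by
  rw [cells, Fintype.mem_piFinset] at hu
  have : (idx k ⁻¹' {u} : Set (Torus m)) = Set.pi Set.univ fun i => {x | idx1 k x = u i} := by
    ext t; simp [idx, funext_iff]
  unfold tmeas
  rw [this, volume_pi_pi]
  have h2 : ∀ i ∈ Finset.univ, volume {x | idx1 k x = u i} = ENNReal.ofReal (1 / k) := by
    intro i _
    have := Finset.mem_Ico.1 (hu i)
    exact vol_idx1 hk _ this.1 this.2
  rw [Finset.prod_congr rfl h2]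
  simp

lemma torusDist_le {m k : ℕ} (hk : 1 ≤ k) (s t : Torus m) (h : idx k s = idx k t) :
    torusDist s t ≤ m * (1 / k) := by
  unfold torusDist
  refine Real.sqrt_le_iff.2 ⟨by positivity, ?_⟩
  calc ∑ i, dist (s i) (t i) ^ 2 ≤ ∑ i : Fin m, (1 / (k : ℝ)) ^ 2 := by
        apply Finset.sum_le_sum
        intro i _
        have := idx1_dist hk (s i) (t i) (congrFun h i)
        gcongr
    _ = m * (1 / (k : ℝ)) ^ 2 := by simp
    _ ≤ (m : ℝ) ^ 2 * (1 / (k : ℝ)) ^ 2 := by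
        gcongr
        rcases Nat.eq_zero_or_pos m with rfl | hm
        · simp
        · have : (1 : ℝ) ≤ m := by exact_mod_cast hm
          nlinarith
    _ = _ := by ring

lemma tcount_cell {p m n k : ℕ} (hk : 1 ≤ k) (F : Fin n → MvPolynomial (Fin m) ℤ)
    (u : Fin m → ℤ) (hu : u ∈ cells m k) :
    Tcount p F (gridCube (fun _ => √2) k u) = Tcount p F (idx k ⁻¹' {u}) := by
  rw [cells, Fintype.mem_piFinset] at hu
  unfold Tcount
  congr 2
  ext x
  have e : ∀ i, torusPt p x i = (((((x i : ℕ) : ℚ) / (p : ℚ) : ℚ) : ℝ) : AddCircle (1 : ℝ)) := by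
    intro i; simp [torusPt]
  simp only [gridCube, Set.mem_ofPred_eq, Set.mem_preimage, Set.mem_singleton_iff, idx, funext_iff]
  refine forall_congr' fun i => ?_
  have hu' := Finset.mem_Ico.1 (hu i)
  constructor
  · intro h
    rw [e] at h ⊢
    exact idx1_of_mem hk _ _ hu'.1 hu'.2 h
  · intro h
    exact mem_torusIcc hk _ _ h

def Sat {m : ℕ} (k : ℕ) (E : Set (Torus m)) : Prop := ∀ s t, idx k s = idx k t → t ∈ E → s ∈ E

open Classical in
lemma sat_union {m k : ℕ} (hk : 1 ≤ k) (E : Set (Torus m)) (hE : Sat k E) :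
    E = ⋃ u ∈ (cells m k).filter (fun u => ∃ t ∈ E, idx k t = u), idx k ⁻¹' {u} := by
  ext t
  simp only [Finset.mem_filter, Set.mem_iUnion, Set.mem_preimage, Set.mem_singleton_iff,
    exists_prop]
  constructor
  · intro ht
    exact ⟨_, ⟨idx_mem_cells hk t, t, ht, rfl⟩, rfl⟩
  · rintro ⟨u, ⟨_, s, hs, hsu⟩, htu⟩
    exact hE t s (htu.trans hsu.symm) hs

lemma sat_meas {m k : ℕ} (hk : 1 ≤ k) (E : Set (Torus m)) (hE : Sat k E) : MeasurableSet E := by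
  classical
  rw [sat_union hk E hE]
  exact Finset.measurableSet_biUnion _ fun u _ => measurable_idx k (measurableSet_singleton u)

lemma tcount_union {p m n : ℕ} (F : Fin n → MvPolynomial (Fin m) ℤ) (A B : Set (Torus m))
    (h : Disjoint A B) : Tcount p F (A ∪ B) = Tcount p F A + Tcount p F B := by
  unfold Tcount
  rw [← Set.ncard_union_eq]
  · congr 1
    ext x
    simp only [Set.mem_inter_iff, Set.mem_ofPred_eq, Set.mem_union, and_or_left]
  · rw [Set.disjoint_left] at h ⊢
    rintro x ⟨_, hx⟩ ⟨_, hy⟩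
    exact h hx hy

lemma tcount_mono {p m n : ℕ} (F : Fin n → MvPolynomial (Fin m) ℤ) (A B : Set (Torus m))
    (h : A ⊆ B) : Tcount p F A ≤ Tcount p F B := by
  unfold Tcount
  apply Set.ncard_le_ncard
  · rintro x ⟨h1, h2⟩
    exact ⟨h1, h h2⟩
  · exact Set.toFinite _

lemma tmeas_union {m : ℕ} (A B : Set (Torus m)) (h : Disjoint A B) (hB : MeasurableSet B) :
    tmeas (A ∪ B) = tmeas A + tmeas B := by
  unfold tmeas
  rw [measure_union h hB, ENNReal.toReal_add (measure_ne_top _ _) (measure_ne_top _ _)]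

lemma tmeas_mono {m : ℕ} (A B : Set (Torus m)) (h : A ⊆ B) : tmeas A ≤ tmeas B :=
  ENNReal.toReal_mono (measure_ne_top _ _) (measure_mono h)

lemma tmeas_nonneg {m : ℕ} (A : Set (Torus m)) : 0 ≤ tmeas A := ENNReal.toReal_nonneg

lemma cell_sum {p m n k : ℕ} (hk : 1 ≤ k) (F : Fin n → MvPolynomial (Fin m) ℤ) (X err : ℝ)
    (h : ∀ u : Fin m → ℤ,
      |(Tcount p F (gridCube (fun _ => √2) k u) : ℝ) - X / (k : ℝ) ^ m| ≤ err)
    (S : Finset (Fin m → ℤ)) (hS : S ⊆ cells m k) :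
    X * tmeas (⋃ u ∈ S, idx k ⁻¹' {u} : Set (Torus m))
      - tmeas (⋃ u ∈ S, idx k ⁻¹' {u} : Set (Torus m)) * (k : ℝ) ^ m * err
      ≤ (Tcount p F (⋃ u ∈ S, idx k ⁻¹' {u}) : ℝ) := by
  classical
  have hk' : (0 : ℝ) < k := by exact_mod_cast hk
  induction S using Finset.induction_on with
  | empty => simp [tmeas, Tcount]
  | insert a S ha ih =>
    have ih := ih ((Finset.subset_insert a S).trans hS)
    have ha' := hS (Finset.mem_insert_self a S)
    have hd : Disjoint (idx k ⁻¹' {a} : Set (Torus m)) (⋃ u ∈ S, idx k ⁻¹' {u}) := by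
      rw [Set.disjoint_left]
      intro t ht ht'
      simp only [Set.mem_iUnion, Set.mem_preimage, Set.mem_singleton_iff, exists_prop] at ht ht'
      obtain ⟨u, hu, e⟩ := ht'
      exact ha (by rw [← ht, e]; exact hu)
    rw [Finset.set_biUnion_insert, tcount_union F _ _ hd, tmeas_union _ _ hd
      (Finset.measurableSet_biUnion _ fun u _ => measurable_idx k (measurableSet_singleton u)),
      vol_cell hk a ha', ← tcount_cell hk F a ha']
    have := (abs_le.1 (h a)).1
    push_cast
    have e1 : 1 / (k : ℝ) ^ m * (k : ℝ) ^ m = 1 := by field_simp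
    have e2 : X * (1 / (k : ℝ) ^ m) = X / (k : ℝ) ^ m := by ring
    rw [mul_add, add_mul, add_mul, e1, e2]
    linarith

lemma sat_bound {p m n k : ℕ} (hk : 1 ≤ k) (F : Fin n → MvPolynomial (Fin m) ℤ) (X err : ℝ)
    (h : ∀ u : Fin m → ℤ,
      |(Tcount p F (gridCube (fun _ => √2) k u) : ℝ) - X / (k : ℝ) ^ m| ≤ err)
    (E : Set (Torus m)) (hE : Sat k E) :
    X * tmeas E - tmeas E * (k : ℝ) ^ m * err ≤ (Tcount p F E : ℝ) := by
  classical
  have := cell_sum hk F X err h _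
    (Finset.filter_subset (fun u => ∃ t ∈ E, idx k t = u) (cells m k))
  rwa [← sat_union hk E hE] at this

def inner {m : ℕ} (Ω : Set (Torus m)) (i : ℕ) : Set (Torus m) :=
  {t | ∀ s, idx (2 ^ i) s = idx (2 ^ i) t → s ∈ Ω}

lemma inner_sub {m : ℕ} (Ω : Set (Torus m)) (i : ℕ) : inner Ω i ⊆ Ω := fun t ht => ht t rfl

lemma idx_succ {m : ℕ} (i : ℕ) (s t : Torus m) (h : idx (2 ^ (i + 1)) s = idx (2 ^ (i + 1)) t) :
    idx (2 ^ i) s = idx (2 ^ i) t := by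
  funext j
  have := congrFun h j
  simp only [idx, pow_succ'] at this ⊢
  exact idx1_half _ _ this

lemma inner_mono {m : ℕ} (Ω : Set (Torus m)) (i : ℕ) : inner Ω i ⊆ inner Ω (i + 1) :=
  fun t ht s hs => ht s (idx_succ i s t hs)

lemma inner_sat {m : ℕ} (Ω : Set (Torus m)) (i : ℕ) : Sat (2 ^ i) (inner Ω i) :=
  fun _ _ hst ht r hr => ht r (hr.trans hst)

lemma diff_sat {m : ℕ} (Ω : Set (Torus m)) (i : ℕ) :
    Sat (2 ^ (i + 1)) (inner Ω (i + 1) \ inner Ω i) := by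
  intro s t hst ht
  refine ⟨inner_sat Ω (i + 1) s t hst ht.1, fun hs => ht.2 ?_⟩
  exact inner_sat Ω i t s (idx_succ i s t hst).symm hs

lemma inner_zero {m : ℕ} (Ω : Set (Torus m)) (h : Ω ≠ Set.univ) : inner Ω 0 = ∅ := by
  obtain ⟨w, hw⟩ := (Set.ne_univ_iff_exists_notMem Ω).1 h
  ext t
  simp only [Set.mem_empty_iff_false, iff_false]
  intro ht
  refine hw (ht w ?_)
  funext j
  have h1 := idx1_nonneg (k := 1) le_rfl (w j)
  have h2 := idx1_nonneg (k := 1) le_rfl (t j)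
  have h3 := idx1_lt (k := 1) (w j)
  have h4 := idx1_lt (k := 1) (t j)
  simp only [idx, pow_zero]
  omega

lemma sub_shell {m : ℕ} (hm : 1 ≤ m) (Ω : Set (Torus m)) (i : ℕ) :
    Ω \ inner Ω i ⊆ innerShell Ω (2 * m / 2 ^ i) := by
  rintro t ⟨h1, h2⟩
  refine ⟨h1, ?_⟩
  simp only [inner, Set.mem_ofPred_eq, not_forall] at h2
  obtain ⟨s, hs, hs'⟩ := h2
  have hm' : (1 : ℝ) ≤ m := by exact_mod_cast hm
  have hb : BddBelow (Set.range fun w : (Ωᶜ : Set (Torus m)) => torusDist t (w : Torus m)) :=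
    ⟨0, by rintro _ ⟨w, rfl⟩; exact Real.sqrt_nonneg _⟩
  have h3 := ciInf_le hb ⟨s, hs'⟩
  have h4 := torusDist_le (Nat.one_le_two_pow) t s hs.symm
  push_cast at h4
  unfold torusDistSet
  refine (h3.trans h4).trans_lt ?_
  have : (0 : ℝ) < 1 / 2 ^ i := by positivity
  have e : (2 * m / 2 ^ i : ℝ) = 2 * (m * (1 / 2 ^ i)) := by ring
  rw [e]
  have : 0 < (m : ℝ) * (1 / 2 ^ i) := by positivity
  linarith

lemma diff_bound {m : ℕ} (hm : 1 ≤ m) (Ω : Set (Torus m)) (C : ℝ) (h : IsVeryWellShaped Ω C)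
    (i : ℕ) : tmeas (Ω \ inner Ω i) ≤
      |C| * (2 * m) ^ m * (tmeas Ω ^ (1 - 1 / (m : ℝ)) / 2 ^ i + 1 / (2 ^ i) ^ m) := by
  have hm' : (1 : ℝ) ≤ m := by exact_mod_cast hm
  have h1 := (h (2 * m / 2 ^ i) (by positivity)).2
  refine (tmeas_mono _ _ (sub_shell hm Ω i)).trans (h1.trans ?_)
  have hμ : 0 ≤ tmeas Ω ^ (1 - 1 / (m : ℝ)) := Real.rpow_nonneg (tmeas_nonneg _) _
  have h2 : (2 * m : ℝ) ≤ (2 * m) ^ m := le_self_pow₀ (by linarith) (by omega)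
  rw [mul_assoc]
  refine mul_le_mul (le_abs_self C) ?_ (by positivity) (abs_nonneg _)
  rw [mul_add, div_pow]
  gcongr ?_ + ?_
  · calc tmeas Ω ^ (1 - 1 / (m : ℝ)) * (2 * m / 2 ^ i)
        = (2 * m) * (tmeas Ω ^ (1 - 1 / (m : ℝ)) / 2 ^ i) := by ring
      _ ≤ _ := by gcongr
  · apply le_of_eq; ring

lemma ne_univ {m : ℕ} (hm : 1 ≤ m) (Ω : Set (Torus m)) (C : ℝ) (h : IsVeryWellShaped Ω C) :
    Ω ≠ Set.univ := by
  rintro rfl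
  have h0 : ∀ ε : ℝ, 0 < ε → innerShell (Set.univ : Set (Torus m)) ε = Set.univ := by
    intro ε hε
    ext t
    simp [innerShell, torusDistSet, hε]
  have h1 : tmeas (Set.univ : Set (Torus m)) = 1 := by
    unfold tmeas
    rw [volume_pi, Measure.pi_univ]
    simp
  have hC : 0 < 2 * |C| + 2 := by positivity
  set ε : ℝ := 1 / (2 * |C| + 2) with hε
  have hε0 : 0 < ε := by positivity
  have h2 := (h ε hε0).2
  rw [h0 _ hε0, h1, Real.one_rpow, one_mul] at h2
  have h3 : ε ^ m ≤ ε := by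
    apply pow_le_of_le_one hε0.le _ (by omega)
    rw [hε, div_le_one hC]; linarith [abs_nonneg C]
  have h4 : C * (ε + ε ^ m) ≤ |C| * (ε + ε) :=
    mul_le_mul (le_abs_self C) (by linarith) (by positivity) (abs_nonneg C)
  have h5 : ε * (2 * |C| + 2) = 1 := by rw [hε]; field_simp
  nlinarith

lemma main_sum {p m n : ℕ} (F : Fin n → MvPolynomial (Fin m) ℤ) (X : ℝ) (err : ℕ → ℝ)
    (M : ℕ) (h : ∀ i < M, ∀ u : Fin m → ℤ,
      |(Tcount p F (gridCube (fun _ => √2) (2 ^ (i + 1)) u) : ℝ)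
        - X / ((2 ^ (i + 1) : ℕ) : ℝ) ^ m| ≤ err i)
    (Ω : Set (Torus m)) (hΩ : Ω ≠ Set.univ) :
    X * tmeas (inner Ω M) - ∑ i ∈ Finset.range M,
      tmeas (inner Ω (i + 1) \ inner Ω i) * ((2 ^ (i + 1) : ℕ) : ℝ) ^ m * err i
      ≤ (Tcount p F (inner Ω M) : ℝ) := by
  induction M with
  | zero => simp [inner_zero Ω hΩ, tmeas]
  | succ M ih =>
    have ih := ih fun i hi => h i (by omega)
    have h1 := sat_bound Nat.one_le_two_pow F X (err M) (h M (by omega)) _ (diff_sat Ω M)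
    have hd : Disjoint (inner Ω M) (inner Ω (M + 1) \ inner Ω M) := Set.disjoint_sdiff_right
    have hu : inner Ω (M + 1) = inner Ω M ∪ (inner Ω (M + 1) \ inner Ω M) :=
      (Set.union_sdiff_cancel (inner_mono Ω M)).symm
    have e1 := tcount_union (p := p) F _ _ hd
    have e2 := tmeas_union _ _ hd (sat_meas Nat.one_le_two_pow _ (diff_sat Ω M))
    rw [← hu] at e1 e2
    rw [Finset.sum_range_succ, e1, e2]
    push_cast at h1 ih ⊢
    linarith


lemma tmeas_sub {m : ℕ} (A B : Set (Torus m)) (h : A ⊆ B) :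
    tmeas B ≤ tmeas A + tmeas (B \ A) := by
  unfold tmeas
  rw [← ENNReal.toReal_add (measure_ne_top _ _) (measure_ne_top _ _)]
  refine ENNReal.toReal_mono (by simp) ?_
  conv_lhs => rw [← Set.union_sdiff_cancel h]
  exact measure_union_le _ _

lemma half_le_log {p : ℕ} (hp : 2 ≤ p) : 1 ≤ 2 * Real.log p := by
  have h1 : Real.log 2 ≤ Real.log p :=
    Real.log_le_log (by norm_num) (by exact_mod_cast hp)
  have := Real.log_two_gt_d9
  linarith

lemma log_le_sqrt {p : ℕ} (hp : 2 ≤ p) : Real.log p ≤ 2 * (p : ℝ) ^ (1 / 2 : ℝ) := by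
  have := Real.log_le_rpow_div (x := (p : ℝ)) (by positivity) (ε := 1 / 2) (by norm_num)
  linarith

lemma pick {p : ℕ} (hp : 2 ≤ p) (a : ℝ) (ha1 : a ≤ 1) :
    ∃ M : ℕ, (M = 0 ∨ (2 : ℝ) ^ M * Real.log p ≤ (p : ℝ) ^ a) ∧
      (p : ℝ) ^ a ≤ 4 * Real.log p * 2 ^ M ∧ 2 ^ M ≤ p := by
  have hL := half_le_log hp
  have hp1 : (1 : ℝ) ≤ p := by exact_mod_cast (by omega : 1 ≤ p)
  rcases lt_or_ge ((p : ℝ) ^ a / (2 * Real.log p)) 1 with h | h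
  · refine ⟨0, Or.inl rfl, ?_, by simp; omega⟩
    rw [div_lt_one (by linarith)] at h
    simp; linarith
  · obtain ⟨M, h1, h2⟩ := exists_nat_pow_near h (one_lt_two)
    rw [le_div_iff₀ (by linarith)] at h1
    rw [div_lt_iff₀ (by linarith), pow_succ] at h2
    have hK : (0 : ℝ) < 2 ^ M := by positivity
    refine ⟨M, Or.inr (by nlinarith), by nlinarith, ?_⟩
    have h3 : (p : ℝ) ^ a ≤ (p : ℝ) ^ (1 : ℝ) := Real.rpow_le_rpow_of_exponent_le hp1 ha1
    rw [Real.rpow_one] at h3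
    have : (2 : ℝ) ^ M ≤ p := by nlinarith
    exact_mod_cast this

lemma M_le {p M : ℕ} (hp : 2 ≤ p) (h : 2 ^ M ≤ p) : (M : ℝ) ≤ 2 * Real.log p := by
  have h1 : Real.log ((2 : ℝ) ^ M) ≤ Real.log p :=
    Real.log_le_log (by positivity) (by exact_mod_cast h)
  rw [Real.log_pow] at h1
  have := Real.log_two_gt_d9
  have hM : (0 : ℝ) ≤ M := Nat.cast_nonneg M
  nlinarith

lemma f1 {p n m : ℕ} (hp : 2 ≤ p) (hm : n + 1 ≤ m) :
    (p : ℝ) ^ (((m : ℝ) - n) / 2) * Real.log p ^ m ≤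
      2 ^ m * ((p : ℝ) ^ ((m : ℝ) - n - 1 / 2) * Real.log p ^ (n + 1)) := by
  obtain ⟨d, rfl⟩ := Nat.exists_eq_add_of_le hm
  have hL := half_le_log hp
  have hp0 : (0 : ℝ) < p := by exact_mod_cast (by omega : 0 < p)
  have h1 : Real.log p ^ d ≤ 2 ^ d * (p : ℝ) ^ ((d : ℝ) / 2) := by
    calc Real.log p ^ d ≤ (2 * (p : ℝ) ^ (1 / 2 : ℝ)) ^ d :=
          pow_le_pow_left₀ (by linarith) (log_le_sqrt hp) d
      _ = _ := by
          rw [mul_pow, ← Real.rpow_natCast ((p : ℝ) ^ (1 / 2 : ℝ)), ← Real.rpow_mul hp0.le]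
          congr 2; ring
  have e : (p : ℝ) ^ ((((n + 1 + d : ℕ) : ℝ) - n) / 2) * (p : ℝ) ^ ((d : ℝ) / 2)
      = (p : ℝ) ^ (((n + 1 + d : ℕ) : ℝ) - n - 1 / 2) := by
    rw [← Real.rpow_add hp0]; congr 1; push_cast; ring
  have h2 : (2 : ℝ) ^ d ≤ 2 ^ (n + 1 + d) := pow_le_pow_right₀ (by norm_num) (by omega)
  rw [pow_add (Real.log p), ← e]
  have hLp : 0 ≤ Real.log p := by linarith
  calc _ ≤ (p : ℝ) ^ ((((n + 1 + d : ℕ) : ℝ) - n) / 2) *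
        (Real.log p ^ (n + 1) * (2 ^ (n + 1 + d) * (p : ℝ) ^ ((d : ℝ) / 2))) := by
        gcongr
        exact h1.trans (by gcongr)
    _ = _ := by ring

lemma f2 {p n m : ℕ} (hp : 2 ≤ p) (hm : n + 1 ≤ m) (K : ℝ) (hK0 : 0 ≤ K)
    (hK : K * Real.log p ≤ (p : ℝ) ^ (1 / (2 * ((n : ℝ) + 1)))) :
    K ^ (m - 1) * ((p : ℝ) ^ (((m : ℝ) - n) / 2) * Real.log p ^ m) ≤
      (p : ℝ) ^ ((m : ℝ) - n - 1 / (2 * ((n : ℝ) + 1))) * Real.log p := by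
  obtain ⟨d, rfl⟩ := Nat.exists_eq_add_of_le hm
  have hL := half_le_log hp
  have hLp : 0 ≤ Real.log p := by linarith
  have hp0 : (0 : ℝ) < p := by exact_mod_cast (by omega : 0 < p)
  have hp1 : (1 : ℝ) ≤ p := by exact_mod_cast (by omega : 1 ≤ p)
  have e0 : n + 1 + d - 1 = n + d := by omega
  rw [e0]
  have h1 : (K * Real.log p) ^ (n + d) ≤ (p : ℝ) ^ (1 / (2 * ((n : ℝ) + 1)) * ((n : ℝ) + d)) := by
    rw [Real.rpow_mul hp0.le]
    calc _ ≤ ((p : ℝ) ^ (1 / (2 * ((n : ℝ) + 1)))) ^ (n + d) :=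
          pow_le_pow_left₀ (by positivity) hK _
      _ = _ := by rw [← Real.rpow_natCast]; push_cast; rfl
  calc _ = (K * Real.log p) ^ (n + d) * (p : ℝ) ^ ((((n + 1 + d : ℕ) : ℝ) - n) / 2)
        * Real.log p := by ring
    _ ≤ (p : ℝ) ^ (1 / (2 * ((n : ℝ) + 1)) * ((n : ℝ) + d)) *
        (p : ℝ) ^ ((((n + 1 + d : ℕ) : ℝ) - n) / 2) * Real.log p := by gcongr
    _ ≤ _ := by
        rw [← Real.rpow_add hp0]
        gcongr
        push_cast
        have hn : (0 : ℝ) < (n : ℝ) + 1 := by positivity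
        have : ((n : ℝ) + 1 + d - n - 1 / (2 * ((n : ℝ) + 1)))
          - (1 / (2 * ((n : ℝ) + 1)) * ((n : ℝ) + d) + ((n : ℝ) + 1 + d - n) / 2)
          = d * n / (2 * ((n : ℝ) + 1)) := by field_simp; ring
        have h3 : (0 : ℝ) ≤ d * n / (2 * ((n : ℝ) + 1)) := by positivity
        linarith

lemma f3 {p n m : ℕ} (hp : 2 ≤ p) (K : ℝ) (hK0 : 0 ≤ K)
    (hK : K * Real.log p ≤ (p : ℝ) ^ (1 / (2 * ((n : ℝ) + 1)))) :
    K ^ n * ((p : ℝ) ^ ((m : ℝ) - n - 1 / 2) * Real.log p ^ (n + 1)) ≤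
      (p : ℝ) ^ ((m : ℝ) - n - 1 / (2 * ((n : ℝ) + 1))) * Real.log p := by
  have hL := half_le_log hp
  have hLp : 0 ≤ Real.log p := by linarith
  have hp0 : (0 : ℝ) < p := by exact_mod_cast (by omega : 0 < p)
  have h1 : (K * Real.log p) ^ n ≤ (p : ℝ) ^ (1 / (2 * ((n : ℝ) + 1)) * (n : ℝ)) := by
    rw [Real.rpow_mul hp0.le]
    calc _ ≤ ((p : ℝ) ^ (1 / (2 * ((n : ℝ) + 1)))) ^ n :=
          pow_le_pow_left₀ (by positivity) hK _
      _ = _ := by rw [← Real.rpow_natCast]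
  calc _ = (K * Real.log p) ^ n * (p : ℝ) ^ ((m : ℝ) - n - 1 / 2) * Real.log p := by ring
    _ ≤ (p : ℝ) ^ (1 / (2 * ((n : ℝ) + 1)) * (n : ℝ)) * (p : ℝ) ^ ((m : ℝ) - n - 1 / 2)
        * Real.log p := by gcongr
    _ = _ := by
        rw [← Real.rpow_add hp0]
        congr 2
        have hn : (0 : ℝ) < (n : ℝ) + 1 := by positivity
        field_simp; ring

lemma f4 {p n m : ℕ} (hp : 2 ≤ p) (hm : n + 1 ≤ m) (K : ℝ) (hK0 : 0 < K)
    (hK : (p : ℝ) ^ (1 / (2 * ((n : ℝ) + 1))) ≤ 4 * Real.log p * K) :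
    (p : ℝ) ^ (m - n) / K ≤
      4 * ((p : ℝ) ^ ((m : ℝ) - n - 1 / (2 * ((n : ℝ) + 1))) * Real.log p) := by
  have hp0 : (0 : ℝ) < p := by exact_mod_cast (by omega : 0 < p)
  rw [div_le_iff₀ hK0]
  have e : (p : ℝ) ^ (m - n) = (p : ℝ) ^ ((m : ℝ) - n - 1 / (2 * ((n : ℝ) + 1))) *
      (p : ℝ) ^ (1 / (2 * ((n : ℝ) + 1))) := by
    rw [← Real.rpow_add hp0, ← Real.rpow_natCast, Nat.cast_sub (by omega)]
    congr 1; ring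
  rw [e]
  calc _ ≤ (p : ℝ) ^ ((m : ℝ) - n - 1 / (2 * ((n : ℝ) + 1))) * (4 * Real.log p * K) := by gcongr
    _ = _ := by ring

lemma f5 {p n m : ℕ} (hp : 2 ≤ p) (hm : n + 1 ≤ m) (K : ℝ) (hK0 : 1 ≤ K)
    (hK : (p : ℝ) ^ (1 / (2 * ((n : ℝ) + 1))) ≤ 4 * Real.log p * K) :
    (p : ℝ) ^ (m - n) / K ^ m ≤
      4 ^ (n + 1) * ((p : ℝ) ^ ((m : ℝ) - n - 1 / 2) * Real.log p ^ (n + 1)) := by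
  have hp0 : (0 : ℝ) < p := by exact_mod_cast (by omega : 0 < p)
  have hL := half_le_log hp
  have hLp : 0 ≤ Real.log p := by linarith
  have hK1 : 0 < K := by linarith
  have h1 : K ^ (n + 1) ≤ K ^ m := pow_le_pow_right₀ hK0 hm
  rw [div_le_iff₀ (by positivity)]
  have e : (p : ℝ) ^ (m - n) = (p : ℝ) ^ ((m : ℝ) - n - 1 / 2) *
      ((p : ℝ) ^ (1 / (2 * ((n : ℝ) + 1)))) ^ (n + 1) := by
    rw [← Real.rpow_natCast ((p : ℝ) ^ (1 / (2 * ((n : ℝ) + 1)))), ← Real.rpow_mul hp0.le,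
      ← Real.rpow_add hp0, ← Real.rpow_natCast, Nat.cast_sub (by omega)]
    congr 1
    have hn : (0 : ℝ) < (n : ℝ) + 1 := by positivity
    push_cast
    field_simp; ring
  rw [e]
  calc _ ≤ (p : ℝ) ^ ((m : ℝ) - n - 1 / 2) * (4 * Real.log p * K) ^ (n + 1) := by gcongr
    _ = 4 ^ (n + 1) * ((p : ℝ) ^ ((m : ℝ) - n - 1 / 2) * Real.log p ^ (n + 1)) * K ^ (n + 1) := by
      ring
    _ ≤ _ := by gcongr

lemma pow_shift (k K : ℝ) (hk : 0 ≤ k) (hkK : k ≤ K) (hK : 0 < K) (j : ℕ) (hj : 1 ≤ j) :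
    k ^ j ≤ k / K * K ^ j := by
  obtain ⟨i, rfl⟩ := Nat.exists_eq_add_of_le' hj
  have : k / K * K ^ (i + 1) = k * K ^ i := by rw [pow_succ]; field_simp
  rw [this, pow_succ']
  gcongr

lemma geom_le (M : ℕ) : ∑ i ∈ Finset.range M, (2 : ℝ) ^ (i + 1) ≤ 2 * 2 ^ M := by
  induction M with
  | zero => simp
  | succ M ih => rw [Finset.sum_range_succ, pow_succ]; nlinarith [ih]

end CSL

/-- Lower bound in the proof of the main congruence theorem: under the Lang–Weil type
hypothesis and the Fouvry type cube-count hypothesis, for every very well shaped `Ω`,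
`T_p(Ω) ≥ #X_p μ(Ω) − c (p^{m−n−1/(2(n+1))} μ(Ω)^{1−1/m} log p + p^{m−n−1/2} (log p)^{n+2})`
with `c = c(m,n,ν,A,C)`. -/
theorem congruence_solutions_lower_bound
    (m n : ℕ) (hn : 1 ≤ n) (hm : n + 1 ≤ m) (ν A C : ℝ) (hν : 1 ≤ ν) (hA : 0 < A) :
    ∃ c : ℝ, 0 < c ∧
      ∀ p : ℕ, p.Prime →
        ∀ F : Fin n → MvPolynomial (Fin m) ℤ,
          |(((polySolutions p F).ncard : ℝ)) - ν * (p : ℝ) ^ (m - n)|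
              ≤ A * (p : ℝ) ^ ((m : ℝ) - n - 1 / 2) →
          (∀ k : ℕ, 1 ≤ k → k ≤ p → ∀ γ : Fin m → ℝ, ∀ u : Fin m → ℤ,
            |((Tcount p F (gridCube γ k u) : ℝ))
                - ((polySolutions p F).ncard : ℝ) / (k : ℝ) ^ m|
              ≤ A * ((p : ℝ) ^ (((m : ℝ) - n) / 2) * Real.log p ^ m
                  + ((k : ℝ) ^ (m - n - 1))⁻¹ * (p : ℝ) ^ ((m : ℝ) - n - 1 / 2) *
                      Real.log p ^ (n + 1))) →
          ∀ Ω : Set (Torus m), IsVeryWellShaped Ω C →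
            ((polySolutions p F).ncard : ℝ) * tmeas Ω
                - c * ((p : ℝ) ^ ((m : ℝ) - n - 1 / (2 * ((n : ℝ) + 1))) *
                      tmeas Ω ^ (1 - 1 / (m : ℝ)) * Real.log p
                    + (p : ℝ) ^ ((m : ℝ) - n - 1 / 2) * Real.log p ^ (n + 2))
              ≤ (Tcount p F Ω : ℝ) := by

  have hm1 : 1 ≤ m := by omega
  set D : ℝ := |C| * (2 * m) ^ m with hD
  have hD0 : 0 ≤ D := by positivity
  set c1 : ℝ := 4 + 2 * 4 ^ (n + 1) with hc1
  set c2 : ℝ := 4 + 2 * (2 ^ m + 1) with hc2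
  refine ⟨D * (ν + A) * c1 + D * 2 ^ m * A * c2 + 1, by positivity, ?_⟩
  intro p hpp F hX hT Ω hΩ
  have hp : 2 ≤ p := hpp.two_le
  have hp0 : (0 : ℝ) < p := by exact_mod_cast (by omega : 0 < p)
  have hp1 : (1 : ℝ) ≤ p := by exact_mod_cast (by omega : 1 ≤ p)
  have hL := CSL.half_le_log hp
  have hLp : 0 ≤ Real.log p := by linarith
  have ha1 : 1 / (2 * ((n : ℝ) + 1)) ≤ 1 := by
    rw [div_le_one (by positivity)]
    have : (0 : ℝ) ≤ n := Nat.cast_nonneg n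
    linarith
  obtain ⟨M, hM1, hM2, hM3⟩ := CSL.pick hp _ ha1
  have hML := CSL.M_le hp hM3
  have g1 := CSL.f1 hp hm
  have g4 := CSL.f4 hp hm (2 ^ M) (by positivity) hM2
  have g5 := CSL.f5 hp hm (2 ^ M) (one_le_pow₀ (by norm_num)) hM2
  have hne := CSL.ne_univ hm1 Ω C hΩ
  set X : ℝ := ((polySolutions p F).ncard : ℝ) with hXdef
  have hX0 : 0 ≤ X := Nat.cast_nonneg _
  set L := Real.log p with hLdef
  set R := (p : ℝ) ^ ((m : ℝ) - n - 1 / 2) with hR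
  have hR0 : 0 ≤ R := by positivity
  set P := (p : ℝ) ^ (((m : ℝ) - n) / 2) with hP
  have hP0 : 0 ≤ P := by positivity
  set Z := (p : ℝ) ^ ((m : ℝ) - n - 1 / (2 * ((n : ℝ) + 1))) with hZ
  have hZ0 : 0 ≤ Z := by positivity
  set w := tmeas Ω ^ (1 - 1 / (m : ℝ)) with hw
  have hw0 : 0 ≤ w := Real.rpow_nonneg (CSL.tmeas_nonneg _) _
  have hXle : X ≤ (ν + A) * (p : ℝ) ^ (m - n) := by
    have h1 := (abs_le.1 hX).2
    have h2 : R ≤ (p : ℝ) ^ (m - n) := by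
      rw [← Real.rpow_natCast, Nat.cast_sub (by omega)]
      exact Real.rpow_le_rpow_of_exponent_le hp1 (by linarith)
    nlinarith
  have hs : R * L ^ (n + 1) ≤ 2 * (R * L ^ (n + 2)) := by
    have : 0 ≤ R * L ^ (n + 1) := by positivity
    rw [pow_succ L (n + 1)]
    nlinarith
  have hmain := CSL.main_sum (p := p) F X
    (fun i => A * (P * L ^ m + (((2 ^ (i + 1) : ℕ) : ℝ) ^ (m - n - 1))⁻¹ * R * L ^ (n + 1))) M
    (fun i hi u => hT (2 ^ (i + 1)) Nat.one_le_two_pow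
      ((Nat.pow_le_pow_right (by norm_num) hi).trans hM3) _ u) Ω hne
  have hTm : (Tcount p F (CSL.inner Ω M) : ℝ) ≤ Tcount p F Ω := by
    exact_mod_cast CSL.tcount_mono F _ _ (CSL.inner_sub Ω M)
  have hdM := CSL.diff_bound hm1 Ω C hΩ M
  have hsub : tmeas Ω ≤ tmeas (CSL.inner Ω M) + tmeas (Ω \ CSL.inner Ω M) :=
    CSL.tmeas_sub _ _ (CSL.inner_sub Ω M)
  have hterm : ∀ i ∈ Finset.range M,
      tmeas (CSL.inner Ω (i + 1) \ CSL.inner Ω i) * ((2 ^ (i + 1) : ℕ) : ℝ) ^ m *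
        (A * (P * L ^ m + (((2 ^ (i + 1) : ℕ) : ℝ) ^ (m - n - 1))⁻¹ * R * L ^ (n + 1)))
      ≤ D * 2 ^ m * A * (2 * (w * (Z * L)) / 2 ^ M * 2 ^ (i + 1)
          + (2 ^ m + 1) * (R * L ^ (n + 1))) := by
    intro i hi
    rw [Finset.mem_range] at hi
    have hKL : (2 : ℝ) ^ M * L ≤ (p : ℝ) ^ (1 / (2 * ((n : ℝ) + 1))) := by
      rcases hM1 with h | h
      · omega
      · exact h
    have g2 := CSL.f2 hp hm (2 ^ M) (by positivity) hKL
    have g3 := CSL.f3 (m := m) hp (2 ^ M) (by positivity) hKL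
    have hE : tmeas (CSL.inner Ω (i + 1) \ CSL.inner Ω i) ≤
        D * (w / 2 ^ i + 1 / (2 ^ i) ^ m) :=
      (CSL.tmeas_mono _ _ (Set.sdiff_subset_sdiff_left (CSL.inner_sub Ω (i + 1)))).trans
        (CSL.diff_bound hm1 Ω C hΩ i)
    push_cast
    have hk1 : (1 : ℝ) ≤ 2 ^ (i + 1) := one_le_pow₀ (by norm_num)
    have hkK : (2 : ℝ) ^ (i + 1) ≤ 2 ^ M := pow_le_pow_right₀ (by norm_num) hi
    have hik : (2 : ℝ) ^ i = 2 ^ (i + 1) / 2 := by rw [pow_succ]; ring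
    rw [hik] at hE
    generalize (2 : ℝ) ^ (i + 1) = k at *
    generalize hKe : (2 : ℝ) ^ M = K at *
    have hk0 : 0 < k := by linarith
    have hK0 : 0 < K := by linarith
    have s1 := CSL.pow_shift k K hk0.le hkK hK0 (m - 1) (by omega)
    have s2 := CSL.pow_shift k K hk0.le hkK hK0 n hn
    have em : k ^ m = k * k ^ (m - 1) := by rw [← pow_succ']; congr 1; omega
    have emn : k ^ (m - 1) * (k ^ (m - n - 1))⁻¹ = k ^ n := by
      have : k ^ (m - 1) = k ^ n * k ^ (m - n - 1) := by rw [← pow_add]; congr 1; omega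
      rw [this]; field_simp
    have hkinv : (k ^ (m - n - 1))⁻¹ ≤ 1 := inv_le_one_of_one_le₀ (one_le_pow₀ hk1)
    have two_le : (2 : ℝ) ≤ 2 ^ m := le_self_pow₀ (by norm_num) (by omega)
    have hEk : tmeas (CSL.inner Ω (i + 1) \ CSL.inner Ω i) * k ^ m ≤
        D * 2 ^ m * (w * k ^ (m - 1) + 1) := by
      calc _ ≤ D * (w / (k / 2) + 1 / (k / 2) ^ m) * k ^ m := by gcongr
        _ = D * (2 * (w * k ^ (m - 1)) + 2 ^ m) := by
            have e1 : 1 / (k / 2) ^ m * k ^ m = 2 ^ m := by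
              rw [div_pow]; field_simp
            have e2 : w / (k / 2) * k ^ m = 2 * (w * k ^ (m - 1)) := by
              rw [em]; field_simp
            rw [mul_assoc, add_mul, e1, e2]
        _ ≤ D * (2 ^ m * (w * k ^ (m - 1)) + 2 ^ m) := by gcongr
        _ = _ := by ring
    have hI : 0 ≤ (k ^ (m - n - 1))⁻¹ := by positivity
    have t1 : k ^ (m - 1) * (P * L ^ m) ≤ k / K * (Z * L) := by
      calc _ ≤ k / K * K ^ (m - 1) * (P * L ^ m) := by gcongr
        _ = k / K * (K ^ (m - 1) * (P * L ^ m)) := by ring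
        _ ≤ _ := by gcongr
    have t2 : k ^ n * (R * L ^ (n + 1)) ≤ k / K * (Z * L) := by
      calc _ ≤ k / K * K ^ n * (R * L ^ (n + 1)) := by gcongr
        _ = k / K * (K ^ n * (R * L ^ (n + 1))) := by ring
        _ ≤ _ := by gcongr
    have t3 : (k ^ (m - n - 1))⁻¹ * (R * L ^ (n + 1)) ≤ R * L ^ (n + 1) :=
      mul_le_of_le_one_left (by positivity) hkinv
    calc _ ≤ D * 2 ^ m * (w * k ^ (m - 1) + 1) *
          (A * (P * L ^ m + (k ^ (m - n - 1))⁻¹ * R * L ^ (n + 1))) := by gcongr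
      _ = D * 2 ^ m * A * (w * (k ^ (m - 1) * (P * L ^ m)
            + (k ^ (m - 1) * (k ^ (m - n - 1))⁻¹) * (R * L ^ (n + 1)))
            + (P * L ^ m + (k ^ (m - n - 1))⁻¹ * (R * L ^ (n + 1)))) := by ring
      _ ≤ D * 2 ^ m * A * (w * (k / K * (Z * L) + k / K * (Z * L))
            + (2 ^ m * (R * L ^ (n + 1)) + R * L ^ (n + 1))) := by
          rw [emn]; gcongr
      _ = _ := by ring
  have hsum := Finset.sum_le_sum hterm
  have hsum2 : ∑ i ∈ Finset.range M, D * 2 ^ m * A * (2 * (w * (Z * L)) / 2 ^ M * 2 ^ (i + 1)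
          + (2 ^ m + 1) * (R * L ^ (n + 1)))
      ≤ D * 2 ^ m * A * (c2 * (Z * w * L + R * L ^ (n + 2))) := by
    rw [← Finset.mul_sum, Finset.sum_add_distrib, ← Finset.mul_sum, Finset.sum_const,
      Finset.card_range, nsmul_eq_mul]
    gcongr D * 2 ^ m * A * ?_
    have q1 : 2 * (w * (Z * L)) / 2 ^ M * ∑ i ∈ Finset.range M, (2 : ℝ) ^ (i + 1)
        ≤ 4 * (Z * w * L) := by
      calc _ ≤ 2 * (w * (Z * L)) / 2 ^ M * (2 * 2 ^ M) := by
            gcongr; exact CSL.geom_le M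
        _ = _ := by field_simp; ring
    have q2 : (M : ℝ) * ((2 ^ m + 1) * (R * L ^ (n + 1)))
        ≤ 2 * (2 ^ m + 1) * (R * L ^ (n + 2)) := by
      calc _ ≤ 2 * L * ((2 ^ m + 1) * (R * L ^ (n + 1))) := by gcongr
        _ = _ := by ring
    have q3 : 0 ≤ Z * w * L := by positivity
    have q4 : 0 ≤ R * L ^ (n + 2) := by positivity
    have q5 : (0 : ℝ) ≤ 2 ^ m + 1 := by positivity
    have q6 := mul_nonneg q5 q3
    rw [hc2]
    linarith
  have hlast : X * tmeas (Ω \ CSL.inner Ω M) ≤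
      D * (ν + A) * (c1 * (Z * w * L + R * L ^ (n + 2))) := by
    calc _ ≤ (ν + A) * (p : ℝ) ^ (m - n) * (D * (w / 2 ^ M + 1 / (2 ^ M) ^ m)) :=
          mul_le_mul hXle hdM (CSL.tmeas_nonneg _) (by positivity)
      _ = D * (ν + A) * (w * ((p : ℝ) ^ (m - n) / 2 ^ M) + (p : ℝ) ^ (m - n) / (2 ^ M) ^ m) := by
          ring
      _ ≤ D * (ν + A) * (w * (4 * (Z * L)) + 4 ^ (n + 1) * (2 * (R * L ^ (n + 2)))) := by
          gcongr
          exact g5.trans (by gcongr)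
      _ ≤ _ := by
          gcongr D * (ν + A) * ?_
          have q3 : 0 ≤ Z * w * L := by positivity
          have q4 : 0 ≤ R * L ^ (n + 2) := by positivity
          have q5 : (0 : ℝ) ≤ 4 ^ (n + 1) := by positivity
          have q6 := mul_nonneg q5 q3
          rw [hc1]
          linarith
  have hXs := mul_le_mul_of_nonneg_left hsub hX0
  have q7 : 0 ≤ Z * w * L + R * L ^ (n + 2) := by positivity
  linarith
end
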